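/- Theorem A.1 (convexity of the forward map in the reflection coefficient, pointwise in ω): Let α, β ≥ 0 with α + β = 1, let η₁, η₂ : (0,∞) → [0,1] satisfy η₁(ω) ≥ η₂(ω) for all ω > 0, and let φ : [0,T_max]×(0,1]×(0,∞) → ℝ be a bounded nonnegative incoming datum. Let g₁, g₂, and g be bounded solutions of the linearized phonon transport equation with zero initial data, the same incoming boundary condition φ at x = 0 for μ > 0, and reflective boundary conditions at x = 1 for μ < 0 with reflection coefficients η₁, η₂, and α η₁ + β η₂, respectively. Then for all t ∈ [0,T_max], ⟨ω g⟩(t,0) ≤ α ⟨ω g₁⟩(t,0) + β ⟨ω g₂⟩(t,0); equivalently, with ΔT_g = ⟨ω g⟩/⟨ω g*⟩, one has α ΔT_{g₁}(t,0) + β ΔT_{g₂}(t,0) ≥ ΔT_g(t,0). -/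

import Mathlib

open MeasureTheory Set

/-- `g*(ω) = ω² eʷ/(eʷ−1)²`. -/
noncomputable def gstar (ω : ℝ) : ℝ := ω ^ 2 * Real.exp ω / (Real.exp ω - 1) ^ 2

/-- Bracket: `⟨f⟩ = ∫_{ω>0} ∫_{μ∈[−1,1]} f(μ,ω) dμ dω`. -/
noncomputable def bracket (f : ℝ → ℝ → ℝ) : ℝ :=
  ∫ ω in Ioi (0:ℝ), ∫ μ in Icc (-1:ℝ) 1, f μ ω

/-- `⟨ω g*⟩ = 2 ∫_0^∞ ω g*(ω) dω`. -/
noncomputable def wgstar : ℝ := 2 * ∫ ω in Ioi (0:ℝ), ω * gstar ω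

/-- Normalized Maxwellian `M(ω) = ω g*(ω)/⟨ω g*⟩`. -/
noncomputable def Mw (ω : ℝ) : ℝ := ω * gstar ω / wgstar

/-- Linearized BGK collision operator `(𝓛g)(μ,ω) = −ω g(μ,ω) + M(ω) ⟨ω g⟩`. -/
noncomputable def coll (g : ℝ → ℝ → ℝ) (μ ω : ℝ) : ℝ :=
  -(ω * g μ ω) + Mw ω * bracket (fun μ' ω' => ω' * g μ' ω')

/-- Integrability of `f(μ,ω)` sufficient for the iterated bracket to be finite. -/
def BracketIntegrable (f : ℝ → ℝ → ℝ) : Prop :=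
  (∀ ω ∈ Ioi (0:ℝ), IntegrableOn (fun μ => f μ ω) (Icc (-1:ℝ) 1)) ∧
  IntegrableOn (fun ω => ∫ μ in Icc (-1:ℝ) 1, f μ ω) (Ioi (0:ℝ))

/-- The forward linearized phonon transport equation
`∂_t g + μ ω ∂_x g = −ω g + M(ω)⟨ω g⟩(t,x)` on `[0,T]×[0,1]×[−1,1]×(0,∞)`,
together with differentiability of the solution in `t` and `x`. -/
def SatisfiesPTE (Tmax : ℝ) (g : ℝ → ℝ → ℝ → ℝ → ℝ) : Prop :=
  ∀ t ∈ Icc (0:ℝ) Tmax, ∀ x ∈ Icc (0:ℝ) 1, ∀ μ ∈ Icc (-1:ℝ) 1, ∀ ω ∈ Ioi (0:ℝ),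
    DifferentiableAt ℝ (fun s => g s x μ ω) t ∧
    DifferentiableAt ℝ (fun y => g t y μ ω) x ∧
    deriv (fun s => g s x μ ω) t + μ * ω * deriv (fun y => g t y μ ω) x
      = coll (fun μ' ω' => g t x μ' ω') μ ω

/-- The adjoint equation `∂_t h + μ ω ∂_x h = ω h − M(ω)⟨ω h⟩ = −𝓛h`. -/
def SatisfiesAdjointPTE (Tmax : ℝ) (h : ℝ → ℝ → ℝ → ℝ → ℝ) : Prop :=
  ∀ t ∈ Icc (0:ℝ) Tmax, ∀ x ∈ Icc (0:ℝ) 1, ∀ μ ∈ Icc (-1:ℝ) 1, ∀ ω ∈ Ioi (0:ℝ),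
    DifferentiableAt ℝ (fun s => h s x μ ω) t ∧
    DifferentiableAt ℝ (fun y => h t y μ ω) x ∧
    deriv (fun s => h s x μ ω) t + μ * ω * deriv (fun y => h t y μ ω) x
      = -(coll (fun μ' ω' => h t x μ' ω') μ ω)

/-- Boundedness of a function of `(t,x,μ,ω)`. -/
def BoundedFn (g : ℝ → ℝ → ℝ → ℝ → ℝ) : Prop := ∃ B, ∀ t x μ ω, |g t x μ ω| ≤ B

/-- `ω g(t,x,·,·)` is integrable in `(μ,ω)` at every point of the domain, so
that `⟨ω g⟩(t,x)` is finite. -/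
def BracketIntegrableSol (Tmax : ℝ) (g : ℝ → ℝ → ℝ → ℝ → ℝ) : Prop :=
  ∀ t ∈ Icc (0:ℝ) Tmax, ∀ x ∈ Icc (0:ℝ) 1,
    BracketIntegrable (fun μ ω => ω * g t x μ ω)

/-- `g` is a bounded-domain solution of the forward problem with reflection
coefficient `η` and incoming datum `φ`: the PDE, zero initial data, incoming
boundary condition at `x = 0` for `μ > 0`, and reflective boundary condition
at `x = 1` for `μ < 0`. -/
def IsForwardSolution (Tmax : ℝ) (η : ℝ → ℝ) (φ : ℝ → ℝ → ℝ → ℝ)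
    (g : ℝ → ℝ → ℝ → ℝ → ℝ) : Prop :=
  SatisfiesPTE Tmax g ∧
  (∀ x ∈ Icc (0:ℝ) 1, ∀ μ ∈ Icc (-1:ℝ) 1, ∀ ω ∈ Ioi (0:ℝ), g 0 x μ ω = 0) ∧
  (∀ t ∈ Icc (0:ℝ) Tmax, ∀ μ ∈ Ioc (0:ℝ) 1, ∀ ω ∈ Ioi (0:ℝ), g t 0 μ ω = φ t μ ω) ∧
  (∀ t ∈ Icc (0:ℝ) Tmax, ∀ μ ∈ Ico (-1:ℝ) 0, ∀ ω ∈ Ioi (0:ℝ), g t 1 μ ω = η ω * g t 1 (-μ) ω)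

/-- `h` is a bounded-domain solution of the adjoint problem with reflection
coefficient `η` and measurement profile `ψ`: the adjoint PDE, zero final data
at `t = Tmax`, boundary condition `h(t,0,μ,ω) = ψ(t) g*(ω)/μ` for `μ < 0`,
and reflective boundary condition at `x = 1` for `μ > 0`. -/
def IsAdjointSolution (Tmax : ℝ) (η : ℝ → ℝ) (ψ : ℝ → ℝ)
    (h : ℝ → ℝ → ℝ → ℝ → ℝ) : Prop :=
  SatisfiesAdjointPTE Tmax h ∧
  (∀ x ∈ Icc (0:ℝ) 1, ∀ μ ∈ Icc (-1:ℝ) 1, ∀ ω ∈ Ioi (0:ℝ), h Tmax x μ ω = 0) ∧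
  (∀ t ∈ Icc (0:ℝ) Tmax, ∀ μ ∈ Ico (-1:ℝ) 0, ∀ ω ∈ Ioi (0:ℝ), h t 0 μ ω = ψ t * gstar ω / μ) ∧
  (∀ t ∈ Icc (0:ℝ) Tmax, ∀ μ ∈ Ioc (0:ℝ) 1, ∀ ω ∈ Ioi (0:ℝ), h t 1 μ ω = η ω * h t 1 (-μ) ω)

section

open MeasureTheory Set Filter Topology

/-- If a property of intervals is stable under gluing and holds for all intervals of length between
`δ` and `2 * δ`, then it holds for all longer intervals as well. -/
theorem interval_bisection {S : ℝ → ℝ → Prop} {a₀ b₀ δ : ℝ} (hδ : 0 < δ)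
    (glue : ∀ a m b, a₀ ≤ a → a ≤ m → m ≤ b → b ≤ b₀ → S a m → S m b → S a b)
    (small : ∀ a b, a₀ ≤ a → b ≤ b₀ → δ ≤ b - a → b - a ≤ 2 * δ → S a b) :
    ∀ a b, a₀ ≤ a → b ≤ b₀ → δ ≤ b - a → S a b := by
  have key : ∀ n : ℕ, ∀ a b, a₀ ≤ a → b ≤ b₀ → δ ≤ b - a → b - a ≤ 2 ^ n * (2 * δ) → S a b := by
    intro n
    induction n with
    | zero => intro a b ha hb h1 h2; exact small a b ha hb h1 (by simpa using h2)
    | succ n ih =>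
      intro a b ha hb h1 h2
      by_cases h : b - a ≤ 2 * δ
      · exact small a b ha hb h1 h
      · push Not at h
        rw [pow_succ] at h2
        refine glue a ((a + b) / 2) b ha (by linarith) (by linarith) hb
          (ih _ _ ha (by linarith) (by linarith) (by nlinarith))
          (ih _ _ (by linarith) hb (by linarith) (by nlinarith))
  intro a b ha hb h
  obtain ⟨n, hn⟩ := pow_unbounded_of_one_lt ((b - a) / (2 * δ)) (one_lt_two)
  refine key n a b ha hb h ?_
  rw [div_lt_iff₀ (by linarith)] at hn
  exact hn.le

/-- The outward flux of `(p, q)` through the boundary of `[a, b] × [c, d]`. -/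
noncomputable def rectFlux (p q : ℝ → ℝ → ℝ) (a b c d : ℝ) : ℝ :=
  (∫ x in c..d, (p b x - p a x)) + ∫ t in a..b, (q t d - q t c)

/-- Locally bounded, separately continuous functions on the plane. -/
structure SepCont (f : ℝ → ℝ → ℝ) : Prop where
  left : ∀ x, Continuous fun t => f t x
  right : ∀ t, Continuous fun x => f t x
  bdd : ∀ R, ∃ B, ∀ t x, |t| ≤ R → |x| ≤ R → |f t x| ≤ B

namespace SepCont

variable {p q : ℝ → ℝ → ℝ}

theorem continuous_integral_right (hp : SepCont p) (c d : ℝ) :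
    Continuous fun t => ∫ x in c..d, p t x := by
  rw [continuous_iff_continuousAt]
  intro t₀
  obtain ⟨B, hB⟩ := hp.bdd (max (|t₀| + 1) (max |c| |d|))
  refine intervalIntegral.continuousAt_of_dominated_interval (bound := fun _ => B)
    (Eventually.of_forall fun t => (hp.right t).aestronglyMeasurable) ?_
    intervalIntegrable_const (ae_of_all _ fun x _ => (hp.left x).continuousAt)
  filter_upwards [Metric.ball_mem_nhds t₀ one_pos] with t ht
  refine ae_of_all _ fun x hx => hB t x (le_max_of_le_left ?_) (le_max_of_le_right ?_)
  · rw [Metric.mem_ball, Real.dist_eq] at ht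
    have := abs_add_le (t - t₀) t₀
    rw [sub_add_cancel] at this
    linarith
  · exact abs_le_max_abs_abs (uIoc_subset_uIcc hx).1 (uIoc_subset_uIcc hx).2 |>.trans
      (by rcases le_total c d with h | h <;> simp [h, le_total])

theorem swap (hp : SepCont p) : SepCont fun x t => p t x :=
  ⟨hp.right, hp.left, fun R => let ⟨B, hB⟩ := hp.bdd R; ⟨B, fun t x ht hx => hB x t hx ht⟩⟩

theorem rectFlux_glue_left (hp : SepCont p) (hq : SepCont q) (a m b c d : ℝ) :
    rectFlux p q a b c d = rectFlux p q a m c d + rectFlux p q m b c d := by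
  have i1 : ∀ t, IntervalIntegrable (p t) volume c d := fun t => (hp.right t).intervalIntegrable _ _
  have i2 : ∀ x s t, IntervalIntegrable (fun t => q t x) volume s t :=
    fun x s t => (hq.left x).intervalIntegrable _ _
  have := intervalIntegral.integral_add_adjacent_intervals (μ := volume) (f := fun t => q t d - q t c)
    (a := a) (b := m) (c := b) ((i2 _ _ _).sub (i2 _ _ _)) ((i2 _ _ _).sub (i2 _ _ _))
  simp only [rectFlux, intervalIntegral.integral_sub (i1 _) (i1 _)]
  rw [← this]; ring

theorem rectFlux_glue_right (hp : SepCont p) (hq : SepCont q) (a b c m d : ℝ) :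
    rectFlux p q a b c d = rectFlux p q a b c m + rectFlux p q a b m d := by
  have e : ∀ a b c d, rectFlux p q a b c d = rectFlux (fun x t => q t x) (fun x t => p t x) c d a b := by
    intros; simp only [rectFlux]; ring
  rw [e, hq.swap.rectFlux_glue_left hp.swap c m d a b, ← e, ← e]

theorem continuous_rectFlux₁ (hp : SepCont p) (hq : SepCont q) (b c d : ℝ) :
    Continuous fun a => rectFlux p q a b c d := by
  have i1 : ∀ t, IntervalIntegrable (p t) volume c d := fun t => (hp.right t).intervalIntegrable _ _
  simp only [rectFlux, intervalIntegral.integral_sub (i1 _) (i1 _)]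
  refine (continuous_const.sub (hp.continuous_integral_right c d)).add ?_
  have e : (fun a => ∫ t in a..b, (q t d - q t c)) = fun a => -∫ t in b..a, (q t d - q t c) :=
    funext fun a => intervalIntegral.integral_symm b a
  rw [e]
  exact (intervalIntegral.continuous_primitive
    (fun s t => ((hq.left d).sub (hq.left c)).intervalIntegrable s t) b).neg

theorem continuous_rectFlux₂ (hp : SepCont p) (hq : SepCont q) (a c d : ℝ) :
    Continuous fun b => rectFlux p q a b c d := by
  have i1 : ∀ t, IntervalIntegrable (p t) volume c d := fun t => (hp.right t).intervalIntegrable _ _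
  simp only [rectFlux, intervalIntegral.integral_sub (i1 _) (i1 _)]
  exact ((hp.continuous_integral_right c d).sub continuous_const).add
    (intervalIntegral.continuous_primitive
      (fun s t => ((hq.left d).sub (hq.left c)).intervalIntegrable s t) a)

theorem rectFlux_swap (p q : ℝ → ℝ → ℝ) (a b c d : ℝ) :
    rectFlux p q a b c d = rectFlux (fun x t => q t x) (fun x t => p t x) c d a b := by
  simp only [rectFlux]; ring

theorem continuous_rectFlux₃ (hp : SepCont p) (hq : SepCont q) (a b d : ℝ) :
    Continuous fun c => rectFlux p q a b c d := by
  simp_rw [rectFlux_swap p q]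
  exact hq.swap.continuous_rectFlux₁ hp.swap d a b

theorem continuous_rectFlux₄ (hp : SepCont p) (hq : SepCont q) (a b c : ℝ) :
    Continuous fun d => rectFlux p q a b c d := by
  simp_rw [rectFlux_swap p q]
  exact hq.swap.continuous_rectFlux₂ hp.swap c a b

end SepCont

/-- The flux of `(p, q)` through the boundary of `[a, b] × [c, d]` is at most `κ` times the area. -/
def FluxLE (p q : ℝ → ℝ → ℝ) (κ a b c d : ℝ) : Prop :=
  |rectFlux p q a b c d| ≤ κ * ((b - a) * (d - c))

namespace FluxLE

variable {p q : ℝ → ℝ → ℝ} {κ : ℝ}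

theorem glue_left (hp : SepCont p) (hq : SepCont q) {a m b c d : ℝ}
    (h1 : FluxLE p q κ a m c d) (h2 : FluxLE p q κ m b c d) : FluxLE p q κ a b c d := by
  unfold FluxLE at *
  rw [hp.rectFlux_glue_left hq a m b]
  refine (abs_add_le _ _).trans ((add_le_add h1 h2).trans (le_of_eq (by ring)))

theorem glue_right (hp : SepCont p) (hq : SepCont q) {a b c m d : ℝ}
    (h1 : FluxLE p q κ a b c m) (h2 : FluxLE p q κ a b m d) : FluxLE p q κ a b c d := by
  unfold FluxLE at *
  rw [hp.rectFlux_glue_right hq a b c m]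
  refine (abs_add_le _ _).trans ((add_le_add h1 h2).trans (le_of_eq (by ring)))

theorem of_left_eq (p q : ℝ → ℝ → ℝ) (κ a c d : ℝ) : FluxLE p q κ a a c d := by
  simp [FluxLE, rectFlux]

theorem of_right_eq (p q : ℝ → ℝ → ℝ) (κ a b c : ℝ) : FluxLE p q κ a b c c := by
  simp [FluxLE, rectFlux]

/-- It suffices to bound the flux on rectangles with small sides. -/
theorem of_small (hp : SepCont p) (hq : SepCont q) {δ : ℝ} (hδ : 0 < δ) {a b c d : ℝ}
    (hab : a ≤ b) (hcd : c ≤ d)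
    (small : ∀ a' b' c' d', a ≤ a' → a' ≤ b' → b' ≤ b → c ≤ c' → c' ≤ d' → d' ≤ d →
      b' - a' ≤ δ → d' - c' ≤ δ → FluxLE p q κ a' b' c' d') : FluxLE p q κ a b c d := by
  have h1 : ∀ a' b', a ≤ a' → a' ≤ b' → b' ≤ b → b' - a' ≤ δ → FluxLE p q κ a' b' c d := by
    intro a' b' ha hab hb hl
    by_cases h : d - c ≤ δ
    · exact small a' b' c d ha hab hb le_rfl hcd le_rfl hl h
    · push Not at h
      refine interval_bisection (S := fun c d => FluxLE p q κ a' b' c d) (half_pos hδ)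
        (fun _ _ _ _ _ _ _ => glue_right hp hq) ?_ c d le_rfl le_rfl (by linarith)
      intro c' d' hc hd h1 h2
      exact small a' b' c' d' ha hab hb hc (by linarith) hd hl (by linarith)
  by_cases h : b - a ≤ δ
  · exact h1 a b le_rfl hab le_rfl h
  · push Not at h
    refine interval_bisection (S := fun a b => FluxLE p q κ a b c d) (half_pos hδ)
      (fun _ _ _ _ _ _ _ => glue_left hp hq) ?_ a b le_rfl le_rfl (by linarith)
    intro a' b' ha hb h1' h2
    exact h1 a' b' ha (by linarith) hb (by linarith)

/-- It suffices to bound the flux on rectangles of aspect ratio at most two. -/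
theorem of_aspect (hp : SepCont p) (hq : SepCont q) {a b c d : ℝ}
    (hab : a ≤ b) (hcd : c ≤ d)
    (H : ∀ a' b' c' d', a ≤ a' → a' ≤ b' → b' ≤ b → c ≤ c' → c' ≤ d' → d' ≤ d →
      b' - a' ≤ 2 * (d' - c') → d' - c' ≤ 2 * (b' - a') → FluxLE p q κ a' b' c' d') :
    FluxLE p q κ a b c d := by
  rcases hab.eq_or_lt with rfl | hab
  · exact of_left_eq ..
  rcases hcd.eq_or_lt with rfl | hcd
  · exact of_right_eq ..
  rcases le_total (b - a) (d - c) with h | h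
  · refine interval_bisection (S := fun c d => FluxLE p q κ a b c d) (sub_pos.2 hab)
      (fun _ _ _ _ _ _ _ => glue_right hp hq) ?_ c d le_rfl le_rfl h
    intro c' d' hc hd h1 h2
    exact H a b c' d' le_rfl hab.le le_rfl hc (by linarith) hd (by linarith) h2
  · refine interval_bisection (S := fun a b => FluxLE p q κ a b c d) (sub_pos.2 hcd)
      (fun _ _ _ _ _ _ _ => glue_left hp hq) ?_ a b le_rfl le_rfl h
    intro a' b' ha hb h1 h2
    exact H a' b' c d ha (by linarith) hb le_rfl hcd.le le_rfl h2 (by linarith)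

/-- A local bound on the flux extends to compact rectangles. -/
theorem of_local (hp : SepCont p) (hq : SepCont q) {a b c d : ℝ} (hab : a ≤ b) (hcd : c ≤ d)
    (H : ∀ z ∈ Icc a b ×ˢ Icc c d, ∃ V ∈ 𝓝 z, ∀ a' b' c' d', a' ≤ b' → c' ≤ d' →
      Icc a' b' ×ˢ Icc c' d' ⊆ V → FluxLE p q κ a' b' c' d') : FluxLE p q κ a b c d := by
  have hK : IsCompact (Icc a b ×ˢ Icc c d) := isCompact_Icc.prod isCompact_Icc
  choose! V hV hF using H
  obtain ⟨δ, hδ, hleb⟩ := lebesgue_number_lemma_of_metric hK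
    (c := fun z : Icc a b ×ˢ Icc c d => interior (V z)) (fun _ => isOpen_interior)
    (fun z hz => mem_iUnion.2 ⟨⟨z, hz⟩, mem_interior_iff_mem_nhds.2 (hV z hz)⟩)
  refine of_small hp hq (half_pos hδ) hab hcd ?_
  intro a' b' c' d' ha hab' hb hc hcd' hd h1 h2
  obtain ⟨⟨y, hy⟩, hy'⟩ := hleb (a', c') ⟨⟨ha, hab'.trans hb⟩, ⟨hc, hcd'.trans hd⟩⟩
  refine hF y hy a' b' c' d' hab' hcd' (subset_trans ?_ (hy'.trans interior_subset))
  rintro ⟨t, x⟩ ⟨⟨ht1, ht2⟩, ⟨hx1, hx2⟩⟩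
  simp only at ht1 ht2 hx1 hx2
  rw [Metric.mem_ball, Prod.dist_eq, max_lt_iff, Real.dist_eq, Real.dist_eq, abs_lt, abs_lt]
  simp only
  constructor <;> constructor <;> linarith

/-- A bound on all compact rectangles inside an open rectangle extends to its closure. -/
theorem of_interior (hp : SepCont p) (hq : SepCont q) {a b c d : ℝ} (hab : a ≤ b) (hcd : c ≤ d)
    (H : ∀ a' b' c' d', a < a' → a' ≤ b' → b' < b → c < c' → c' ≤ d' → d' < d →
      FluxLE p q κ a' b' c' d') : FluxLE p q κ a b c d := by
  rcases hab.eq_or_lt with rfl | hab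
  · exact of_left_eq ..
  rcases hcd.eq_or_lt with rfl | hcd
  · exact of_right_eq ..
  have h1 : ∀ b' c' d', a < b' → b' < b → c < c' → c' ≤ d' → d' < d → FluxLE p q κ a b' c' d' := by
    intro b' c' d' hb hb' hc hcd hd
    have e1 : Tendsto (fun a' => |rectFlux p q a' b' c' d'|) (𝓝[>] a) (𝓝 |rectFlux p q a b' c' d'|) :=
      ((hp.continuous_rectFlux₁ hq b' c' d').abs.tendsto a).mono_left nhdsWithin_le_nhds
    have e2 : Tendsto (fun a' => κ * ((b' - a') * (d' - c'))) (𝓝[>] a)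
        (𝓝 (κ * ((b' - a) * (d' - c')))) :=
      (Continuous.tendsto (by fun_prop) a).mono_left nhdsWithin_le_nhds
    refine le_of_tendsto_of_tendsto e1 e2 ?_
    filter_upwards [Ioo_mem_nhdsGT hb] with a' ha'
    exact H a' b' c' d' ha'.1 ha'.2.le hb' hc hcd hd
  have h2 : ∀ c' d', c < c' → c' ≤ d' → d' < d → FluxLE p q κ a b c' d' := by
    intro c' d' hc hcd hd
    have e1 : Tendsto (fun b' => |rectFlux p q a b' c' d'|) (𝓝[<] b) (𝓝 |rectFlux p q a b c' d'|) :=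
      ((hp.continuous_rectFlux₂ hq a c' d').abs.tendsto b).mono_left nhdsWithin_le_nhds
    have e2 : Tendsto (fun b' => κ * ((b' - a) * (d' - c'))) (𝓝[<] b)
        (𝓝 (κ * ((b - a) * (d' - c')))) :=
      (Continuous.tendsto (by fun_prop) b).mono_left nhdsWithin_le_nhds
    refine le_of_tendsto_of_tendsto e1 e2 ?_
    filter_upwards [Ioo_mem_nhdsLT hab] with b' hb'
    exact h1 b' c' d' hb'.1 hb'.2 hc hcd hd
  have h3 : ∀ d', c < d' → d' < d → FluxLE p q κ a b c d' := by
    intro d' hd hd'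
    have e1 : Tendsto (fun c' => |rectFlux p q a b c' d'|) (𝓝[>] c) (𝓝 |rectFlux p q a b c d'|) :=
      ((hp.continuous_rectFlux₃ hq a b d').abs.tendsto c).mono_left nhdsWithin_le_nhds
    have e2 : Tendsto (fun c' => κ * ((b - a) * (d' - c'))) (𝓝[>] c)
        (𝓝 (κ * ((b - a) * (d' - c)))) :=
      (Continuous.tendsto (by fun_prop) c).mono_left nhdsWithin_le_nhds
    refine le_of_tendsto_of_tendsto e1 e2 ?_
    filter_upwards [Ioo_mem_nhdsGT hd] with c' hc'
    exact h2 c' d' hc'.1 hc'.2.le hd'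
  have e1 : Tendsto (fun d' => |rectFlux p q a b c d'|) (𝓝[<] d) (𝓝 |rectFlux p q a b c d|) :=
    ((hp.continuous_rectFlux₄ hq a b c).abs.tendsto d).mono_left nhdsWithin_le_nhds
  have e2 : Tendsto (fun d' => κ * ((b - a) * (d' - c))) (𝓝[<] d)
      (𝓝 (κ * ((b - a) * (d - c)))) :=
    (Continuous.tendsto (by fun_prop) d).mono_left nhdsWithin_le_nhds
  refine le_of_tendsto_of_tendsto e1 e2 ?_
  filter_upwards [Ioo_mem_nhdsLT hcd] with d' hd'
  exact h3 d' hd'.1 hd'.2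

end FluxLE

end

section

open MeasureTheory Set Filter Topology

/-- The point `(t, x)` has increments of `f` in both coordinate directions that are linear with
slopes `r` and `s` up to a relative error `ε`, at scales below `δ`. -/
def LinIncr (f : ℝ → ℝ → ℝ) (r s ε δ : ℝ) (z : ℝ × ℝ) : Prop :=
  (∀ h, |h| < δ → |f (z.1 + h) z.2 - f z.1 z.2 - r * h| ≤ ε * |h|) ∧
  (∀ h, |h| < δ → |f z.1 (z.2 + h) - f z.1 z.2 - s * h| ≤ ε * |h|)

theorem SepCont.isClosed_linIncr {f : ℝ → ℝ → ℝ} (hf : SepCont f) {r s ε δ : ℝ} (hδ : 0 < δ) :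
    IsClosed {z | LinIncr f r s ε δ z} := by
  refine IsSeqClosed.isClosed ?_
  rintro z ⟨t, x⟩ hz hlim
  have ht : Tendsto (fun n => (z n).1) atTop (𝓝 t) := (continuous_fst.tendsto _).comp hlim
  have hx : Tendsto (fun n => (z n).2) atTop (𝓝 x) := (continuous_snd.tendsto _).comp hlim
  have key : ∀ t', |t' - t| < δ → Tendsto (fun n => f t' (z n).2 - f (z n).1 (z n).2 - r * (t' - (z n).1))
      atTop (𝓝 (f t' x - f t x - r * (t' - t))) := by
    have hz0 : Tendsto (fun n => f t (z n).2 - f (z n).1 (z n).2 - r * (t - (z n).1)) atTop (𝓝 0) := by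
      have h0 : Tendsto (fun n => t - (z n).1) atTop (𝓝 0) := by simpa using ht.const_sub t
      have h1 : Tendsto (fun n => ε * |t - (z n).1|) atTop (𝓝 0) := by
        simpa using h0.abs.const_mul ε
      refine squeeze_zero_norm' ?_ h1
      have : ∀ᶠ n in atTop, |t - (z n).1| < δ := by
        have := h0.abs
        rw [abs_zero] at this
        exact this.eventually (gt_mem_nhds hδ)
      filter_upwards [this] with n hn
      have := (hz n).1 _ hn
      simpa using this
    have hz1 : Tendsto (fun n => f t (z n).2 - f (z n).1 (z n).2) atTop (𝓝 0) := by
      have h0 : Tendsto (fun n => t - (z n).1) atTop (𝓝 0) := by simpa using ht.const_sub t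
      have := hz0.add (h0.const_mul r)
      simpa using this
    intro t' _
    have h2 : Tendsto (fun n => f t' (z n).2) atTop (𝓝 (f t' x)) := ((hf.right t').tendsto x).comp hx
    have h3 : Tendsto (fun n => f t (z n).2) atTop (𝓝 (f t x)) := ((hf.right t).tendsto x).comp hx
    have h4 : Tendsto (fun n => f (z n).1 (z n).2) atTop (𝓝 (f t x)) := by
      have := h3.sub hz1
      simpa using this
    exact (h2.sub h4).sub ((ht.const_sub t').const_mul r)
  constructor
  · intro h hh
    simp only
    have h1 := key (t + h) (by simpa using hh)
    have h0 : Tendsto (fun n => t + h - (z n).1) atTop (𝓝 h) := by simpa using ht.const_sub (t + h)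
    have h2 : Tendsto (fun n => ε * |t + h - (z n).1|) atTop (𝓝 (ε * |h|)) := h0.abs.const_mul ε
    have h3 := h1.abs
    simp only [add_sub_cancel_left] at h3
    refine le_of_tendsto_of_tendsto h3 h2 ?_
    filter_upwards [h0.abs.eventually (gt_mem_nhds hh)] with n hn
    have := (hz n).1 _ hn
    simpa using this
  · intro h hh
    simp only
    have h1 := key t (by simpa using hδ)
    have h0 : Tendsto (fun n => x + h - (z n).2) atTop (𝓝 h) := by simpa using hx.const_sub (x + h)
    have h2 : Tendsto (fun n => ε * |x + h - (z n).2|) atTop (𝓝 (ε * |h|)) := h0.abs.const_mul ε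
    have ht0 : Tendsto (fun n => r * (t - (z n).1)) atTop (𝓝 0) := by
      simpa using (ht.const_sub t).const_mul r
    have h4 : Tendsto (fun n => f (z n).1 (z n).2) atTop (𝓝 (f t x)) := by
      have h3 : Tendsto (fun n => f t (z n).2) atTop (𝓝 (f t x)) := ((hf.right t).tendsto x).comp hx
      have := (h3.sub h1).sub ht0
      simp only [sub_self, mul_zero, sub_zero] at this
      refine this.congr fun n => by ring
    have h5 : Tendsto (fun n => f (z n).1 (x + h)) atTop (𝓝 (f t (x + h))) :=
      ((hf.left (x + h)).tendsto t).comp ht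
    have h6 := ((h5.sub h4).sub (h0.const_mul s)).abs
    refine le_of_tendsto_of_tendsto h6 h2 ?_
    filter_upwards [h0.abs.eventually (gt_mem_nhds hh)] with n hn
    have := (hz n).2 _ hn
    simpa using this

theorem exists_linIncr {f : ℝ → ℝ → ℝ} {t x a b ε : ℝ} (hε : 0 < ε)
    (ha : HasDerivAt (fun t => f t x) a t) (hb : HasDerivAt (fun x => f t x) b x) :
    ∃ r s : ℚ, |(r : ℝ) - a| ≤ ε ∧ |(s : ℝ) - b| ≤ ε ∧
      ∃ δ > 0, ∀ δ' ≤ δ, LinIncr f r s (2 * ε) δ' (t, x) := by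
  obtain ⟨r, hr⟩ := exists_rat_btwn (show a < a + ε by linarith)
  obtain ⟨s, hs⟩ := exists_rat_btwn (show b < b + ε by linarith)
  have aux : ∀ {g : ℝ → ℝ} {c y : ℝ} {q : ℝ}, HasDerivAt g c y → |q - c| ≤ ε →
      ∃ δ > 0, ∀ h, |h| < δ → |g (y + h) - g y - q * h| ≤ 2 * ε * |h| := by
    intro g c y q hg hq
    have := hasDerivAt_iff_isLittleO_nhds_zero.1 hg
    have := (Asymptotics.isLittleO_iff.1 this) hε
    obtain ⟨δ, hδ, H⟩ := Metric.eventually_nhds_iff.1 this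
    refine ⟨δ, hδ, fun h hh => ?_⟩
    have h1 := H (y := h) (by simpa using hh)
    rw [Real.norm_eq_abs, Real.norm_eq_abs, smul_eq_mul] at h1
    have : g (y + h) - g y - q * h = (g (y + h) - g y - h * c) + (c - q) * h := by ring
    rw [this]
    refine (abs_add_le _ _).trans ?_
    rw [abs_mul, abs_sub_comm c q]
    nlinarith [abs_nonneg h]
  have hr' : |(r : ℝ) - a| ≤ ε := by rw [abs_le]; constructor <;> linarith
  have hs' : |(s : ℝ) - b| ≤ ε := by rw [abs_le]; constructor <;> linarith
  obtain ⟨δ₁, h₁, H₁⟩ := aux ha hr'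
  obtain ⟨δ₂, h₂, H₂⟩ := aux hb hs'
  exact ⟨r, s, hr', hs', min δ₁ δ₂, lt_min h₁ h₂, fun δ' hδ' =>
    ⟨fun h hh => H₁ h (hh.trans_le (hδ'.trans (min_le_left _ _))),
     fun h hh => H₂ h (hh.trans_le (hδ'.trans (min_le_right _ _)))⟩⟩

/-- Increment across a rectangle each of whose sides carries a point of linear increments. -/
theorem abs_increment_le {f : ℝ → ℝ → ℝ} {r s ε δ a b c d xa xb : ℝ} (hε : 0 ≤ ε)
    (hab : a ≤ b) (h1 : b - a < δ) (h2 : d - c < δ)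
    (hxa : xa ∈ Icc c d) (hxb : xb ∈ Icc c d)
    (ha : LinIncr f r s ε δ (a, xa)) (hb : LinIncr f r s ε δ (b, xb)) {x : ℝ} (hx : x ∈ Icc c d) :
    |f b x - f a x - r * (b - a)| ≤ ε * ((b - a) + 3 * (d - c)) := by
  have hl : ∀ {y z : ℝ}, y ∈ Icc c d → z ∈ Icc c d → |y - z| ≤ d - c := by
    intro y z hy hz
    rw [abs_le]; constructor <;> linarith [hy.1, hy.2, hz.1, hz.2]
  have e1 := ha.2 (x - xa) ((hl hx hxa).trans_lt h2)
  have e2 := hb.2 (x - xb) ((hl hx hxb).trans_lt h2)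
  have e3 := ha.1 (b - a) (by rwa [abs_of_nonneg (by linarith)])
  have e4 := hb.2 (xa - xb) ((hl hxa hxb).trans_lt h2)
  simp only [add_sub_cancel] at e1 e2 e3 e4
  rw [abs_of_nonneg (show 0 ≤ b - a by linarith)] at e3
  have i1 := mul_le_mul_of_nonneg_left (hl hx hxa) hε
  have i2 := mul_le_mul_of_nonneg_left (hl hx hxb) hε
  have i4 := mul_le_mul_of_nonneg_left (hl hxa hxb) hε
  rw [abs_le] at *
  constructor <;> linarith [e1.1, e1.2, e2.1, e2.2, e3.1, e3.2, e4.1, e4.2]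

theorem rectFlux_le_of_linIncr {p q : ℝ → ℝ → ℝ} (hp : SepCont p) (hq : SepCont q)
    {r s r' s' ε δ a b c d xa xb tc td : ℝ} (hε : 0 ≤ ε) (hrs : |r + s'| ≤ 2 * ε)
    (hab : a ≤ b) (hcd : c ≤ d) (h1 : b - a < δ) (h2 : d - c < δ)
    (hxa : xa ∈ Icc c d) (hxb : xb ∈ Icc c d) (htc : tc ∈ Icc a b) (htd : td ∈ Icc a b)
    (ha : LinIncr p r s ε δ (a, xa)) (hb : LinIncr p r s ε δ (b, xb))
    (hc : LinIncr q r' s' ε δ (tc, c)) (hd : LinIncr q r' s' ε δ (td, d)) :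
    |rectFlux p q a b c d| ≤ ε * (3 * (b - a) ^ 2 + 3 * (d - c) ^ 2 + 4 * ((b - a) * (d - c))) := by
  have i1 : |∫ x in c..d, (p b x - p a x - r * (b - a))| ≤
      ε * ((b - a) + 3 * (d - c)) * |d - c| := by
    rw [← Real.norm_eq_abs]
    refine intervalIntegral.norm_integral_le_of_norm_le_const fun x hx => ?_
    rw [uIoc_of_le hcd] at hx
    exact abs_increment_le hε hab h1 h2 hxa hxb ha hb ⟨hx.1.le, hx.2⟩
  have sw : ∀ {y z : ℝ}, LinIncr q r' s' ε δ (y, z) →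
      LinIncr (fun x t => q t x) s' r' ε δ (z, y) := fun h => ⟨h.2, h.1⟩
  have i2 : |∫ t in a..b, (q t d - q t c - s' * (d - c))| ≤
      ε * ((d - c) + 3 * (b - a)) * |b - a| := by
    rw [← Real.norm_eq_abs]
    refine intervalIntegral.norm_integral_le_of_norm_le_const fun t ht => ?_
    rw [uIoc_of_le hab] at ht
    exact abs_increment_le hε hcd h2 h1 htc htd (sw hc) (sw hd) ⟨ht.1.le, ht.2⟩
  have j1 : IntervalIntegrable (fun x => p b x - p a x) volume c d :=
    ((hp.right b).sub (hp.right a)).intervalIntegrable _ _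
  have j2 : IntervalIntegrable (fun t => q t d - q t c) volume a b :=
    ((hq.left d).sub (hq.left c)).intervalIntegrable _ _
  rw [intervalIntegral.integral_sub j1 intervalIntegrable_const, intervalIntegral.integral_const,
    smul_eq_mul] at i1
  rw [intervalIntegral.integral_sub j2 intervalIntegrable_const, intervalIntegral.integral_const,
    smul_eq_mul] at i2
  have hba : 0 ≤ b - a := by linarith
  have hdc : 0 ≤ d - c := by linarith
  rw [abs_of_nonneg hdc] at i1
  rw [abs_of_nonneg hba] at i2
  have i3 : |(r + s') * ((b - a) * (d - c))| ≤ 2 * ε * ((b - a) * (d - c)) := by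
    rw [abs_mul, abs_of_nonneg (mul_nonneg hba hdc)]
    exact mul_le_mul_of_nonneg_right hrs (mul_nonneg hba hdc)
  unfold rectFlux
  rw [abs_le] at *
  constructor <;> nlinarith [i1.1, i1.2, i2.1, i2.2, i3.1, i3.2]

end

section

open MeasureTheory Set Filter Topology

/-- The circumscribed rectangle of the part of a compact set inside a rectangle. -/
theorem exists_minimal_rectangle {K : Set (ℝ × ℝ)} (hK : IsCompact K) (hne : K.Nonempty) :
    ∃ a b c d xa xb tc td : ℝ, (a, xa) ∈ K ∧ (b, xb) ∈ K ∧ (tc, c) ∈ K ∧ (td, d) ∈ K ∧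
      K ⊆ Icc a b ×ˢ Icc c d := by
  obtain ⟨⟨a, xa⟩, ha, ha'⟩ := hK.exists_isMinOn hne continuous_fst.continuousOn
  obtain ⟨⟨b, xb⟩, hb, hb'⟩ := hK.exists_isMaxOn hne continuous_fst.continuousOn
  obtain ⟨⟨tc, c⟩, hc, hc'⟩ := hK.exists_isMinOn hne continuous_snd.continuousOn
  obtain ⟨⟨td, d⟩, hd, hd'⟩ := hK.exists_isMaxOn hne continuous_snd.continuousOn
  exact ⟨a, b, c, d, xa, xb, tc, td, ha, hb, hc, hd, fun z hz =>
    ⟨⟨ha' hz, hb' hz⟩, ⟨hc' hz, hd' hz⟩⟩⟩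

set_option maxHeartbeats 1000000 in
/-- If a closed set carries uniform linear increments of `p` and `q` with almost cancelling slopes,
and the flux is at most `ε` times the area on rectangles avoiding it, then the same bound holds
on all rectangles. -/
theorem FluxLE.of_linIncr_on {p q : ℝ → ℝ → ℝ} (hp : SepCont p) (hq : SepCont q) {ε : ℝ}
    (hε : 0 < ε) {E B : Set (ℝ × ℝ)} {r s r' s' δ : ℝ} (hrs : |r + s'| ≤ 2 * (ε / 40))
    (hE : ∀ a b c d, a ≤ b → c ≤ d → Icc a b ×ˢ Icc c d ⊆ B →
      IsCompact (E ∩ Icc a b ×ˢ Icc c d))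
    (hB : ∀ a b c d, a ≤ b → c ≤ d → Icc a b ×ˢ Icc c d ⊆ B → b - a < δ ∧ d - c < δ)
    (hlin : ∀ z ∈ E ∩ B, LinIncr p r s (ε / 40) δ z ∧ LinIncr q r' s' (ε / 40) δ z)
    (hoff : ∀ a b c d, a ≤ b → c ≤ d → Icc a b ×ˢ Icc c d ⊆ B →
      (Ioo a b ×ˢ Ioo c d) ∩ E = ∅ → FluxLE p q ε a b c d) :
    ∀ a b c d, a ≤ b → c ≤ d → Icc a b ×ˢ Icc c d ⊆ B → FluxLE p q ε a b c d := by
  have decomp : ∀ a b c d, a ≤ b → c ≤ d → Icc a b ×ˢ Icc c d ⊆ B → FluxLE p q ε a b c d ∨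
      ∃ a' b' c' d', a ≤ a' ∧ a' ≤ b' ∧ b' ≤ b ∧ c ≤ c' ∧ c' ≤ d' ∧ d' ≤ d ∧
        |rectFlux p q a' b' c' d'| ≤ ε / 40 *
          (3 * (b' - a') ^ 2 + 3 * (d' - c') ^ 2 + 4 * ((b' - a') * (d' - c'))) ∧
        |rectFlux p q a b c d| ≤ |rectFlux p q a' b' c' d'| +
          ε * ((b - a) * (d - c) - (b' - a') * (d' - c')) := by
    intro a b c d hab hcd hR
    rcases (E ∩ Icc a b ×ˢ Icc c d).eq_empty_or_nonempty with h0 | hne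
    · left
      refine hoff a b c d hab hcd hR ?_
      rw [inter_comm]
      exact subset_eq_empty (inter_subset_inter_right _
        (prod_mono Ioo_subset_Icc_self Ioo_subset_Icc_self)) h0
    right
    obtain ⟨a', b', c', d', xa, xb, tc, td, ha, hb, hc, hd, hJ⟩ :=
      exists_minimal_rectangle (hE a b c d hab hcd hR) hne
    have ha1 := hJ ha; have hb1 := hJ hb; have hc1 := hJ hc; have hd1 := hJ hd
    have ha2 := ha.2; have hb2 := hb.2; have hc2 := hc.2; have hd2 := hd.2
    simp only [mem_prod, mem_Icc] at ha1 hb1 hc1 hd1 ha2 hb2 hc2 hd2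
    have hab' : a' ≤ b' := by linarith
    have hcd' : c' ≤ d' := by linarith
    refine ⟨a', b', c', d', ha2.1.1, hab', hb2.1.2, hc2.2.1, hcd', hd2.2.2, ?_, ?_⟩
    · obtain ⟨h1, h2⟩ := hB a b c d hab hcd hR
      exact rectFlux_le_of_linIncr hp hq (by positivity) hrs hab' hcd' (by linarith) (by linarith)
        ha1.2 hb1.2 hc1.1 hd1.1 (hlin _ ⟨ha.1, hR ha.2⟩).1 (hlin _ ⟨hb.1, hR hb.2⟩).1
        (hlin _ ⟨hc.1, hR hc.2⟩).2 (hlin _ ⟨hd.1, hR hd.2⟩).2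
    · have off : ∀ a₁ b₁ c₁ d₁, a ≤ a₁ → a₁ ≤ b₁ → b₁ ≤ b → c ≤ c₁ → c₁ ≤ d₁ → d₁ ≤ d →
          (b₁ ≤ a' ∨ b' ≤ a₁ ∨ d₁ ≤ c' ∨ d' ≤ c₁) → FluxLE p q ε a₁ b₁ c₁ d₁ := by
        intro a₁ b₁ c₁ d₁ h1 h2 h3 h4 h5 h6 h7
        refine hoff _ _ _ _ h2 h5 ((prod_mono (Icc_subset_Icc h1 h3) (Icc_subset_Icc h4 h6)).trans hR) ?_
        rw [eq_empty_iff_forall_notMem]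
        rintro ⟨t, x⟩ ⟨⟨ht, hx⟩, hEz⟩
        simp only [mem_Ioo] at ht hx
        have := hJ ⟨hEz, ⟨⟨by linarith, by linarith⟩, ⟨by linarith, by linarith⟩⟩⟩
        simp only [mem_prod, mem_Icc] at this
        rcases h7 with h | h | h | h <;> linarith
      have o1 := off a a' c d le_rfl (by linarith) (by linarith) le_rfl hcd le_rfl (.inl le_rfl)
      have o2 := off b' b c d (by linarith) (by linarith) le_rfl le_rfl hcd le_rfl
        (.inr (.inl le_rfl))
      have o3 := off a' b' c c' (by linarith) hab' (by linarith) le_rfl (by linarith) (by linarith)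
        (.inr (.inr (.inl le_rfl)))
      have o4 := off a' b' d' d (by linarith) hab' (by linarith) (by linarith) (by linarith) le_rfl
        (.inr (.inr (.inr le_rfl)))
      rw [hp.rectFlux_glue_left hq a a' b, hp.rectFlux_glue_left hq a' b' b,
        hp.rectFlux_glue_right hq a' b' c c' d, hp.rectFlux_glue_right hq a' b' c' d' d]
      unfold FluxLE at o1 o2 o3 o4
      refine abs_le.2 ⟨?_, ?_⟩ <;>
      nlinarith [abs_le.1 o1, abs_le.1 o2, abs_le.1 o3, abs_le.1 o4,
        neg_abs_le (rectFlux p q a' b' c' d'), le_abs_self (rectFlux p q a' b' c' d')]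
  have sub : ∀ {a b c d a' b' c' d' : ℝ}, a ≤ a' → b' ≤ b → c ≤ c' → d' ≤ d →
      Icc a b ×ˢ Icc c d ⊆ B → Icc a' b' ×ˢ Icc c' d' ⊆ B := fun h1 h2 h3 h4 h =>
    (prod_mono (Icc_subset_Icc h1 h2) (Icc_subset_Icc h3 h4)).trans h
  have iter : ∀ k : ℕ, ∀ a b c d, a ≤ b → c ≤ d → Icc a b ×ˢ Icc c d ⊆ B →
      FluxLE p q (ε + ε / 2 ^ k) a b c d := by
    intro k
    induction k with
    | zero =>
      intro a b c d hab hcd hR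
      refine of_aspect hp hq hab hcd fun a b c d ha hab hb hc hcd hd h1 h2 => ?_
      rcases decomp a b c d hab hcd (sub ha hb hc hd hR) with h |
        ⟨a', b', c', d', ha', hab', hb', hc', hcd', hd', hF, hsum⟩
      · refine h.trans ?_
        have := mul_nonneg hε.le (mul_nonneg (sub_nonneg.2 hab) (sub_nonneg.2 hcd))
        simp only [pow_zero, div_one]; linarith
      · refine hsum.trans ?_
        have e1 : (b' - a') ^ 2 ≤ 2 * ((b - a) * (d - c)) := by nlinarith
        have e2 : (d' - c') ^ 2 ≤ 2 * ((b - a) * (d - c)) := by nlinarith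
        have e3 : (b' - a') * (d' - c') ≤ (b - a) * (d - c) := by nlinarith
        have e4 : 0 ≤ (b' - a') * (d' - c') := mul_nonneg (by linarith) (by linarith)
        simp only [pow_zero, div_one]
        nlinarith
    | succ k ih =>
      intro a b c d hab hcd hR
      refine of_aspect hp hq hab hcd fun a b c d ha hab hb hc hcd hd h1 h2 => ?_
      have hR' := sub ha hb hc hd hR
      have hk : 0 < ε / 2 ^ k := by positivity
      have hk' : ε / 2 ^ (k + 1) = (ε / 2 ^ k) / 2 := by rw [pow_succ]; field_simp
      have hA : 0 ≤ (b - a) * (d - c) := mul_nonneg (by linarith) (by linarith)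
      unfold FluxLE
      rw [hk']
      rcases decomp a b c d hab hcd hR' with h |
        ⟨a', b', c', d', ha', hab', hb', hc', hcd', hd', hF, hsum⟩
      · refine h.trans ?_
        nlinarith
      · refine hsum.trans ?_
        have e4 : 0 ≤ (b' - a') * (d' - c') := mul_nonneg (by linarith) (by linarith)
        by_cases hfat : b' - a' ≤ 4 * (d' - c') ∧ d' - c' ≤ 4 * (b' - a')
        · have e1 : (b' - a') ^ 2 ≤ 4 * ((b' - a') * (d' - c')) := by nlinarith
          have e2 : (d' - c') ^ 2 ≤ 4 * ((b' - a') * (d' - c')) := by nlinarith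
          nlinarith
        · have e5 : (b' - a') * (d' - c') ≤ (b - a) * (d - c) / 2 := by
            rcases not_and_or.1 hfat with h | h
            · push Not at h
              nlinarith
            · push Not at h
              nlinarith
          have := ih a' b' c' d' hab' hcd' (sub ha' hb' hc' hd' hR')
          unfold FluxLE at this
          nlinarith
  intro a b c d hab hcd hR
  have lim : Tendsto (fun k : ℕ => (ε + ε / 2 ^ k) * ((b - a) * (d - c))) atTop
      (𝓝 ((ε + 0) * ((b - a) * (d - c)))) := by
    refine (Tendsto.const_add ε ?_).mul_const _
    exact tendsto_const_nhds.div_atTop (tendsto_pow_atTop_atTop_of_one_lt one_lt_two)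
  rw [add_zero] at lim
  exact ge_of_tendsto' lim fun k => iter k a b c d hab hcd hR

/-- **Green's theorem for separately differentiable fields** (Looman–Menchoff): a bounded field
`(p, q)`, differentiable in each variable, with zero divergence, has zero flux through rectangles. -/
theorem rectFlux_eq_zero {p q : ℝ → ℝ → ℝ} (hp : SepCont p) (hq : SepCont q) {Ω : Set (ℝ × ℝ)}
    (hΩ : IsOpen Ω)
    (H : ∀ t x, (t, x) ∈ Ω → ∃ D₁ D₂ D₃, HasDerivAt (fun t => p t x) D₁ t ∧
      HasDerivAt (fun x => p t x) D₂ x ∧ HasDerivAt (fun t => q t x) D₃ t ∧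
      HasDerivAt (fun x => q t x) (-D₁) x)
    {a b c d : ℝ} (hab : a ≤ b) (hcd : c ≤ d) (hR : Icc a b ×ˢ Icc c d ⊆ Ω) :
    rectFlux p q a b c d = 0 := by
  suffices h : ∀ ε > 0, FluxLE p q ε a b c d by
    have lim : Tendsto (fun ε : ℝ => ε * ((b - a) * (d - c))) (𝓝[>] 0)
        (𝓝 (0 * ((b - a) * (d - c)))) :=
      (Continuous.tendsto (by fun_prop) 0).mono_left nhdsWithin_le_nhds
    rw [zero_mul] at lim
    refine abs_nonpos_iff.1 (ge_of_tendsto lim ?_)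
    filter_upwards [self_mem_nhdsWithin] with ε hε using h ε hε
  intro ε hε
  set O : Set (ℝ × ℝ) := {z | ∃ V ∈ 𝓝 z, ∀ a' b' c' d', a' ≤ b' → c' ≤ d' →
      Icc a' b' ×ˢ Icc c' d' ⊆ V → FluxLE p q ε a' b' c' d'} with hO
  have hOo : IsOpen O := by
    rw [isOpen_iff_mem_nhds]
    rintro z ⟨V, hV, h⟩
    filter_upwards [eventually_mem_nhds_iff.2 hV] with y hy using ⟨V, hy, h⟩
  suffices hE : Ω \ O = ∅ from
    FluxLE.of_local hp hq hab hcd fun z hz => sdiff_eq_empty.1 hE (hR hz)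
  by_contra hne
  set E := Ω \ O with hEdef
  have : LocallyCompactSpace E :=
    (hΩ.isLocallyClosed.inter hOo.isClosed_compl.isLocallyClosed).locallyCompactSpace
  have : Nonempty E := (nonempty_iff_ne_empty.2 hne).to_subtype
  let F : ℚ × ℚ × ℚ × ℚ × ℕ → Set E := fun i => {z | |(i.1 : ℝ) + i.2.2.2.1| ≤ 2 * (ε / 40) ∧
    LinIncr p i.1 i.2.1 (ε / 40) (1 / (i.2.2.2.2 + 1)) z ∧
    LinIncr q i.2.2.1 i.2.2.2.1 (ε / 40) (1 / (i.2.2.2.2 + 1)) z}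
  have hFc : ∀ i, IsClosed (F i) := fun i =>
    isClosed_const.inter (((hp.isClosed_linIncr (by positivity)).preimage continuous_subtype_val).inter
      ((hq.isClosed_linIncr (by positivity)).preimage continuous_subtype_val))
  have hFu : ⋃ i, F i = univ := by
    refine eq_univ_of_forall ?_
    rintro ⟨⟨t, x⟩, hz⟩
    obtain ⟨D₁, D₂, D₃, h1, h2, h3, h4⟩ := H t x hz.1
    have hε' : 0 < ε / 80 := by positivity
    obtain ⟨r, s, hr, -, δ₁, hδ₁, H₁⟩ := exists_linIncr hε' h1 h2
    obtain ⟨r', s', -, hs', δ₂, hδ₂, H₂⟩ := exists_linIncr hε' h3 h4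
    obtain ⟨n, hn⟩ := exists_nat_one_div_lt (lt_min hδ₁ hδ₂)
    have e : 2 * (ε / 80) = ε / 40 := by ring
    rw [e] at H₁ H₂
    refine mem_iUnion.2 ⟨(r, s, r', s', n), ?_, H₁ _ (hn.le.trans (min_le_left _ _)),
      H₂ _ (hn.le.trans (min_le_right _ _))⟩
    rw [abs_le] at *
    constructor <;> simp only <;> linarith
  obtain ⟨⟨r, s, r', s', n⟩, z, hz⟩ := nonempty_interior_of_iUnion_of_closed hFc hFu
  obtain ⟨W', hW'F, hW', hzW'⟩ := mem_interior.1 hz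
  obtain ⟨W, hW, rfl⟩ := isOpen_induced_iff.1 hW'
  have hrs := (hW'F hzW').1
  set δ : ℝ := 1 / (n + 1) with hδdef
  have hδ : 0 < δ := by positivity
  obtain ⟨ρ, hρ, hball⟩ := Metric.isOpen_iff.1 (hW.inter hΩ) z.1 ⟨hzW', z.2.1⟩
  set B := Metric.ball z.1 (min ρ (δ / 2)) with hBdef
  have hBρ : B ⊆ W ∩ Ω := (Metric.ball_subset_ball (min_le_left _ _)).trans hball
  have hdist : ∀ y ∈ B, ∀ y' ∈ B, |y.1 - y'.1| < δ ∧ |y.2 - y'.2| < δ := by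
    intro y hy y' hy'
    have h1 : dist y y' < δ := by
      have := dist_triangle_right y y' z.1
      have h1 := (Metric.mem_ball.1 hy).trans_le (min_le_right _ _)
      have h2 := (Metric.mem_ball.1 hy').trans_le (min_le_right _ _)
      linarith
    rw [Prod.dist_eq, max_lt_iff] at h1
    exact h1
  refine z.2.2 ⟨B, Metric.ball_mem_nhds _ (lt_min hρ (by positivity)), ?_⟩
  refine FluxLE.of_linIncr_on hp hq hε (E := E) (r := r) (s := s) (r' := r') (s' := s') (δ := δ)
    hrs ?_ ?_ ?_ ?_
  · intro a b c d hab hcd hR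
    have : E ∩ Icc a b ×ˢ Icc c d = Icc a b ×ˢ Icc c d \ O := by
      ext y
      exact ⟨fun h => ⟨h.2, h.1.2⟩, fun h => ⟨⟨(hBρ (hR h.1)).2, h.2⟩, h.1⟩⟩
    rw [this]
    exact (isCompact_Icc.prod isCompact_Icc).diff hOo
  · intro a b c d hab hcd hR
    have := hdist (b, d) (hR ⟨⟨hab, le_rfl⟩, ⟨hcd, le_rfl⟩⟩) (a, c) (hR ⟨⟨le_rfl, hab⟩, ⟨le_rfl, hcd⟩⟩)
    simp only [abs_lt] at this
    exact ⟨this.1.2, this.2.2⟩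
  · intro y hy
    exact (hW'F (show (⟨y, hy.1⟩ : E) ∈ Subtype.val ⁻¹' W from (hBρ hy.2).1)).2
  · intro a b c d hab hcd hR hempty
    refine FluxLE.of_interior hp hq hab hcd fun a' b' c' d' ha hab' hb hc hcd' hd => ?_
    refine FluxLE.of_local hp hq hab' hcd' fun y hy => ?_
    by_contra hyO
    have hy1 : y ∈ Ioo a b ×ˢ Ioo c d :=
      ⟨⟨ha.trans_le hy.1.1, hy.1.2.trans_lt hb⟩, ⟨hc.trans_le hy.2.1, hy.2.2.trans_lt hd⟩⟩
    have : y ∈ (Ioo a b ×ˢ Ioo c d) ∩ E := ⟨hy1, (hBρ (hR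
      (prod_mono Ioo_subset_Icc_self Ioo_subset_Icc_self hy1))).2, hyO⟩
    rw [hempty] at this
    exact this

end

section

open MeasureTheory Set Filter Topology

namespace SepCont

variable {f g : ℝ → ℝ → ℝ}

theorem add (hf : SepCont f) (hg : SepCont g) : SepCont fun t x => f t x + g t x :=
  ⟨fun x => (hf.left x).add (hg.left x), fun t => (hf.right t).add (hg.right t), fun R =>
    let ⟨B, hB⟩ := hf.bdd R; let ⟨C, hC⟩ := hg.bdd R
    ⟨B + C, fun t x ht hx => (abs_add_le _ _).trans (add_le_add (hB t x ht hx) (hC t x ht hx))⟩⟩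

theorem mul (hf : SepCont f) (hg : SepCont g) : SepCont fun t x => f t x * g t x :=
  ⟨fun x => (hf.left x).mul (hg.left x), fun t => (hf.right t).mul (hg.right t), fun R =>
    let ⟨B, hB⟩ := hf.bdd R; let ⟨C, hC⟩ := hg.bdd R
    ⟨B * C, fun t x ht hx => by
      rw [abs_mul]
      exact mul_le_mul (hB t x ht hx) (hC t x ht hx) (abs_nonneg _)
        ((abs_nonneg _).trans (hB t x ht hx))⟩⟩

theorem of_continuous {φ : ℝ → ℝ} (hφ : Continuous φ) : SepCont fun t _ => φ t := by
  refine ⟨fun _ => hφ, fun _ => continuous_const, fun R => ?_⟩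
  obtain ⟨B, hB⟩ := (isCompact_Icc (a := -R) (b := R)).exists_bound_of_continuousOn hφ.continuousOn
  exact ⟨B, fun t x ht _ => hB t (abs_le.1 ht)⟩

theorem const_mul (hf : SepCont f) (r : ℝ) : SepCont fun t x => r * f t x :=
  (of_continuous continuous_const).mul hf

theorem sub (hf : SepCont f) (hg : SepCont g) : SepCont fun t x => f t x - g t x := by
  simpa only [sub_eq_add_neg, neg_one_mul] using hf.add (hg.const_mul (-1))

theorem measurable (hf : SepCont f) : Measurable (Function.uncurry f) :=
  measurable_uncurry_of_continuous_of_measurable hf.left fun t => (hf.right t).measurable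

theorem intervalIntegrable (hf : SepCont f) (x a b : ℝ) :
    IntervalIntegrable (fun t => f t x) volume a b := (hf.left x).intervalIntegrable _ _

theorem abs_primitive_sub_le {B s t x : ℝ} (hB : ∀ r ∈ uIcc s t, |f r x| ≤ B)
    (hf : SepCont f) : |(∫ r in (0:ℝ)..t, f r x) - ∫ r in (0:ℝ)..s, f r x| ≤ B * |t - s| := by
  rw [intervalIntegral.integral_interval_sub_left (hf.intervalIntegrable _ _ _)
    (hf.intervalIntegrable _ _ _), ← Real.norm_eq_abs]
  exact intervalIntegral.norm_integral_le_of_norm_le_const fun r hr => hB r (uIoc_subset_uIcc hr)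

theorem primitive (hf : SepCont f) : SepCont fun t x => ∫ s in (0:ℝ)..t, f s x := by
  refine ⟨fun x => intervalIntegral.continuous_primitive (fun a b => hf.intervalIntegrable x a b) 0,
    fun t => hf.swap.continuous_integral_right 0 t, fun R => ?_⟩
  obtain ⟨B, hB⟩ := hf.bdd R
  refine ⟨B * R, fun t x ht hx => ?_⟩
  have h := abs_primitive_sub_le (s := 0) (t := t) (x := x) (B := B) (fun r hr => hB r x ?_ hx) hf
  · simp only [intervalIntegral.integral_same, sub_zero] at h
    refine h.trans (mul_le_mul_of_nonneg_left ht ?_)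
    exact (abs_nonneg _).trans (hB t x ht hx)
  · rw [mem_uIcc] at hr
    rw [abs_le] at *
    rcases hr with hr | hr <;> constructor <;> linarith

/-- Primitives in the first variable are jointly continuous. -/
theorem continuous_primitive (hf : SepCont f) :
    Continuous fun z : ℝ × ℝ => ∫ s in (0:ℝ)..z.1, f s z.2 := by
  rw [continuous_iff_continuousAt]
  rintro ⟨t, x⟩
  obtain ⟨B, hB⟩ := hf.bdd (max |t| |x| + 1)
  have h1 : Tendsto (fun z : ℝ × ℝ => ∫ s in (0:ℝ)..t, f s z.2) (𝓝 (t, x))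
      (𝓝 (∫ s in (0:ℝ)..t, f s x)) :=
    ((hf.primitive.right t).tendsto x).comp (continuous_snd.tendsto (t, x))
  have h2 : Tendsto (fun z : ℝ × ℝ => (∫ s in (0:ℝ)..z.1, f s z.2) - ∫ s in (0:ℝ)..t, f s z.2)
      (𝓝 (t, x)) (𝓝 0) := by
    have h3 : Tendsto (fun z : ℝ × ℝ => B * |z.1 - t|) (𝓝 (t, x)) (𝓝 0) := by
      have : Continuous fun z : ℝ × ℝ => B * |z.1 - t| := by fun_prop
      simpa using this.tendsto (t, x)
    refine squeeze_zero_norm' ?_ h3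
    filter_upwards [Metric.ball_mem_nhds (t, x) one_pos] with z hz
    rw [Metric.mem_ball, Prod.dist_eq, max_lt_iff, Real.dist_eq, Real.dist_eq] at hz
    refine abs_primitive_sub_le (fun r hr => hB r z.2 ?_ ?_) hf
    · have h4 : |r - t| ≤ |z.1 - t| := by
        have := abs_sub_left_of_mem_uIcc hr
        rwa [abs_sub_comm, abs_sub_comm z.1] at *
      have := abs_add_le (r - t) t
      rw [sub_add_cancel] at this
      linarith [le_max_left |t| |x|, hz.1]
    · have := abs_add_le (z.2 - x) x
      rw [sub_add_cancel] at this
      linarith [le_max_right |t| |x|, hz.2]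
  have := h2.add h1
  simpa [ContinuousAt] using this

theorem integral_swap (hf : SepCont f) (a b c d : ℝ) :
    ∫ s in a..b, ∫ x in c..d, f s x = ∫ x in c..d, ∫ s in a..b, f s x := by
  refine intervalIntegral_intervalIntegral_swap ?_
  obtain ⟨B, hB⟩ := hf.bdd (max (max |a| |b|) (max |c| |d|))
  refine Measure.integrableOn_of_bounded (M := B) ?_ hf.measurable.aestronglyMeasurable ?_
  · rw [Measure.volume_eq_prod, Measure.prod_prod]
    exact ENNReal.mul_ne_top (by simp [uIoc]) (by simp [uIoc])
  · refine (ae_restrict_iff' (measurableSet_uIoc.prod measurableSet_uIoc)).2 (ae_of_all _ ?_)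
    rintro ⟨t, x⟩ ⟨ht, hx⟩
    have aux : ∀ {y a b : ℝ}, y ∈ uIoc a b → |y| ≤ max |a| |b| := fun {y a b} hy =>
      (abs_le_max_abs_abs (uIoc_subset_uIcc hy).1 (uIoc_subset_uIcc hy).2).trans
        (by rcases le_total a b with h | h <;> simp [h, le_total])
    exact hB t x ((aux ht).trans (le_max_left _ _)) ((aux hx).trans (le_max_right _ _))

theorem hasDerivAt_primitive (hf : SepCont f) (t x : ℝ) :
    HasDerivAt (fun t => ∫ s in (0:ℝ)..t, f s x) (f t x) t :=
  (hf.left x).integral_hasStrictDerivAt 0 t |>.hasDerivAt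

end SepCont

/-- Integrated balance law: `z_t + c w_x + ω z = 0` integrated over `[0, t] × [x₁, x₂]`. -/
theorem balance_integral {z w : ℝ → ℝ → ℝ} (hz : SepCont z) (hw : SepCont w) {T c ω : ℝ}
    (hz0 : ∀ x, z 0 x = 0)
    (H : ∀ t ∈ Ioo 0 T, ∀ x ∈ Ioo (0:ℝ) 1, DifferentiableAt ℝ (fun s => z s x) t ∧
      DifferentiableAt ℝ (fun y => z t y) x ∧ DifferentiableAt ℝ (fun s => w s x) t ∧
      DifferentiableAt ℝ (fun y => w t y) x ∧
      deriv (fun s => z s x) t + c * deriv (fun y => w t y) x + ω * z t x = 0)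
    {t x₁ x₂ : ℝ} (ht : t ∈ Icc 0 T) (h1 : 0 ≤ x₁) (h12 : x₁ ≤ x₂) (h2 : x₂ ≤ 1) :
    (∫ x in x₁..x₂, z t x) + c * ((∫ s in (0:ℝ)..t, w s x₂) - ∫ s in (0:ℝ)..t, w s x₁)
      + ω * ∫ x in x₁..x₂, ∫ s in (0:ℝ)..t, z s x = 0 := by
  have hexp : SepCont fun t _ => Real.exp (ω * t) := SepCont.of_continuous (by fun_prop)
  set p : ℝ → ℝ → ℝ := fun t x => Real.exp (ω * t) * z t x with hp
  set q : ℝ → ℝ → ℝ := fun t x => c * (Real.exp (ω * t) * w t x) with hq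
  have hpc : SepCont p := hexp.mul hz
  have hqc : SepCont q := (hexp.mul hw).const_mul c
  have hexpd : ∀ t, HasDerivAt (fun t => Real.exp (ω * t)) (Real.exp (ω * t) * ω) t := fun t => by
    simpa using ((hasDerivAt_id t).const_mul ω).exp
  set m : ℝ → ℝ := fun t => ∫ x in x₁..x₂, z t x with hm
  set n : ℝ → ℝ := fun t => w t x₂ - w t x₁ with hn
  have hnc : Continuous n := (hw.left _).sub (hw.left _)
  have flux : ∀ t ∈ Icc 0 T, Real.exp (ω * t) * m t + c * ∫ s in (0:ℝ)..t, Real.exp (ω * s) * n s = 0 := by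
    intro t ht
    have h0 : FluxLE p q 0 0 t x₁ x₂ := by
      refine FluxLE.of_interior hpc hqc ht.1 h12 fun a b c' d ha hab hb hc hcd hd => ?_
      have := rectFlux_eq_zero hpc hqc (Ω := Ioo 0 T ×ˢ Ioo 0 1) (isOpen_Ioo.prod isOpen_Ioo) ?_
        hab hcd (prod_mono (Icc_subset_Ioo (by linarith) (by linarith [ht.2]))
          (Icc_subset_Ioo (by linarith) (by linarith)))
      · simp [FluxLE, this]
      · rintro t x ⟨ht, hx⟩
        obtain ⟨e1, e2, e3, e4, e5⟩ := H t ht x hx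
        refine ⟨_, _, _, (hexpd t).mul e1.hasDerivAt, e2.hasDerivAt.const_mul _,
          ((hexpd t).mul e3.hasDerivAt).const_mul c, ?_⟩
        refine ((e4.hasDerivAt.const_mul (Real.exp (ω * t))).const_mul c).congr_deriv ?_
        linear_combination (Real.exp (ω * t)) * e5
    have h1 : rectFlux p q 0 t x₁ x₂ = 0 := by
      simpa [FluxLE] using h0
    have h2 : ∀ s, q s x₂ - q s x₁ = c * (Real.exp (ω * s) * n s) := fun s => by
      simp only [hq, hn]; ring
    simp only [rectFlux, h2, hp, hz0, mul_zero, sub_zero,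
      intervalIntegral.integral_const_mul] at h1
    exact h1
  set A : ℝ → ℝ := fun t => ∫ s in (0:ℝ)..t, Real.exp (ω * s) * n s with hA
  have hAd : ∀ t, HasDerivAt A (Real.exp (ω * t) * n t) t := fun t =>
    ((by fun_prop : Continuous fun s => Real.exp (ω * s) * n s).integral_hasStrictDerivAt 0 t).hasDerivAt
  have hAc : Continuous A := continuous_iff_continuousAt.2 fun t => (hAd t).continuousAt
  have hmA : ∀ t ∈ Icc 0 T, m t = -c * (Real.exp (-ω * t) * A t) := by
    intro t ht
    have := flux t ht
    have e : Real.exp (-ω * t) * Real.exp (ω * t) = 1 := by rw [← Real.exp_add]; simp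
    linear_combination Real.exp (-ω * t) * this - m t * e
  have hEd : ∀ t, HasDerivAt (fun t => Real.exp (-ω * t) * A t)
      (n t - ω * (Real.exp (-ω * t) * A t)) t := by
    intro t
    have h1 : HasDerivAt (fun t => Real.exp (-ω * t)) (Real.exp (-ω * t) * (-ω)) t := by
      simpa using ((hasDerivAt_id t).const_mul (-ω)).exp
    refine (h1.mul (hAd t)).congr_deriv ?_
    have e : Real.exp (-ω * t) * Real.exp (ω * t) = 1 := by rw [← Real.exp_add]; simp
    linear_combination (n t) * e
  have hftc := intervalIntegral.integral_eq_sub_of_hasDerivAt (a := 0) (b := t)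
    (fun s _ => hEd s) (Continuous.intervalIntegrable (by fun_prop) _ _)
  rw [intervalIntegral.integral_sub (hnc.intervalIntegrable _ _)
    (Continuous.intervalIntegrable (by fun_prop) _ _), intervalIntegral.integral_const_mul] at hftc
  have hm_int : ∫ s in (0:ℝ)..t, m s = -c * ∫ s in (0:ℝ)..t, Real.exp (-ω * s) * A s := by
    rw [← intervalIntegral.integral_const_mul]
    refine intervalIntegral.integral_congr fun s hs => ?_
    rw [uIcc_of_le ht.1] at hs
    exact hmA s ⟨hs.1, hs.2.trans ht.2⟩
  have hn_int : ∫ s in (0:ℝ)..t, n s = (∫ s in (0:ℝ)..t, w s x₂) - ∫ s in (0:ℝ)..t, w s x₁ :=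
    intervalIntegral.integral_sub (hw.intervalIntegrable _ _ _) (hw.intervalIntegrable _ _ _)
  rw [← hz.integral_swap, ← hn_int]
  have hmt := hmA t ht
  simp only [A, intervalIntegral.integral_same, mul_zero, sub_zero] at hftc
  change m t + c * (∫ s in (0:ℝ)..t, n s) + ω * ∫ s in (0:ℝ)..t, m s = 0
  rw [hm_int, hmt]
  simp only [A]
  linear_combination c * hftc

end

section

open MeasureTheory Set Filter Topology

/-- Duhamel's formula for the primitive in time `W` of the transport variable, given its
partial derivatives. -/
theorem transport_characteristic {W U K S : ℝ → ℝ → ℝ} {c ω T : ℝ} (hc : 0 < c)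
    (hW : Continuous fun z : ℝ × ℝ => W z.1 z.2) (hU : Continuous fun z : ℝ × ℝ => U z.1 z.2)
    (hK : Continuous fun z : ℝ × ℝ => K z.1 z.2) (hS : Continuous fun z : ℝ × ℝ => S z.1 z.2)
    (hKS : ∀ t x, K t x = S t x - U t x - ω * W t x)
    (hWt : ∀ t x, HasDerivAt (fun t => W t x) (U t x) t)
    (hWx : ∀ t < T, ∀ x ∈ Ioo (0:ℝ) 1, HasDerivAt (fun x => W t x) (K t x / c) x)
    {t x : ℝ} (ht : t ≤ T) (hx : x ∈ Icc (0:ℝ) 1) :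
    W t x = Real.exp (-ω * (x / c)) * W (t - x / c) 0 +
      ∫ σ in (0:ℝ)..x / c, Real.exp (-ω * σ) * S (t - σ) (x - c * σ) := by
  have hder : ∀ σ ∈ Ioo 0 (x / c), HasDerivAt (fun σ => Real.exp (-ω * σ) * W (t - σ) (x - c * σ))
      (-(Real.exp (-ω * σ) * S (t - σ) (x - c * σ))) σ := by
    rintro σ ⟨h0, h1⟩
    have h2 : c * σ < x := by rwa [lt_div_iff₀ hc, mul_comm] at h1
    have h3 : 0 < c * σ := by positivity
    have hopen : ∀ᶠ v in 𝓝 (t - σ, x - c * σ), v ∈ Iio T ×ˢ Ioo (0:ℝ) 1 :=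
      (isOpen_Iio.prod isOpen_Ioo).mem_nhds
        ⟨show t - σ < T by linarith, show 0 < x - c * σ by linarith,
          show x - c * σ < 1 by linarith [hx.2]⟩
    have hF := hasStrictFDerivAt_uncurry_coprod (𝕜 := ℝ) (u := (t - σ, x - c * σ)) (f := W)
      (f₁ := fun t x => ContinuousLinearMap.toSpanSingleton ℝ (U t x))
      (f₂ := fun t x => ContinuousLinearMap.toSpanSingleton ℝ (K t x / c))
      (Eventually.of_forall fun v => (hWt v.1 v.2).hasFDerivAt)
      (hopen.mono fun v hv => (hWx v.1 hv.1 v.2 hv.2).hasFDerivAt)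
      ((ContinuousLinearMap.toSpanSingletonCLE (𝕜 := ℝ) (E := ℝ)).continuous.comp hU).continuousAt
      ((ContinuousLinearMap.toSpanSingletonCLE (𝕜 := ℝ) (E := ℝ)).continuous.comp
        (hK.div_const c)).continuousAt
    have hpath : HasDerivAt (fun σ => (t - σ, x - c * σ)) ((-1 : ℝ), -c) σ := by
      refine HasDerivAt.prodMk ?_ ?_
      · simpa using (hasDerivAt_id σ).const_sub t
      · simpa using ((hasDerivAt_id σ).const_mul c).const_sub x
    have hcomp := hF.hasFDerivAt.comp_hasDerivAt σ hpath
    have hexp : HasDerivAt (fun σ => Real.exp (-ω * σ)) (Real.exp (-ω * σ) * (-ω)) σ := by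
      simpa using ((hasDerivAt_id σ).const_mul (-ω)).exp
    refine (hexp.mul hcomp).congr_deriv ?_
    simp only [ContinuousLinearMap.coprod_apply, Function.HasUncurry.uncurry, id,
      ContinuousLinearMap.toSpanSingleton_apply, smul_eq_mul, hKS, Function.comp]
    field_simp
    ring
  have hWc : Continuous fun σ => W (t - σ) (x - c * σ) :=
    hW.comp (by fun_prop : Continuous fun σ : ℝ => (t - σ, x - c * σ))
  have hSc : Continuous fun σ => S (t - σ) (x - c * σ) :=
    hS.comp (by fun_prop : Continuous fun σ : ℝ => (t - σ, x - c * σ))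
  have hftc := intervalIntegral.integral_eq_sub_of_hasDerivAt_of_le (div_nonneg hx.1 hc.le)
    (Continuous.continuousOn (by fun_prop)) hder (Continuous.intervalIntegrable (by fun_prop) _ _)
  rw [intervalIntegral.integral_neg] at hftc
  simp only [mul_zero, sub_zero, Real.exp_zero, one_mul, mul_div_cancel₀ x hc.ne', sub_self] at hftc
  linarith

/-- Duhamel's formula along characteristics, for the time primitive of a transported function whose
source has primitive `M * P`. -/
theorem duhamel {u v P : ℝ → ℝ → ℝ} (hu : SepCont u) (hv : SepCont v) (hP : SepCont P)
    {T c ω M : ℝ} (hT : 0 ≤ T) (hc : 0 < c) (hu0 : ∀ t ≤ 0, ∀ x, u t x = 0) (hv0 : ∀ x, v 0 x = 0)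
    (hP0 : ∀ t ≤ 0, ∀ x, P t x = 0)
    (hvP : ∀ t ∈ Icc 0 T, ∀ x ∈ Icc (0:ℝ) 1, v t x + ω * ∫ s in (0:ℝ)..t, v s x = M * P t x)
    (H : ∀ t ∈ Ioo 0 T, ∀ x ∈ Ioo (0:ℝ) 1, DifferentiableAt ℝ (fun s => u s x) t ∧
      DifferentiableAt ℝ (fun y => u t y) x ∧ DifferentiableAt ℝ (fun s => v s x) t ∧
      DifferentiableAt ℝ (fun y => v t y) x ∧
      deriv (fun s => u s x) t + c * deriv (fun y => u t y) x + ω * u t x =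
        deriv (fun s => v s x) t + ω * v t x)
    {t x : ℝ} (ht : t < T) (hx : x ∈ Icc (0:ℝ) 1) :
    ∫ s in (0:ℝ)..t, u s x = Real.exp (-ω * (x / c)) * (∫ s in (0:ℝ)..(t - x / c), u s 0) +
      M * ∫ σ in (0:ℝ)..x / c, Real.exp (-ω * σ) * P (t - σ) (x - c * σ) := by
  set U : ℝ → ℝ → ℝ := fun t x => ∫ s in (0:ℝ)..t, u s x with hUdef
  have hU : SepCont U := hu.primitive
  set k : ℝ → ℝ → ℝ := fun t x => M * P t x - u t x - ω * U t x with hkdef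
  have hk : SepCont k := ((hP.const_mul M).sub hu).sub (hU.const_mul ω)
  have hU0 : ∀ t ≤ 0, ∀ x, U t x = 0 := fun t ht x => by
    refine intervalIntegral.integral_zero_ae (ae_of_all _ fun s hs => hu0 s ?_ x)
    rw [uIoc_of_ge ht] at hs
    exact hs.2
  have integrated_balance : ∀ t ≤ T, ∀ x₁ x₂, 0 ≤ x₁ → x₁ ≤ x₂ → x₂ ≤ 1 →
      c * (U t x₂ - U t x₁) = ∫ x in x₁..x₂, k t x := by
    intro t htT x₁ x₂ h1 h12 h2
    rcases le_or_gt t 0 with h0 | h0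
    · simp [hkdef, hU0 t h0, hu0 t h0, hP0 t h0]
    have hb := balance_integral (z := fun t x => u t x - v t x) (w := u) (hu.sub hv) hu
      (T := T) (c := c) (ω := ω) (t := t) (fun x => by simp [hu0, hv0]) ?_ ⟨h0.le, htT⟩ h1 h12 h2
    · rw [← intervalIntegral.integral_const_mul, add_right_comm, ← intervalIntegral.integral_add
        (((hu.sub hv).right t).intervalIntegrable _ _)
        ((((hu.sub hv).primitive.const_mul ω).right t).intervalIntegrable _ _)] at hb
      have : ∫ x in x₁..x₂, k t x = -∫ x in x₁..x₂, (u t x - v t x +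
          ω * ∫ s in (0:ℝ)..t, (u s x - v s x)) := by
        rw [← intervalIntegral.integral_neg]
        refine intervalIntegral.integral_congr fun x hx => ?_
        rw [uIcc_of_le h12] at hx
        have h3 := hvP t ⟨h0.le, htT⟩ x ⟨h1.trans hx.1, hx.2.trans h2⟩
        simp only [hkdef, hUdef]
        rw [intervalIntegral.integral_sub (hu.intervalIntegrable _ _ _)
          (hv.intervalIntegrable _ _ _), ← h3]
        ring
      rw [this]
      linarith
    · intro t ht x hx
      obtain ⟨e1, e2, e3, e4, e5⟩ := H t ht x hx
      refine ⟨e1.sub e3, e2.sub e4, e1, e2, ?_⟩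
      rw [show deriv (fun s => u s x - v s x) t = _ from (e1.hasDerivAt.sub e3.hasDerivAt).deriv]
      linarith
  have primitive_balance : ∀ t ≤ T, ∀ x₁ x₂, 0 ≤ x₁ → x₁ ≤ x₂ → x₂ ≤ 1 →
      c * ((∫ s in (0:ℝ)..t, U s x₂) - ∫ s in (0:ℝ)..t, U s x₁) =
        ∫ x in x₁..x₂, ∫ s in (0:ℝ)..t, k s x := by
    intro t htT x₁ x₂ h1 h12 h2
    rw [← hk.integral_swap, ← intervalIntegral.integral_sub (hU.intervalIntegrable _ _ _)
      (hU.intervalIntegrable _ _ _), ← intervalIntegral.integral_const_mul]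
    refine intervalIntegral.integral_congr fun s hs => integrated_balance s ?_ x₁ x₂ h1 h12 h2
    exact hs.2.trans (sup_le hT htT)
  set W : ℝ → ℝ → ℝ := fun t x => ∫ s in (0:ℝ)..t, U s x with hWdef
  set K : ℝ → ℝ → ℝ := fun t x => ∫ s in (0:ℝ)..t, k s x with hKdef
  set S : ℝ → ℝ → ℝ := fun t x => ∫ s in (0:ℝ)..t, M * P s x with hSdef
  have hchar : ∀ t ≤ T, W t x = Real.exp (-ω * (x / c)) * W (t - x / c) 0 +
      ∫ σ in (0:ℝ)..x / c, Real.exp (-ω * σ) * S (t - σ) (x - c * σ) := by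
    intro t ht
    refine transport_characteristic (U := U) (K := K) hc hU.continuous_primitive
      hu.continuous_primitive hk.continuous_primitive (hP.const_mul M).continuous_primitive ?_
      hU.hasDerivAt_primitive ?_ ht hx
    · intro t x
      simp only [hKdef, hkdef, hSdef]
      rw [intervalIntegral.integral_sub, intervalIntegral.integral_sub,
        intervalIntegral.integral_const_mul ω]
      exacts [(hP.const_mul M).intervalIntegrable _ _ _, hu.intervalIntegrable _ _ _,
        ((hP.const_mul M).sub hu).intervalIntegrable _ _ _,
        (hU.const_mul ω).intervalIntegrable _ _ _]
    · rintro t ht x ⟨hx0, hx1⟩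
      have h1 : HasDerivAt (fun y => W t 0 + (∫ y in (0:ℝ)..y, K t y) / c) (K t x / c) x :=
        (((hk.primitive.right t).integral_hasStrictDerivAt 0 x).hasDerivAt.div_const c).const_add _
      refine h1.congr_of_eventuallyEq ?_
      filter_upwards [Ioo_mem_nhds hx0 hx1] with y hy
      have := primitive_balance t ht.le 0 y le_rfl hy.1.le hy.2.le
      simp only [hKdef, ← this]
      field_simp
      ring
  have hd1 : HasDerivAt (fun t => W t x) (U t x) t := hU.hasDerivAt_primitive t x
  have hd2 : HasDerivAt (fun t => W (t - x / c) 0) (U (t - x / c) 0) t := by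
    simpa using (hU.hasDerivAt_primitive (t - x / c) 0).comp_sub_const t (x / c)
  have hd3 : HasDerivAt (fun t => ∫ σ in (0:ℝ)..x / c,
      Real.exp (-ω * σ) * S (t - σ) (x - c * σ))
      (∫ σ in (0:ℝ)..x / c, Real.exp (-ω * σ) * (M * P (t - σ) (x - c * σ))) t := by
    have hxc : 0 ≤ x / c := div_nonneg hx.1 hc.le
    obtain ⟨B, hB⟩ := (hP.const_mul M).bdd (|t| + 1 + x / c + 1)
    have hSc : ∀ t, Continuous fun σ => S (t - σ) (x - c * σ) := fun t =>
      (hP.const_mul M).continuous_primitive.comp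
        (by fun_prop : Continuous fun σ : ℝ => (t - σ, x - c * σ))
    have hexp : Continuous fun σ => Real.exp (-ω * σ) := by fun_prop
    have hPm : Measurable fun σ : ℝ => M * P (t - σ) (x - c * σ) :=
      (hP.const_mul M).measurable.comp
        (by fun_prop : Measurable fun σ : ℝ => (t - σ, x - c * σ))
    refine (intervalIntegral.hasDerivAt_integral_of_dominated_loc_of_deriv_le
      (bound := fun σ => Real.exp (-ω * σ) * B) (s := Metric.ball t 1)
      (F' := fun t σ => Real.exp (-ω * σ) * (M * P (t - σ) (x - c * σ)))
      (Metric.ball_mem_nhds t one_pos) ?_ ?_ ?_ ?_ ?_ ?_).2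
    · exact Eventually.of_forall fun t => (hexp.mul (hSc t)).aestronglyMeasurable
    · exact (hexp.mul (hSc t)).intervalIntegrable _ _
    · exact (hexp.measurable.mul hPm).aestronglyMeasurable
    · refine ae_of_all _ fun σ hσ s hs => ?_
      rw [uIoc_of_le hxc] at hσ
      rw [norm_mul, Real.norm_eq_abs, Real.abs_exp, Real.norm_eq_abs]
      refine mul_le_mul_of_nonneg_left (hB _ _ ?_ ?_) (Real.exp_pos _).le
      · rw [Metric.mem_ball, Real.dist_eq] at hs
        have h1 := abs_add_le (s - t + t) (-σ)
        have h2 := abs_add_le (s - t) t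
        rw [abs_neg, abs_of_pos hσ.1] at h1
        rw [show s - t + t + -σ = s - σ by ring] at h1
        linarith [hσ.2]
      · have h1 : c * σ ≤ x := by
          have := hσ.2
          rwa [le_div_iff₀ hc, mul_comm] at this
        have h2 : 0 < c * σ := mul_pos hc hσ.1
        rw [abs_le]
        constructor <;> linarith [abs_nonneg t, hx.2]
    · exact Continuous.intervalIntegrable (by fun_prop) _ _
    · refine ae_of_all _ fun σ _ s _ => HasDerivAt.const_mul _ ?_
      exact ((hP.const_mul M).hasDerivAt_primitive (s - σ) (x - c * σ)).comp_sub_const s σ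
  have hd4 := (hd2.const_mul (Real.exp (-ω * (x / c)))).add hd3
  have hd5 := hd4.congr_of_eventuallyEq (f₁ := fun t => W t x)
    (by filter_upwards [Iio_mem_nhds ht] with s hs using hchar s (le_of_lt hs))
  rw [← intervalIntegral.integral_const_mul M]
  have := hd1.unique hd5
  simp only [U] at this
  rw [this]
  congr 1
  refine intervalIntegral.integral_congr fun σ _ => ?_
  ring

end

section

open MeasureTheory Set Filter Topology
open scoped FourierTransform SchwartzMap ContDiff

/-- The `L²` Fourier transform agrees with the Fourier integral on `L¹ ∩ L²`. -/
theorem fourier_toLp_ae_eq {f : ℝ → ℂ} (hf : Integrable f) (hf2 : MemLp f 2) :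
    (𝓕 (hf2.toLp f) : Lp ℂ 2 (volume : Measure ℝ)) =ᵐ[volume] 𝓕 f := by
  have hcont : Continuous (𝓕 f) :=
    VectorFourier.fourierIntegral_continuous Real.continuous_fourierChar
      (by exact continuous_inner) hf
  refine ae_eq_of_integral_contDiff_smul_eq
    ((Lp.memLp _).locallyIntegrable (by norm_num)) hcont.locallyIntegrable fun g hg hgc => ?_
  have hg₁ : HasCompactSupport (Complex.ofRealCLM ∘ g) := hgc.comp_left rfl
  have hg₂ : ContDiff ℝ ∞ (Complex.ofRealCLM ∘ g) := by fun_prop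
  set G : 𝓢(ℝ, ℂ) := hg₁.toSchwartzMap hg₂
  have hG : ∀ x, G x = (g x : ℂ) := fun x => rfl
  have h1 := congrArg (fun D : 𝓢'(ℝ, ℂ) => D G)
    (Lp.fourier_toTemperedDistribution_eq (hf2.toLp f))
  simp only [TemperedDistribution.fourier_apply, Lp.toTemperedDistribution_apply] at h1
  have h2 : ∫ x, (𝓕 G) x • (hf2.toLp f) x = ∫ x, 𝓕 (G : ℝ → ℂ) x • f x := by
    refine integral_congr_ae ?_
    filter_upwards [hf2.coeFn_toLp] with x hx
    rw [hx, SchwartzMap.fourier_coe]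
  have h3 : ∫ x, 𝓕 (G : ℝ → ℂ) x • f x = ∫ x, G x • 𝓕 f x :=
    VectorFourier.integral_fourierIntegral_smul_eq_flip Real.continuous_fourierChar
      (L := innerₗ ℝ) (by exact continuous_inner) G.integrable hf |>.trans <| by
        simp [Real.fourier_eq, VectorFourier.fourierIntegral, innerₗ_apply_apply]
  rw [h2, h3] at h1
  simp only [hG] at h1
  simpa only [Complex.real_smul, smul_eq_mul] using h1.symm

/-- Plancherel's identity for functions in `L¹ ∩ L²`. -/
theorem lintegral_enorm_fourier_sq {f : ℝ → ℂ} (hf : Integrable f) (hf2 : MemLp f 2) :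
    ∫⁻ k, ‖𝓕 f k‖ₑ ^ 2 = ∫⁻ x, ‖f x‖ₑ ^ 2 := by
  have h1 : eLpNorm (𝓕 f) 2 = eLpNorm f 2 := by
    rw [← eLpNorm_congr_ae (fourier_toLp_ae_eq hf hf2), ← Lp.enorm_def, ← eLpNorm_congr_ae
      hf2.coeFn_toLp, ← Lp.enorm_def, ← ofReal_norm, ← ofReal_norm,
      Lp.norm_fourier_eq]
  have h2 : ∀ g : ℝ → ℂ, ∫⁻ x, ‖g x‖ₑ ^ 2 = eLpNorm g 2 ^ 2 := fun g => by
    simpa using (eLpNorm_nnreal_pow_eq_lintegral (μ := volume) (f := g) (p := 2) two_ne_zero).symm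
  rw [h2, h2, h1]

end

section

open MeasureTheory Set Filter Topology

/-- Oscillatory average `∫₀¹ (1 - μ ^ m) e^{-iaμ} dμ`. -/
noncomputable def oscAvg (m : ℕ) (a : ℝ) : ℂ :=
  ∫ μ in (0:ℝ)..1, ((1 - μ ^ m : ℝ) : ℂ) * Complex.exp (-(a * μ : ℝ) * Complex.I)

/-- The derivative of `oscAvg`. -/
noncomputable def oscAvgDeriv (m : ℕ) (a : ℝ) : ℂ :=
  ∫ μ in (0:ℝ)..1, ((1 - μ ^ m : ℝ) : ℂ) *
    (Complex.exp (-(a * μ : ℝ) * Complex.I) * (-(μ : ℂ) * Complex.I))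

theorem norm_exp_neg_ofReal_mul_I (r : ℝ) : ‖Complex.exp (-(r : ℂ) * Complex.I)‖ = 1 := by
  rw [← Complex.ofReal_neg, Complex.norm_exp_ofReal_mul_I]

theorem abs_one_sub_pow_le {μ : ℝ} (hμ : μ ∈ Icc (0:ℝ) 1) (m : ℕ) : |1 - μ ^ m| ≤ 1 := by
  have h1 := pow_le_one₀ (n := m) hμ.1 hμ.2
  have h2 := pow_nonneg hμ.1 m
  rw [abs_le]; constructor <;> linarith

theorem norm_oscAvg_le (m : ℕ) (a : ℝ) : ‖oscAvg m a‖ ≤ 1 := by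
  have := intervalIntegral.norm_integral_le_of_norm_le_const (a := (0:ℝ)) (b := 1) (C := 1)
    (f := fun μ : ℝ => ((1 - μ ^ m : ℝ) : ℂ) * Complex.exp (-(a * μ : ℝ) * Complex.I))
    fun μ hμ => by
      rw [uIoc_of_le zero_le_one] at hμ
      rw [norm_mul, norm_exp_neg_ofReal_mul_I, mul_one, Complex.norm_real]
      exact abs_one_sub_pow_le (Ioc_subset_Icc_self hμ) m
  simpa [oscAvg] using this

theorem hasDerivAt_oscAvg (m : ℕ) (a : ℝ) : HasDerivAt (oscAvg m) (oscAvgDeriv m a) a := by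
  refine (intervalIntegral.hasDerivAt_integral_of_dominated_loc_of_deriv_le (s := univ)
    (bound := fun _ => 1)
    (F := fun (a μ : ℝ) => ((1 - μ ^ m : ℝ) : ℂ) * Complex.exp (-(a * μ : ℝ) * Complex.I))
    (F' := fun (a μ : ℝ) => ((1 - μ ^ m : ℝ) : ℂ) *
      (Complex.exp (-(a * μ : ℝ) * Complex.I) * (-(μ : ℂ) * Complex.I)))
    univ_mem ?_ ?_ ?_ ?_ ?_ ?_).2
  · exact Eventually.of_forall fun a => Continuous.aestronglyMeasurable (by fun_prop)
  · exact Continuous.intervalIntegrable (by fun_prop) _ _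
  · exact Continuous.aestronglyMeasurable (by fun_prop)
  · refine ae_of_all _ fun μ hμ a _ => ?_
    rw [uIoc_of_le zero_le_one] at hμ
    rw [norm_mul, norm_mul, norm_exp_neg_ofReal_mul_I, one_mul, Complex.norm_real, norm_mul,
      norm_neg, Complex.norm_I, mul_one, Complex.norm_real, Real.norm_eq_abs, Real.norm_eq_abs,
      abs_of_pos hμ.1]
    exact mul_le_one₀ (abs_one_sub_pow_le (Ioc_subset_Icc_self hμ) m) hμ.1.le hμ.2
  · exact Continuous.intervalIntegrable (by fun_prop) _ _
  · refine ae_of_all _ fun μ _ a _ => HasDerivAt.const_mul _ ?_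
    refine HasDerivAt.cexp ?_
    have h1 : HasDerivAt (fun a : ℝ => ((a * μ : ℝ) : ℂ)) ((μ : ℝ) : ℂ) a := by
      simpa using ((hasDerivAt_id a).mul_const μ).ofReal_comp
    simpa using h1.neg.mul_const Complex.I

theorem sq_mul_norm_oscAvgDeriv_le (m : ℕ) (a : ℝ) :
    a ^ 2 * ‖oscAvgDeriv m a‖ ≤ m ^ 2 + 3 * m + 1 := by
  set E : ℝ → ℂ := fun μ => Complex.exp (-(a * μ : ℝ) * Complex.I) with hE
  have hEd : ∀ μ, HasDerivAt E (E μ * (-(a : ℂ) * Complex.I)) μ := fun μ => by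
    refine HasDerivAt.cexp ?_
    have h1 : HasDerivAt (fun μ : ℝ => ((a * μ : ℝ) : ℂ)) ((a : ℝ) : ℂ) μ := by
      simpa using ((hasDerivAt_id μ).const_mul a).ofReal_comp
    simpa using h1.neg.mul_const Complex.I
  have hEn : ∀ μ, ‖E μ‖ = 1 := fun μ => norm_exp_neg_ofReal_mul_I _
  have hθd : ∀ μ : ℝ, HasDerivAt (fun μ : ℝ => ((μ - μ ^ (m + 1) : ℝ) : ℂ))
      ((1 - (m + 1) * μ ^ m : ℝ) : ℂ) μ := fun μ => by
    have := ((hasDerivAt_id μ).sub (hasDerivAt_pow (m + 1) μ)).ofReal_comp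
    simpa using this
  have hθdd : ∀ μ : ℝ, HasDerivAt (fun μ : ℝ => ((1 - (m + 1) * μ ^ m : ℝ) : ℂ))
      ((-((m + 1) * (m * μ ^ (m - 1))) : ℝ) : ℂ) μ := fun μ => by
    have := ((hasDerivAt_pow m μ).const_mul ((m : ℝ) + 1)).const_sub 1 |>.ofReal_comp
    simpa using this
  have hΦ : ∀ μ : ℝ, HasDerivAt (fun μ : ℝ => ((μ - μ ^ (m + 1) : ℝ) : ℂ) *
      (E μ * (-(a : ℂ) * Complex.I)) - ((1 - (m + 1) * μ ^ m : ℝ) : ℂ) * E μ)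
      ((-a ^ 2 * Complex.I) * (((1 - μ ^ m : ℝ) : ℂ) * (E μ * (-(μ : ℂ) * Complex.I)))
        - ((-((m + 1) * (m * μ ^ (m - 1))) : ℝ) : ℂ) * E μ) μ := fun μ => by
    refine (((hθd μ).mul ((hEd μ).mul_const (-(a : ℂ) * Complex.I))).sub
      ((hθdd μ).mul (hEd μ))).congr_deriv ?_
    push_cast
    ring
  have hftc := intervalIntegral.integral_eq_sub_of_hasDerivAt (a := 0) (b := 1) (fun μ _ => hΦ μ)
    (Continuous.intervalIntegrable (by fun_prop) _ _)
  rw [intervalIntegral.integral_sub (Continuous.intervalIntegrable (by fun_prop) _ _)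
    (Continuous.intervalIntegrable (by fun_prop) _ _), intervalIntegral.integral_const_mul] at hftc
  change (-(a:ℂ) ^ 2 * Complex.I) * oscAvgDeriv m a - _ = _ at hftc
  rw [sub_eq_iff_eq_add] at hftc
  have hn := congrArg norm hftc
  have e1 : ‖(-(a:ℂ) ^ 2 * Complex.I) * oscAvgDeriv m a‖ = a ^ 2 * ‖oscAvgDeriv m a‖ := by
    simp
  rw [e1] at hn
  rw [hn]
  have b1 : ‖∫ μ in (0:ℝ)..1, ((-((m + 1) * (m * μ ^ (m - 1))) : ℝ) : ℂ) * E μ‖ ≤ (m + 1) * m := by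
    have := intervalIntegral.norm_integral_le_of_norm_le_const (a := (0:ℝ)) (b := 1)
      (C := (m + 1) * m) (f := fun μ : ℝ => ((-((m + 1) * (m * μ ^ (m - 1))) : ℝ) : ℂ) * E μ)
      fun μ hμ => by
        rw [uIoc_of_le zero_le_one] at hμ
        rw [norm_mul, hEn, mul_one, Complex.norm_real, norm_neg, Real.norm_eq_abs,
          abs_of_nonneg (by have := hμ.1; positivity)]
        have := pow_le_one₀ (n := m - 1) hμ.1.le hμ.2
        gcongr
        exact mul_le_of_le_one_right (by positivity) this
    simpa using this
  refine (norm_add_le _ _).trans ?_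
  have b2 := norm_sub_le (((1 - (1:ℝ) ^ (m + 1) : ℝ) : ℂ) *
      (E 1 * (-(a : ℂ) * Complex.I)) - ((1 - (m + 1) * (1:ℝ) ^ m : ℝ) : ℂ) * E 1)
      (((0 - (0:ℝ) ^ (m + 1) : ℝ) : ℂ) *
      (E 0 * (-(a : ℂ) * Complex.I)) - ((1 - (m + 1) * (0:ℝ) ^ m : ℝ) : ℂ) * E 0)
  have b3 : ‖((1 - (1:ℝ) ^ (m + 1) : ℝ) : ℂ) *
      (E 1 * (-(a : ℂ) * Complex.I)) - ((1 - (m + 1) * (1:ℝ) ^ m : ℝ) : ℂ) * E 1‖ ≤ m := by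
    simp [hEn]
  have b4 : ‖((0 - (0:ℝ) ^ (m + 1) : ℝ) : ℂ) *
      (E 0 * (-(a : ℂ) * Complex.I)) - ((1 - (m + 1) * (0:ℝ) ^ m : ℝ) : ℂ) * E 0‖ ≤ m + 1 := by
    have h0 : (0:ℝ) - 0 ^ (m + 1) = 0 := by simp
    rw [h0, Complex.ofReal_zero, zero_mul, zero_sub, norm_neg, norm_mul, hEn, mul_one,
      Complex.norm_real, Real.norm_eq_abs, abs_le]
    rcases Nat.eq_zero_or_pos m with rfl | hm
    · norm_num
    · rw [zero_pow hm.ne']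
      constructor <;> simp <;> linarith [(Nat.cast_nonneg m : (0:ℝ) ≤ m)]
  nlinarith

theorem norm_oscAvgDeriv_le (m : ℕ) (a : ℝ) :
    ‖oscAvgDeriv m a‖ ≤ (m + 2) ^ 2 * (1 + a ^ 2)⁻¹ := by
  have h1 : ‖oscAvgDeriv m a‖ ≤ 1 := by
    have := intervalIntegral.norm_integral_le_of_norm_le_const (a := (0:ℝ)) (b := 1) (C := 1)
      (f := fun μ : ℝ => ((1 - μ ^ m : ℝ) : ℂ) *
        (Complex.exp (-(a * μ : ℝ) * Complex.I) * (-(μ : ℂ) * Complex.I)))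
      fun μ hμ => by
        rw [uIoc_of_le zero_le_one] at hμ
        rw [norm_mul, norm_mul, norm_exp_neg_ofReal_mul_I, one_mul, Complex.norm_real, norm_mul,
          norm_neg, Complex.norm_I, mul_one, Complex.norm_real, Real.norm_eq_abs, Real.norm_eq_abs,
          abs_of_pos hμ.1]
        exact mul_le_one₀ (abs_one_sub_pow_le (Ioc_subset_Icc_self hμ) m) hμ.1.le hμ.2
    simpa [oscAvgDeriv] using this
  have h2 := sq_mul_norm_oscAvgDeriv_le m a
  rw [← div_eq_mul_inv, le_div_iff₀ (by positivity)]
  nlinarith [(Nat.cast_nonneg m : (0:ℝ) ≤ m)]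

theorem continuous_oscAvgDeriv (m : ℕ) : Continuous (oscAvgDeriv m) := by
  refine intervalIntegral.continuous_parametric_intervalIntegral_of_continuous' ?_ 0 1
  simp only [Function.uncurry_def]
  fun_prop

end

section

open MeasureTheory Set Filter Topology

theorem ENNReal.two_mul_le_add_sq' (a b : ENNReal) : 2 * (a * b) ≤ a ^ 2 + b ^ 2 := by
  induction a with
  | top => simp
  | coe a =>
    induction b with
    | top => simp
    | coe b =>
      norm_cast
      rw [← mul_assoc]
      exact two_mul_le_add_sq a b

/-- Weighted Cauchy–Schwarz inequality. -/
theorem lintegral_mul_sq_le {α : Type*} [MeasurableSpace α] {ν : Measure α} {d p : α → ENNReal}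
    (hd : Measurable d) (hp : Measurable p) :
    (∫⁻ s, d s * p s ∂ν) ^ 2 ≤ (∫⁻ s, d s ∂ν) * ∫⁻ s, d s * p s ^ 2 ∂ν := by
  have key : 2 * (∫⁻ s, d s * p s ∂ν) ^ 2 ≤ 2 * ((∫⁻ s, d s ∂ν) * ∫⁻ s, d s * p s ^ 2 ∂ν) := by
    have e1 : 2 * (∫⁻ s, d s * p s ∂ν) ^ 2 =
        ∫⁻ s, ∫⁻ r, d s * d r * (2 * (p s * p r)) ∂ν ∂ν := by
      have hdp : Measurable fun s => d s * p s := hd.mul hp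
      rw [sq, ← lintegral_mul_const _ hdp, ← lintegral_const_mul _ (by fun_prop)]
      refine lintegral_congr fun s => ?_
      rw [← lintegral_const_mul _ hdp, ← lintegral_const_mul _ (by fun_prop)]
      exact lintegral_congr fun r => by ring
    have e2 : 2 * ((∫⁻ s, d s ∂ν) * ∫⁻ s, d s * p s ^ 2 ∂ν) =
        ∫⁻ s, ∫⁻ r, d s * d r * (p s ^ 2 + p r ^ 2) ∂ν ∂ν := by
      have : ∀ s, ∫⁻ r, d s * d r * (p s ^ 2 + p r ^ 2) ∂ν =
          (d s * p s ^ 2) * (∫⁻ r, d r ∂ν) + d s * ∫⁻ r, d r * p r ^ 2 ∂ν := fun s => by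
        rw [← lintegral_const_mul _ hd, ← lintegral_const_mul _ (by fun_prop),
          ← lintegral_add_left (by fun_prop)]
        exact lintegral_congr fun r => by ring
      simp_rw [this]
      rw [lintegral_add_left (by fun_prop), lintegral_mul_const _ (by fun_prop),
        lintegral_mul_const _ hd]
      ring
    rw [e1, e2]
    exact lintegral_mono fun s => lintegral_mono fun r =>
      mul_le_mul_right (ENNReal.two_mul_le_add_sq' _ _) _
  rwa [ENNReal.mul_le_mul_iff_right two_ne_zero (by simp)] at key

/-- Young's inequality `‖D * p‖₂ ≤ ‖D‖₁ ‖p‖₂` on the line. -/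
theorem lintegral_convolution_sq_le {D p : ℝ → ℂ} (hD : Measurable D) (hp : Measurable p) :
    ∫⁻ t, ‖∫ σ, D σ * p (t - σ)‖ₑ ^ 2 ≤ (∫⁻ σ, ‖D σ‖ₑ) ^ 2 * ∫⁻ t, ‖p t‖ₑ ^ 2 := by
  calc ∫⁻ t, ‖∫ σ, D σ * p (t - σ)‖ₑ ^ 2
      ≤ ∫⁻ t, (∫⁻ σ, ‖D σ‖ₑ) * ∫⁻ σ, ‖D σ‖ₑ * ‖p (t - σ)‖ₑ ^ 2 := by
        refine lintegral_mono fun t => ?_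
        refine le_trans ?_ (lintegral_mul_sq_le hD.enorm (by fun_prop))
        gcongr
        refine (enorm_integral_le_lintegral_enorm _).trans_eq ?_
        exact lintegral_congr fun σ => enorm_mul _ _
    _ = (∫⁻ σ, ‖D σ‖ₑ) * ∫⁻ t, ∫⁻ σ, ‖D σ‖ₑ * ‖p (t - σ)‖ₑ ^ 2 :=
        lintegral_const_mul _ (Measurable.lintegral_prod_right'
          (f := fun z : ℝ × ℝ => ‖D z.2‖ₑ * ‖p (z.1 - z.2)‖ₑ ^ 2) (by fun_prop))
    _ = (∫⁻ σ, ‖D σ‖ₑ) * ∫⁻ σ, ∫⁻ t, ‖D σ‖ₑ * ‖p (t - σ)‖ₑ ^ 2 := by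
        rw [lintegral_lintegral_swap (by fun_prop)]
    _ = (∫⁻ σ, ‖D σ‖ₑ) ^ 2 * ∫⁻ t, ‖p t‖ₑ ^ 2 := by
        have : ∀ σ, ∫⁻ t, ‖D σ‖ₑ * ‖p (t - σ)‖ₑ ^ 2 = ‖D σ‖ₑ * ∫⁻ t, ‖p t‖ₑ ^ 2 := fun σ => by
          rw [lintegral_const_mul _ (by fun_prop),
            lintegral_sub_right_eq_self (fun t => ‖p t‖ₑ ^ 2)]
        simp_rw [this]
        rw [lintegral_mul_const _ hD.enorm]
        ring

/-- `L¹` modulus of continuity of a one-sided kernel. -/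
theorem lintegral_shift_sub_le {K K' : ℝ → ℂ} (hK : ∀ σ, HasDerivAt K (K' σ) σ)
    (hK' : Continuous K') (hK1 : ∀ σ ≥ 0, ‖K σ‖ ≤ 1) {h : ℝ} (hh : 0 < h) :
    ∫⁻ σ, ‖(Ioi 0).indicator K (σ + h) - (Ioi 0).indicator K σ‖ₑ ≤
      ENNReal.ofReal h * (1 + ∫⁻ σ in Ioi 0, ‖K' σ‖ₑ) := by
  have hm : Measurable (Function.uncurry fun σ r => ‖K' (σ + r)‖ₑ) :=
    (by fun_prop : Continuous fun z : ℝ × ℝ => ‖K' (z.1 + z.2)‖ₑ).measurable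
  calc ∫⁻ σ, ‖(Ioi 0).indicator K (σ + h) - (Ioi 0).indicator K σ‖ₑ
      ≤ ∫⁻ σ, ((Ioc (-h) 0).indicator (fun _ => 1) σ +
          (Ioi 0).indicator (fun σ => ∫⁻ r in Ioc 0 h, ‖K' (σ + r)‖ₑ) σ) := by
        refine lintegral_mono fun σ => ?_
        rcases lt_or_ge 0 σ with h0 | h0
        · have h1 : σ ∉ Ioc (-h) 0 := fun h => h.2.not_gt h0
          rw [indicator_of_notMem h1, zero_add, indicator_of_mem (show σ ∈ Ioi 0 from h0),
            indicator_of_mem (show σ ∈ Ioi 0 from h0),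
            indicator_of_mem (show σ + h ∈ Ioi 0 from add_pos h0 hh)]
          have := intervalIntegral.integral_eq_sub_of_hasDerivAt (a := 0) (b := h)
            (f := fun r => K (σ + r)) (f' := fun r => K' (σ + r))
            (fun r _ => (hK (σ + r)).comp_const_add σ r)
            (Continuous.intervalIntegrable (by fun_prop) _ _)
          rw [add_zero] at this
          rw [← this, intervalIntegral.integral_of_le hh.le]
          exact enorm_integral_le_lintegral_enorm _
        · have h1 : σ ∉ Ioi 0 := not_lt.2 h0
          rw [indicator_of_notMem h1, indicator_of_notMem h1, sub_zero, add_zero]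
          rcases lt_or_ge (-h) σ with h2 | h2
          · rw [indicator_of_mem (show σ ∈ Ioc (-h) 0 from ⟨h2, h0⟩),
              indicator_of_mem (show σ + h ∈ Ioi 0 from by simp; linarith)]
            have := hK1 (σ + h) (by linarith)
            rw [← ofReal_norm]
            exact ENNReal.ofReal_le_one.2 this
          · rw [indicator_of_notMem (show σ + h ∉ Ioi 0 from by simp; linarith)]
            simp
    _ = ENNReal.ofReal h + ∫⁻ σ in Ioi 0, ∫⁻ r in Ioc 0 h, ‖K' (σ + r)‖ₑ := by
        rw [lintegral_add_left ((measurable_const).indicator measurableSet_Ioc),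
          lintegral_indicator measurableSet_Ioc, lintegral_indicator measurableSet_Ioi]
        simp
    _ = ENNReal.ofReal h + ∫⁻ r in Ioc 0 h, ∫⁻ σ in Ioi 0, ‖K' (σ + r)‖ₑ := by
        rw [lintegral_lintegral_swap hm.aemeasurable]
    _ ≤ ENNReal.ofReal h + ∫⁻ r in Ioc 0 h, ∫⁻ σ in Ioi 0, ‖K' σ‖ₑ := by
        refine add_le_add le_rfl ?_
        refine setLIntegral_mono' (measurableSet_Ioc (a := (0:ℝ))) fun r hr => ?_
        have : ∫⁻ σ in Ioi 0, ‖K' (σ + r)‖ₑ = ∫⁻ σ in Ioi r, ‖K' σ‖ₑ := by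
          rw [← lintegral_indicator measurableSet_Ioi, ← lintegral_indicator measurableSet_Ioi,
            ← lintegral_add_right_eq_self (fun σ => (Ioi r).indicator (fun σ => ‖K' σ‖ₑ) σ) r]
          refine lintegral_congr fun σ => ?_
          simp [indicator_apply]
        rw [this]
        exact lintegral_mono_set (Ioi_subset_Ioi hr.1.le)
    _ = ENNReal.ofReal h * (1 + ∫⁻ σ in Ioi 0, ‖K' σ‖ₑ) := by
        simp only [lintegral_const, Measure.restrict_apply MeasurableSet.univ, univ_inter,
          Real.volume_Ioc, sub_zero]
        ring

/-- The symbol of the velocity average along characteristics. -/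
noncomputable def symbolKernel (m : ℕ) (ω b σ : ℝ) : ℂ := (Real.exp (-ω * σ) : ℂ) * oscAvg m (b * σ)

theorem lintegral_symbolKernel_shift_le (m : ℕ) {ω : ℝ} (hω : 0 < ω) (b : ℝ) {h : ℝ} (hh : 0 < h) :
    ∫⁻ σ, ‖(Ioi 0).indicator (symbolKernel m ω b) (σ + h) -
      (Ioi 0).indicator (symbolKernel m ω b) σ‖ₑ ≤
      ENNReal.ofReal (h * (2 + (m + 2) ^ 2 * Real.pi)) := by
  set K' : ℝ → ℂ := fun σ => ((Real.exp (-ω * σ) * (-ω) : ℝ) : ℂ) * oscAvg m (b * σ) +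
    (Real.exp (-ω * σ) : ℂ) * (b * oscAvgDeriv m (b * σ)) with hK'def
  have hosc : ∀ σ, HasDerivAt (fun σ => oscAvg m (b * σ)) (b * oscAvgDeriv m (b * σ)) σ := fun σ => by
    have := (hasDerivAt_oscAvg m (b * σ)).scomp σ ((hasDerivAt_id σ).const_mul b)
    exact this.congr_deriv (by simp)
  have hexp : ∀ σ, HasDerivAt (fun σ => Real.exp (-ω * σ)) (Real.exp (-ω * σ) * (-ω)) σ := fun σ => by
    simpa using ((hasDerivAt_id σ).const_mul (-ω)).exp
  have hK : ∀ σ, HasDerivAt (symbolKernel m ω b) (K' σ) σ := fun σ =>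
    (hexp σ).ofReal_comp.mul (hosc σ)
  have hcosc : Continuous fun σ => oscAvg m (b * σ) :=
    continuous_iff_continuousAt.2 fun σ => (hosc σ).continuousAt
  have hcosc' := continuous_oscAvgDeriv m
  have hK'c : Continuous K' := by fun_prop
  refine (lintegral_shift_sub_le hK hK'c ?_ hh).trans ?_
  · intro σ hσ
    rw [symbolKernel, norm_mul, Complex.norm_real, Real.norm_eq_abs, Real.abs_exp]
    exact mul_le_one₀ (Real.exp_le_one_iff.2 (by nlinarith)) (norm_nonneg _) (norm_oscAvg_le _ _)
  rw [ENNReal.ofReal_mul hh.le]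
  gcongr
  set F : ℝ → ℝ := fun σ => ω * Real.exp (-ω * σ) + (m + 2) ^ 2 * (|b| * (1 + (b * σ) ^ 2)⁻¹) with hF
  have hle : ∫⁻ σ in Ioi 0, ‖K' σ‖ₑ ≤ ∫⁻ σ in Ioi 0, ENNReal.ofReal (F σ) := by
    refine setLIntegral_mono' measurableSet_Ioi fun σ hσ => ?_
    rw [← ofReal_norm]
    refine ENNReal.ofReal_le_ofReal ((norm_add_le _ _).trans (add_le_add ?_ ?_))
    · rw [norm_mul, Complex.norm_real, Real.norm_eq_abs, abs_mul, Real.abs_exp, abs_neg,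
        abs_of_pos hω, mul_comm ω]
      exact mul_le_of_le_one_right (by positivity) (norm_oscAvg_le _ _)
    · rw [norm_mul, norm_mul, Complex.norm_real, Complex.norm_real, Real.norm_eq_abs, Real.abs_exp,
        Real.norm_eq_abs]
      have h1 : Real.exp (-ω * σ) ≤ 1 := Real.exp_le_one_iff.2 (by nlinarith [mem_Ioi.1 hσ])
      calc Real.exp (-ω * σ) * (|b| * ‖oscAvgDeriv m (b * σ)‖)
          ≤ 1 * (|b| * ((m + 2) ^ 2 * (1 + (b * σ) ^ 2)⁻¹)) := by
            gcongr
            exact norm_oscAvgDeriv_le _ _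
        _ = _ := by ring
  have i1 : IntegrableOn (fun σ => ω * Real.exp (-ω * σ)) (Ioi 0) :=
    (exp_neg_integrableOn_Ioi 0 hω).const_mul ω
  have i2 : Integrable fun σ => |b| * (1 + (b * σ) ^ 2)⁻¹ := by
    rcases eq_or_ne b 0 with rfl | hb
    · simp
    · exact (integrable_inv_one_add_sq.comp_mul_left' hb).const_mul _
  have v1 : ∫ σ in Ioi 0, ω * Real.exp (-ω * σ) = 1 := by
    rw [integral_const_mul, integral_exp_mul_Ioi (by linarith) 0]
    simp [hω.ne']
  have v2 : ∫ σ in Ioi (0:ℝ), |b| * (1 + (b * σ) ^ 2)⁻¹ ≤ Real.pi := by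
    refine (setIntegral_le_integral i2 (ae_of_all _ fun σ => by positivity)).trans ?_
    rcases eq_or_ne b 0 with rfl | hb
    · simp [Real.pi_pos.le]
    · rw [integral_const_mul, Measure.integral_comp_mul_left (fun y : ℝ => (1 + y ^ 2)⁻¹),
        integral_univ_inv_one_add_sq, smul_eq_mul, abs_inv, mul_inv_cancel_left₀ (by simpa)]
  have hFi : IntegrableOn F (Ioi 0) := i1.add ((i2.integrableOn).const_mul _)
  rw [← ofReal_integral_eq_lintegral_ofReal hFi (ae_of_all _ fun σ => by positivity)] at hle
  have v3 : ∫ σ in Ioi 0, F σ ≤ 1 + (m + 2) ^ 2 * Real.pi := by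
    rw [hF, integral_add i1 ((i2.integrableOn).const_mul _), v1, integral_const_mul]
    gcongr
  calc 1 + ∫⁻ σ in Ioi 0, ‖K' σ‖ₑ ≤ ENNReal.ofReal 1 + ENNReal.ofReal (1 + (m + 2) ^ 2 * Real.pi) := by
        rw [ENNReal.ofReal_one]
        gcongr
        exact hle.trans (ENNReal.ofReal_le_ofReal v3)
    _ = _ := by
        rw [← ENNReal.ofReal_add zero_le_one (by positivity)]
        congr 1
        ring

end

section

open MeasureTheory Set Filter Topology
open scoped FourierTransform

theorem integrable_comp_shear {Y : Type*} [MeasurableSpace Y] {ν : Measure Y} [SFinite ν]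
    {w : Y → ℂ} (hw : Integrable w ν) {a : Y → ℝ} (ha : Measurable a) {f : Y → ℝ → ℂ}
    (hf : Measurable (Function.uncurry f)) {C : ℝ} (hC : ∀ y x, ‖f y x‖ ≤ C)
    (hsupp : ∀ y, ∀ x ∉ Icc (0:ℝ) 1, f y x = 0) :
    Integrable (fun z : ℝ × Y => w z.2 * f z.2 (z.1 - a z.2)) (volume.prod ν) := by
  have hsh : MeasurePreserving (fun z : Y × ℝ => (z.1, z.2 - a z.1)) (ν.prod volume)
      (ν.prod volume) :=
    (MeasurePreserving.id ν).skew_product (g := fun y x => x - a y) (by fun_prop)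
      (ae_of_all _ fun y => (measurePreserving_sub_right volume (a y)).map_eq)
  have h0 : Integrable (fun z : Y × ℝ => w z.1 * f z.1 z.2) (ν.prod volume) := by
    have h1 : Integrable (fun z : Y × ℝ => w z.1 * (Icc (0:ℝ) 1).indicator (fun _ => (1:ℂ)) z.2)
        (ν.prod volume) :=
      hw.mul_prod ((integrable_indicator_iff measurableSet_Icc).2 (by simp))
    refine (h1.bdd_mul (c := C) (f := Function.uncurry f) hf.aestronglyMeasurable
      (ae_of_all _ fun z => hC _ _)).congr (ae_of_all _ fun z => ?_)
    by_cases hz : z.2 ∈ Icc (0:ℝ) 1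
    · simp only [indicator_of_mem hz, Function.uncurry]; ring
    · simp only [indicator_of_notMem hz, hsupp _ _ hz]; ring
  have h2 : Integrable (fun z : Y × ℝ => w z.1 * f z.1 (z.2 - a z.1)) (ν.prod volume) :=
    hsh.integrable_comp_of_integrable h0
  exact h2.swap

theorem fourier_average_shift {Y : Type*} [MeasurableSpace Y] {ν : Measure Y} [SFinite ν]
    {w : Y → ℂ} (hw : Integrable w ν) {a : Y → ℝ} (ha : Measurable a) {f : Y → ℝ → ℂ}
    (hf : Measurable (Function.uncurry f)) {C : ℝ} (hC : ∀ y x, ‖f y x‖ ≤ C)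
    (hsupp : ∀ y, ∀ x ∉ Icc (0:ℝ) 1, f y x = 0) (k : ℝ) :
    𝓕 (fun x => ∫ y, w y * f y (x - a y) ∂ν) k =
      ∫ y, w y * Complex.exp (-(2 * Real.pi * k * a y : ℝ) * Complex.I) * 𝓕 (f y) k ∂ν := by
  have hI := integrable_comp_shear hw ha hf hC hsupp
  simp only [Real.fourier_real_eq_integral_exp_smul, smul_eq_mul]
  simp_rw [← integral_const_mul]
  rw [integral_integral_swap]
  · refine integral_congr_ae (ae_of_all _ fun y => ?_)
    simp only
    rw [← integral_sub_right_eq_self (fun x => w y * Complex.exp (-(2 * Real.pi * k * a y : ℝ) *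
      Complex.I) * (Complex.exp ((-2 * Real.pi * x * k : ℝ) * Complex.I) * f y x)) (a y)]
    refine integral_congr_ae (ae_of_all _ fun x => ?_)
    simp only
    rw [mul_assoc (w y), ← mul_assoc (Complex.exp _) (Complex.exp _), ← Complex.exp_add,
      mul_left_comm]
    congr 3
    push_cast
    ring
  · refine hI.bdd_mul (c := 1) (f := fun z : ℝ × Y =>
      Complex.exp ((-2 * Real.pi * z.1 * k : ℝ) * Complex.I)) ?_ (ae_of_all _ fun z => ?_)
    · exact (by fun_prop : Measurable _).aestronglyMeasurable
    · rw [Complex.norm_exp_ofReal_mul_I]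

theorem measurable_fourier_right {P : ℝ → ℝ → ℂ} (hP : Measurable (Function.uncurry P)) :
    Measurable fun z : ℝ × ℝ => 𝓕 (P z.1) z.2 := by
  simp only [Real.fourier_real_eq_integral_exp_smul, smul_eq_mul]
  refine (StronglyMeasurable.integral_prod_right' (ν := volume) (f := fun z : (ℝ × ℝ) × ℝ =>
    Complex.exp ((-2 * Real.pi * z.2 * z.1.2 : ℝ) * Complex.I) * P z.1.1 z.2)
    (Measurable.stronglyMeasurable ?_)).measurable
  have : Measurable fun z : (ℝ × ℝ) × ℝ => P z.1.1 z.2 :=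
    hP.comp ((measurable_fst.fst).prodMk measurable_snd)
  fun_prop

theorem norm_fourier_le_of_support {f : ℝ → ℂ} {C : ℝ} (hC : ∀ x, ‖f x‖ ≤ C)
    (hsupp : ∀ x ∉ Icc (0:ℝ) 1, f x = 0) (k : ℝ) : ‖𝓕 f k‖ ≤ C := by
  rw [Real.fourier_real_eq_integral_exp_smul, ← setIntegral_eq_integral_of_forall_compl_eq_zero
    (s := Icc (0:ℝ) 1) fun x hx => by rw [hsupp x hx, smul_zero]]
  refine (norm_setIntegral_le_of_norm_le_const (C := C) (by simp) fun x _ => ?_).trans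
    (by simp)
  rw [norm_smul, Complex.norm_exp_ofReal_mul_I, one_mul]
  exact hC x

end

section

open MeasureTheory Set Filter Topology
open scoped FourierTransform

/-- Product of the velocity interval and the half-line of elapsed times. -/
noncomputable def rayMeasure : Measure (ℝ × ℝ) :=
  (volume.restrict (Ioc (0:ℝ) 1)).prod (volume.restrict (Ioi (0:ℝ)))

instance : SFinite rayMeasure := by unfold rayMeasure; infer_instance

/-- Weight of the truncated velocity average along rays. -/
noncomputable def rayWeight (m : ℕ) (ω : ℝ) (y : ℝ × ℝ) : ℝ :=
  (1 - y.1 ^ m) * Real.exp (-ω * y.2)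

theorem integrable_rayWeight (m : ℕ) {ω : ℝ} (hω : 0 < ω) :
    Integrable (rayWeight m ω) rayMeasure :=
  Integrable.mul_prod (f := fun μ : ℝ => 1 - μ ^ m) (g := fun σ => Real.exp (-ω * σ))
    (Continuous.integrableOn_Ioc (by fun_prop)) (exp_neg_integrableOn_Ioi 0 hω)

theorem integrable_ofReal_rayWeight (m : ℕ) {ω : ℝ} (hω : 0 < ω) :
    Integrable (fun y => (rayWeight m ω y : ℂ)) rayMeasure :=
  Complex.ofRealCLM.integrable_comp (integrable_rayWeight m hω)

theorem integrable_symbolKernel_indicator (m : ℕ) {ω : ℝ} (hω : 0 < ω) (b : ℝ) :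
    Integrable ((Ioi 0).indicator (symbolKernel m ω b)) := by
  rw [integrable_indicator_iff measurableSet_Ioi]
  have hc : Continuous (oscAvg m) :=
    continuous_iff_continuousAt.2 fun a => (hasDerivAt_oscAvg m a).continuousAt
  refine (exp_neg_integrableOn_Ioi 0 hω).mono' ?_ (ae_of_all _ fun σ => ?_)
  · unfold symbolKernel
    exact (by fun_prop : Continuous _).aestronglyMeasurable
  · rw [symbolKernel, norm_mul, Complex.norm_real, Real.norm_eq_abs, Real.abs_exp]
    exact mul_le_of_le_one_right (Real.exp_pos _).le (norm_oscAvg_le _ _)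

theorem integral_ray_symbol (m : ℕ) {ω : ℝ} (hω : 0 < ω) (k b : ℝ) {q : ℝ → ℂ}
    (hq : Measurable q) {C : ℝ} (hC : ∀ r, ‖q r‖ ≤ C) :
    ∫ y, (rayWeight m ω y : ℂ) * Complex.exp (-(2 * Real.pi * k * (y.1 * b * y.2) : ℝ) * Complex.I) *
      q y.2 ∂rayMeasure =
    ∫ σ, (Ioi 0).indicator (symbolKernel m ω (2 * Real.pi * k * b)) σ * q σ := by
  have hI : Integrable (fun y : ℝ × ℝ => (rayWeight m ω y : ℂ) *
      Complex.exp (-(2 * Real.pi * k * (y.1 * b * y.2) : ℝ) * Complex.I) * q y.2) rayMeasure := by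
    have hg : AEStronglyMeasurable (fun y : ℝ × ℝ =>
        Complex.exp (-(2 * Real.pi * k * (y.1 * b * y.2) : ℝ) * Complex.I) * q y.2) rayMeasure :=
      Measurable.aestronglyMeasurable (by fun_prop)
    have h1 := (integrable_ofReal_rayWeight m hω).mul_bdd (c := C) hg (ae_of_all _ fun y => by
      rw [norm_mul, norm_exp_neg_ofReal_mul_I, one_mul]
      exact hC _)
    simpa only [← mul_assoc] using h1
  unfold rayMeasure at hI ⊢
  rw [integral_prod_symm _ hI]
  simp_rw [← indicator_mul_left]
  rw [integral_indicator measurableSet_Ioi]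
  refine setIntegral_congr_fun measurableSet_Ioi fun σ _ => ?_
  simp only [symbolKernel, oscAvg]
  rw [integral_mul_const, intervalIntegral.integral_of_le zero_le_one, ← integral_const_mul]
  congr 1
  refine integral_congr_ae (ae_of_all _ fun μ => ?_)
  simp only [rayWeight]
  push_cast
  rw [show (2 * (Real.pi:ℂ) * k * (μ * b * σ)) = 2 * Real.pi * k * b * σ * μ by ring]
  ring

/-- Average over velocities of the time increments of `P` along rays. -/
noncomputable def rayIncrement (m : ℕ) (ω b h : ℝ) (P : ℝ → ℝ → ℂ) (t x : ℝ) : ℂ :=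
  ∫ y, (rayWeight m ω y : ℂ) * (P (t + h - y.2) (x - y.1 * b * y.2) -
    P (t - y.2) (x - y.1 * b * y.2)) ∂rayMeasure

section
variable {P : ℝ → ℝ → ℂ} {C : ℝ}

theorem measurable_increment (hP : Measurable (Function.uncurry P)) (t h : ℝ) :
    Measurable (Function.uncurry fun (y : ℝ × ℝ) x => P (t + h - y.2) x - P (t - y.2) x) :=
  (hP.comp (f := fun z : (ℝ × ℝ) × ℝ => (t + h - z.1.2, z.2)) (by fun_prop)).sub
    (hP.comp (f := fun z : (ℝ × ℝ) × ℝ => (t - z.1.2, z.2)) (by fun_prop))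

theorem integrable_of_support {f : ℝ → ℂ} (hf : Measurable f) (hC : ∀ x, ‖f x‖ ≤ C)
    (hsupp : ∀ x ∉ Icc (0:ℝ) 1, f x = 0) : Integrable f := by
  rw [← integrableOn_iff_integrable_of_support_subset (s := Icc (0:ℝ) 1)
    (fun x hx => by by_contra h; exact hx (hsupp x h))]
  exact Measure.integrableOn_of_bounded (M := C) (by simp) hf.aestronglyMeasurable
    (ae_of_all _ fun x => hC x)

theorem norm_increment_le (hC : ∀ t x, ‖P t x‖ ≤ C) (s r x : ℝ) : ‖P s x - P r x‖ ≤ 2 * C :=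
  (norm_sub_le _ _).trans (by linarith [hC s x, hC r x])

theorem measurable_fourier_left (hP : Measurable (Function.uncurry P)) (k : ℝ) :
    Measurable fun r => 𝓕 (P r) k := by
  have := (measurable_fourier_right hP).comp (measurable_prodMk_right (y := k))
  simpa only [Function.comp_def] using this

theorem fourier_sub_apply {f g : ℝ → ℂ} (hf : Integrable f) (hg : Integrable g) (k : ℝ) :
    𝓕 (fun x => f x - g x) k = 𝓕 f k - 𝓕 g k := by
  simp only [Real.fourier_eq]
  rw [← integral_sub ((Real.fourierIntegral_convergent_iff k).2 hf)
    ((Real.fourierIntegral_convergent_iff k).2 hg)]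
  simp only [smul_sub]

theorem integral_shift_kernel {K p : ℝ → ℂ} (hK : Integrable K) (hp : Measurable p)
    (hC : ∀ r, ‖p r‖ ≤ C) (t h : ℝ) :
    ∫ σ, K σ * (p (t + h - σ) - p (t - σ)) = ∫ σ, (K (σ + h) - K σ) * p (t - σ) := by
  have hi : ∀ {J : ℝ → ℂ}, Integrable J → ∀ c, Integrable fun σ => J σ * p (c - σ) :=
    fun hJ c => hJ.mul_bdd (c := C)
      (hp.comp (measurable_const_sub c)).aestronglyMeasurable (ae_of_all _ fun σ => hC _)
  simp only [mul_sub, sub_mul]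
  rw [integral_sub (hi hK _) (hi hK _), integral_sub (hi (hK.comp_add_right h) _) (hi hK _),
    ← integral_add_right_eq_self (fun σ => K σ * p (t + h - σ)) h]
  simp only [add_sub_add_right_eq_sub]

theorem fourier_rayIncrement (m : ℕ) {ω : ℝ} (hω : 0 < ω) (b h : ℝ)
    (hP : Measurable (Function.uncurry P)) (hC : ∀ t x, ‖P t x‖ ≤ C)
    (hsupp : ∀ t, ∀ x ∉ Icc (0:ℝ) 1, P t x = 0) (t k : ℝ) :
    𝓕 (rayIncrement m ω b h P t) k =
      ∫ σ, ((Ioi 0).indicator (symbolKernel m ω (2 * Real.pi * k * b)) (σ + h) -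
        (Ioi 0).indicator (symbolKernel m ω (2 * Real.pi * k * b)) σ) * 𝓕 (P (t - σ)) k := by
  have hint : ∀ r, Integrable (P r) := fun r =>
    integrable_of_support (hP.comp measurable_prodMk_left) (hC r) (hsupp r)
  have hF : ∀ r s, 𝓕 (fun x => P r x - P s x) k = 𝓕 (P r) k - 𝓕 (P s) k := fun r s =>
    fourier_sub_apply (hint r) (hint s) k
  have hpm : Measurable fun r => 𝓕 (P r) k := measurable_fourier_left hP k
  have hpb : ∀ r, ‖𝓕 (P r) k‖ ≤ C := fun r => norm_fourier_le_of_support (hC r) (hsupp r) k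
  have hs : ∀ y : ℝ × ℝ, ∀ x ∉ Icc (0:ℝ) 1, P (t + h - y.2) x - P (t - y.2) x = 0 :=
    fun y x hx => by rw [hsupp _ x hx, hsupp _ x hx, sub_zero]
  have h1 : 𝓕 (rayIncrement m ω b h P t) k = _ :=
    fourier_average_shift (f := fun y x => P (t + h - y.2) x - P (t - y.2) x) (C := 2 * C)
      (integrable_ofReal_rayWeight m hω)
      (a := fun y : ℝ × ℝ => y.1 * b * y.2) (by fun_prop) (measurable_increment hP t h)
      (fun y x => norm_increment_le hC _ _ _) hs k
  simp only [hF] at h1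
  rw [h1]
  rw [integral_ray_symbol m hω k b (q := fun σ => 𝓕 (P (t + h - σ)) k - 𝓕 (P (t - σ)) k)
    ((hpm.comp (measurable_const_sub _)).sub (hpm.comp (measurable_const_sub _))) (C := 2 * C)
    (fun σ => (norm_sub_le _ _).trans (by linarith [hpb (t + h - σ), hpb (t - σ)]))]
  exact integral_shift_kernel (integrable_symbolKernel_indicator m hω _) hpm hpb t h

theorem measurable_rayIncrement (m : ℕ) (ω b h : ℝ) (hP : Measurable (Function.uncurry P)) :
    Measurable (Function.uncurry (rayIncrement m ω b h P)) := by
  refine (StronglyMeasurable.integral_prod_right' (ν := rayMeasure)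
    (f := fun z : (ℝ × ℝ) × (ℝ × ℝ) => (rayWeight m ω z.2 : ℂ) *
      (P (z.1.1 + h - z.2.2) (z.1.2 - z.2.1 * b * z.2.2) -
        P (z.1.1 - z.2.2) (z.1.2 - z.2.1 * b * z.2.2)))
    (Measurable.stronglyMeasurable ?_)).measurable
  have h1 : Measurable fun z : (ℝ × ℝ) × (ℝ × ℝ) =>
      P (z.1.1 + h - z.2.2) (z.1.2 - z.2.1 * b * z.2.2) :=
    hP.comp (f := fun z : (ℝ × ℝ) × (ℝ × ℝ) =>
      (z.1.1 + h - z.2.2, z.1.2 - z.2.1 * b * z.2.2)) (by fun_prop)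
  have h2 : Measurable fun z : (ℝ × ℝ) × (ℝ × ℝ) =>
      P (z.1.1 - z.2.2) (z.1.2 - z.2.1 * b * z.2.2) :=
    hP.comp (f := fun z : (ℝ × ℝ) × (ℝ × ℝ) =>
      (z.1.1 - z.2.2, z.1.2 - z.2.1 * b * z.2.2)) (by fun_prop)
  have h3 : Measurable fun z : (ℝ × ℝ) × (ℝ × ℝ) => (rayWeight m ω z.2 : ℂ) := by
    unfold rayWeight
    fun_prop
  exact h3.mul (h1.sub h2)

/-- Velocity averaging: time increments of the truncated velocity average are of first order in
`L²`, with a constant that is polynomial in the truncation exponent. -/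
theorem lintegral_rayIncrement_sq_le (m : ℕ) {ω : ℝ} (hω : 0 < ω) (b : ℝ) {h : ℝ} (hh : 0 < h)
    (hP : Measurable (Function.uncurry P)) (hC : ∀ t x, ‖P t x‖ ≤ C)
    (hsupp : ∀ t, ∀ x ∉ Icc (0:ℝ) 1, P t x = 0) :
    ∫⁻ t, ∫⁻ x, ‖rayIncrement m ω b h P t x‖ₑ ^ 2 ≤
      ENNReal.ofReal (h * (2 + (m + 2) ^ 2 * Real.pi)) ^ 2 * ∫⁻ t, ∫⁻ x, ‖P t x‖ₑ ^ 2 := by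
  have hmem : ∀ {f : ℝ → ℂ} {B : ℝ}, Integrable f → (∀ x, ‖f x‖ ≤ B) → MemLp f 2 :=
    fun {f B} hf hB => by
      rw [memLp_two_iff_integrable_sq_norm hf.aestronglyMeasurable]
      simp only [sq]
      exact hf.norm.bdd_mul (c := B) hf.norm.aestronglyMeasurable
        (ae_of_all _ fun x => by rw [norm_norm]; exact hB x)
  have hPi : ∀ r, Integrable (P r) := fun r =>
    integrable_of_support (hP.comp measurable_prodMk_left) (hC r) (hsupp r)
  have hAi : ∀ t, Integrable (rayIncrement m ω b h P t) := fun t =>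
    (integrable_comp_shear (integrable_ofReal_rayWeight m hω)
      (a := fun y : ℝ × ℝ => y.1 * b * y.2) (by fun_prop) (measurable_increment hP t h)
      (fun y x => norm_increment_le hC _ _ _)
      (fun y x hx => by simp [hsupp _ x hx])).integral_prod_left
  have hAb : ∀ t x, ‖rayIncrement m ω b h P t x‖ ≤
      ∫ y, ‖(rayWeight m ω y : ℂ)‖ * (2 * C) ∂rayMeasure := fun t x =>
    norm_integral_le_of_norm_le ((integrable_ofReal_rayWeight m hω).norm.mul_const _)
      (ae_of_all _ fun y => by
        rw [norm_mul]
        exact mul_le_mul_of_nonneg_left (norm_increment_le hC _ _ _) (norm_nonneg _))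
  have hAm := measurable_rayIncrement m ω b h hP
  have hFA : Measurable fun z : ℝ × ℝ => ‖𝓕 (rayIncrement m ω b h P z.1) z.2‖ₑ ^ 2 :=
    (measurable_fourier_right hAm).enorm.pow_const 2
  have hFP : Measurable fun z : ℝ × ℝ => ‖𝓕 (P z.1) z.2‖ₑ ^ 2 :=
    (measurable_fourier_right hP).enorm.pow_const 2
  calc ∫⁻ t, ∫⁻ x, ‖rayIncrement m ω b h P t x‖ₑ ^ 2
      = ∫⁻ t, ∫⁻ k, ‖𝓕 (rayIncrement m ω b h P t) k‖ₑ ^ 2 :=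
        lintegral_congr fun t => (lintegral_enorm_fourier_sq (hAi t) (hmem (hAi t) (hAb t))).symm
    _ = ∫⁻ k, ∫⁻ t, ‖𝓕 (rayIncrement m ω b h P t) k‖ₑ ^ 2 :=
        lintegral_lintegral_swap hFA.aemeasurable
    _ ≤ ∫⁻ k, ENNReal.ofReal (h * (2 + (m + 2) ^ 2 * Real.pi)) ^ 2 * ∫⁻ t, ‖𝓕 (P t) k‖ₑ ^ 2 := by
        refine lintegral_mono fun k => ?_
        simp only [fourier_rayIncrement m hω b h hP hC hsupp]
        have hK : Measurable ((Ioi 0).indicator (symbolKernel m ω (2 * Real.pi * k * b))) := by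
          refine Measurable.indicator ?_ measurableSet_Ioi
          have hc : Continuous (oscAvg m) :=
            continuous_iff_continuousAt.2 fun a => (hasDerivAt_oscAvg m a).continuousAt
          unfold symbolKernel
          fun_prop
        refine (lintegral_convolution_sq_le ((hK.comp (measurable_add_const h)).sub hK)
          (measurable_fourier_left hP k)).trans ?_
        refine mul_le_mul_left (pow_le_pow_left₀ zero_le ?_ 2) _
        exact lintegral_symbolKernel_shift_le m hω _ hh
    _ = ENNReal.ofReal (h * (2 + (m + 2) ^ 2 * Real.pi)) ^ 2 * ∫⁻ k, ∫⁻ t, ‖𝓕 (P t) k‖ₑ ^ 2 :=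
        lintegral_const_mul _ (Measurable.lintegral_prod_left' hFP)
    _ = ENNReal.ofReal (h * (2 + (m + 2) ^ 2 * Real.pi)) ^ 2 * ∫⁻ t, ∫⁻ x, ‖P t x‖ₑ ^ 2 := by
        rw [← lintegral_lintegral_swap hFP.aemeasurable]
        congr 1
        exact lintegral_congr fun t => lintegral_enorm_fourier_sq (hPi t) (hmem (hPi t) (hC t))

end

end

section

open MeasureTheory Set Filter Topology

/-- Restriction of `P` to the slab `x ∈ (0, 1)` and to times at most `T`. -/
noncomputable def cutoff (T : ℝ) (P : ℝ → ℝ → ℝ) (t x : ℝ) : ℝ :=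
  (Iic T ×ˢ Ioo (0:ℝ) 1).indicator (Function.uncurry P) (t, x)

section
variable {T : ℝ} {P : ℝ → ℝ → ℝ} {t x : ℝ}

theorem cutoff_of_mem (ht : t ≤ T) (hx : x ∈ Ioo (0:ℝ) 1) : cutoff T P t x = P t x :=
  indicator_of_mem (show (t, x) ∈ Iic T ×ˢ Ioo (0:ℝ) 1 from ⟨ht, hx⟩) _

theorem cutoff_of_notMem (hx : x ∉ Ioo (0:ℝ) 1) : cutoff T P t x = 0 :=
  indicator_of_notMem (fun h => hx h.2) _

theorem cutoff_of_lt (ht : T < t) : cutoff T P t x = 0 :=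
  indicator_of_notMem (fun h => ht.not_ge h.1) _

theorem cutoff_of_nonpos (hP0 : ∀ t ≤ 0, ∀ x, P t x = 0) (ht : t ≤ 0) : cutoff T P t x = 0 := by
  rw [cutoff, indicator_apply]
  split_ifs
  · exact hP0 t ht x
  · rfl

theorem measurable_cutoff (hP : SepCont P) : Measurable (Function.uncurry (cutoff T P)) :=
  hP.measurable.indicator (measurableSet_Iic.prod measurableSet_Ioo)

theorem exists_abs_cutoff_le (hP : SepCont P) (hP0 : ∀ t ≤ 0, ∀ x, P t x = 0) :
    ∃ C, ∀ t x, |cutoff T P t x| ≤ C := by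
  obtain ⟨B, hB⟩ := hP.bdd (max T 1)
  refine ⟨max B 0, fun t x => ?_⟩
  rcases le_or_gt t 0 with h0 | h0
  · rw [cutoff_of_nonpos hP0 h0]; simp
  rcases lt_or_ge T t with h1 | h1
  · rw [cutoff_of_lt h1]; simp
  by_cases hx : x ∈ Ioo (0:ℝ) 1
  · rw [cutoff_of_mem h1 hx]
    refine (hB t x ?_ ?_).trans (le_max_left _ _)
    · rw [abs_of_pos h0]; exact h1.trans (le_max_left _ _)
    · rw [abs_of_pos hx.1]; exact hx.2.le.trans (le_max_right _ _)
  · rw [cutoff_of_notMem hx]; simp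

theorem cutoff_mirror (T : ℝ) (P : ℝ → ℝ → ℝ) (t x : ℝ) :
    cutoff T (fun t x => P t (1 - x)) t x = cutoff T P t (1 - x) := by
  simp only [cutoff, indicator_apply, Function.uncurry]
  congr 1
  simp only [mem_prod, mem_Ioo, eq_iff_iff]
  constructor <;> rintro ⟨h1, h2, h3⟩ <;> exact ⟨h1, by linarith, by linarith⟩

theorem integral_ray_cutoff (ω : ℝ) {c : ℝ} (hc : 0 < c) (ht : t < T) (hx : x ∈ Icc (0:ℝ) 1) :
    ∫ σ in Ioi 0, Real.exp (-ω * σ) * cutoff T P (t - σ) (x - c * σ) =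
      ∫ σ in 0..(x / c), Real.exp (-ω * σ) * P (t - σ) (x - c * σ) := by
  rw [intervalIntegral.integral_of_le (div_nonneg hx.1 hc.le), integral_Ioc_eq_integral_Ioo,
    ← integral_indicator measurableSet_Ioi, ← integral_indicator measurableSet_Ioo]
  congr 1
  funext σ
  rw [indicator_apply, indicator_apply]
  have key : σ * c = c * σ := mul_comm _ _
  by_cases h0 : 0 < σ
  · rw [if_pos (mem_Ioi.2 h0)]
    by_cases h1 : σ < x / c
    · rw [if_pos (mem_Ioo.2 ⟨h0, h1⟩)]
      rw [lt_div_iff₀ hc] at h1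
      rw [cutoff_of_mem (by linarith) ⟨by linarith, by nlinarith [hx.2]⟩]
    · rw [if_neg (fun h => h1 h.2)]
      rw [lt_div_iff₀ hc] at h1
      rw [cutoff_of_notMem (fun h => by linarith [h.1]), mul_zero]
  · rw [if_neg (fun h => h0 (mem_Ioi.1 h)), if_neg (fun h => h0 h.1)]

theorem integral_ray_cutoff_mirror (ω : ℝ) {c : ℝ} (hc : 0 < c) (ht : t < T)
    (hx : x ∈ Icc (0:ℝ) 1) :
    ∫ σ in Ioi 0, Real.exp (-ω * σ) * cutoff T P (t - σ) (x + c * σ) =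
      ∫ σ in 0..((1 - x) / c), Real.exp (-ω * σ) * P (t - σ) (x + c * σ) := by
  have := integral_ray_cutoff (P := fun t x => P t (1 - x)) (x := 1 - x) ω hc ht
    ⟨by linarith [hx.2], by linarith [hx.1]⟩
  have e : ∀ σ, 1 - (1 - x - c * σ) = x + c * σ := fun σ => by ring
  simpa only [cutoff_mirror, e] using this

theorem integral_ray_cutoff_reflect (ω : ℝ) {c : ℝ} (hc : 0 < c) (ht : t < T)
    (hx : x ∈ Icc (0:ℝ) 1) :
    ∫ σ in Ioi 0, Real.exp (-ω * σ) * cutoff T P (t - σ) (2 - x - c * σ) =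
      Real.exp (-ω * ((1 - x) / c)) *
        ∫ σ in 0..(1 / c), Real.exp (-ω * σ) * P (t - (1 - x) / c - σ) (1 - c * σ) := by
  set s := (1 - x) / c with hs
  have hs0 : 0 ≤ s := div_nonneg (by linarith [hx.2]) hc.le
  have hcs : c * s = 1 - x := by rw [hs]; field_simp
  rw [← integral_ray_cutoff (T := T) ω hc (by linarith) (by simp : (1:ℝ) ∈ Icc (0:ℝ) 1),
    ← integral_const_mul, ← integral_indicator measurableSet_Ioi,
    ← integral_indicator measurableSet_Ioi, ← integral_add_right_eq_self _ s]
  congr 1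
  funext σ
  rw [indicator_apply, indicator_apply]
  by_cases h0 : 0 < σ
  · rw [if_pos (mem_Ioi.2 (by linarith)), if_pos (mem_Ioi.2 h0), ← mul_assoc, ← Real.exp_add]
    congr 2
    · ring_nf
    · ring
    · linear_combination -hcs
  · rw [if_neg (fun h => h0 (mem_Ioi.1 h))]
    split_ifs
    · rw [cutoff_of_notMem (fun h => by nlinarith [h.2]), mul_zero]
    · rfl

theorem integrableOn_ray_cutoff {ω : ℝ} (hω : 0 < ω) (hP : SepCont P)
    (hP0 : ∀ t ≤ 0, ∀ x, P t x = 0) (t x c : ℝ) :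
    IntegrableOn (fun σ => Real.exp (-ω * σ) * cutoff T P (t - σ) (x + c * σ)) (Ioi 0) := by
  obtain ⟨C, hC⟩ := exists_abs_cutoff_le (T := T) hP hP0
  refine (exp_neg_integrableOn_Ioi 0 hω).mul_bdd (c := C) (g := fun σ =>
    cutoff T P (t - σ) (x + c * σ)) ?_ (ae_of_all _ fun σ => hC _ _)
  exact ((measurable_cutoff hP).comp (f := fun σ : ℝ => (t - σ, x + c * σ))
    (by fun_prop)).aestronglyMeasurable

theorem lintegral_cutoff_sq_lt_top (hP : SepCont P) (hP0 : ∀ t ≤ 0, ∀ x, P t x = 0) :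
    ∫⁻ t, ∫⁻ x, ‖(cutoff T P t x : ℂ)‖ₑ ^ 2 < ⊤ := by
  obtain ⟨C, hC⟩ := exists_abs_cutoff_le (T := T) hP hP0
  have hC0 : 0 ≤ C := (abs_nonneg _).trans (hC 0 0)
  have h1 : ∀ t x, ‖(cutoff T P t x : ℂ)‖ₑ ^ 2 ≤
      (Icc 0 T).indicator (fun _ => 1) t * (Icc (0:ℝ) 1).indicator (fun _ => ENNReal.ofReal C ^ 2) x :=
    fun t x => by
      by_cases ht : t ∈ Icc 0 T
      · by_cases hx : x ∈ Icc (0:ℝ) 1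
        · rw [indicator_of_mem ht, indicator_of_mem hx, one_mul, ← ofReal_norm, Complex.norm_real]
          gcongr
          exact hC t x
        · rw [cutoff_of_notMem fun h => hx (Ioo_subset_Icc_self h)]; simp
      · have : cutoff T P t x = 0 := by
          rcases le_or_gt t 0 with h0 | h0
          · exact cutoff_of_nonpos hP0 h0
          · exact cutoff_of_lt (lt_of_not_ge fun h => ht ⟨h0.le, h⟩)
        rw [this]; simp
  refine (lintegral_mono fun t => lintegral_mono fun x => h1 t x).trans_lt ?_
  simp_rw [lintegral_const_mul _ ((measurable_const (a := ENNReal.ofReal C ^ 2)).indicator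
    (measurableSet_Icc (a := (0:ℝ)) (b := 1)))]
  rw [lintegral_mul_const _ (measurable_const.indicator measurableSet_Icc),
    lintegral_indicator measurableSet_Icc, lintegral_indicator measurableSet_Icc]
  simp [ENNReal.mul_lt_top]
end

end

section

open MeasureTheory Set Filter Topology

section
variable {T : ℝ}

theorem gstar_pos {ω : ℝ} (hω : 0 < ω) : 0 < gstar ω := by
  have h := Real.add_one_lt_exp hω.ne'
  unfold gstar
  have : 0 < Real.exp ω - 1 := by linarith
  positivity

theorem gstar_le {ω : ℝ} (hω : 0 < ω) : gstar ω ≤ 8 * (1 + ω ^ 2) * Real.exp (-ω) := by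
  have h := Real.add_one_lt_exp hω.ne'
  have hp : 0 < Real.exp ω - 1 := by linarith
  have he : Real.exp (-ω) * Real.exp ω = 1 := by rw [← Real.exp_add]; simp
  have hpos := Real.exp_pos ω
  unfold gstar
  rw [Real.exp_neg, ← div_eq_mul_inv, div_le_div_iff₀ (by positivity) hpos]
  rcases le_or_gt ω 1 with h1 | h1
  · have hE : Real.exp ω ^ 2 ≤ 8 := by
      have := Real.exp_le_exp.2 h1
      have h2 := Real.exp_one_lt_d9
      nlinarith
    have h3 : ω ^ 2 ≤ (Real.exp ω - 1) ^ 2 := by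
      apply pow_le_pow_left₀ hω.le; linarith
    nlinarith [sq_nonneg (ω * (Real.exp ω - 1)), sq_nonneg ω, mul_le_mul_of_nonneg_left hE (sq_nonneg ω)]
  · have h2 : Real.exp ω ≤ 2 * (Real.exp ω - 1) := by linarith
    have h3 : Real.exp ω ^ 2 ≤ (2 * (Real.exp ω - 1)) ^ 2 := pow_le_pow_left₀ hpos.le h2 2
    nlinarith [mul_le_mul_of_nonneg_left h3 (sq_nonneg ω), sq_nonneg (ω * (Real.exp ω - 1)),
      sq_nonneg (Real.exp ω - 1)]

theorem measurable_gstar : Measurable gstar := by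
  unfold gstar
  fun_prop

theorem integrableOn_pow_mul_exp_neg (k : ℕ) :
    IntegrableOn (fun ω : ℝ => ω ^ k * Real.exp (-ω)) (Ioi 0) := by
  refine (Real.GammaIntegral_convergent (s := k + 1) (by positivity)).congr_fun (fun ω _ => ?_)
    measurableSet_Ioi
  simp [mul_comm]

theorem integrableOn_pow_mul_gstar (k : ℕ) :
    IntegrableOn (fun ω : ℝ => ω ^ k * gstar ω) (Ioi 0) := by
  refine (((integrableOn_pow_mul_exp_neg k).add (integrableOn_pow_mul_exp_neg (k + 2))).const_mul
    8).mono' (((measurable_id.pow_const k).mul measurable_gstar).aestronglyMeasurable) ?_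
  refine (ae_restrict_iff' measurableSet_Ioi).2 (ae_of_all _ fun ω hω => ?_)
  have hω : 0 < ω := hω
  rw [Real.norm_eq_abs, abs_of_nonneg (mul_nonneg (by positivity) (gstar_pos hω).le)]
  refine (mul_le_mul_of_nonneg_left (gstar_le hω) (by positivity)).trans_eq ?_
  simp only [Pi.add_apply]
  ring

theorem wgstar_pos : 0 < wgstar := by
  unfold wgstar
  have h1 : IntegrableOn (fun ω : ℝ => ω * gstar ω) (Ioi 0) := by
    simpa using integrableOn_pow_mul_gstar 1
  refine mul_pos two_pos ?_
  rw [setIntegral_pos_iff_support_of_nonneg_ae ?_ h1]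
  · refine lt_of_lt_of_le (b := volume (Ioi (0:ℝ))) (by simp) (measure_mono fun ω hω => ⟨?_, hω⟩)
    exact (mul_pos hω (gstar_pos hω)).ne'
  · exact (ae_restrict_iff' measurableSet_Ioi).2 (ae_of_all _ fun ω hω =>
      (mul_pos hω (gstar_pos hω)).le)

theorem Mw_pos {ω : ℝ} (hω : 0 < ω) : 0 < Mw ω :=
  div_pos (mul_pos hω (gstar_pos hω)) wgstar_pos

theorem measurable_Mw : Measurable Mw := by
  have := measurable_gstar
  unfold Mw
  fun_prop

theorem integrableOn_pow_mul_Mw (k : ℕ) : IntegrableOn (fun ω : ℝ => ω ^ k * Mw ω) (Ioi 0) := by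
  have h : IntegrableOn (fun ω : ℝ => ω ^ (k + 1) * gstar ω / wgstar) (Ioi 0) :=
    (integrableOn_pow_mul_gstar (k + 1)).div_const wgstar
  refine h.congr_fun (fun ω _ => ?_) measurableSet_Ioi
  simp only [Mw]
  ring

theorem two_mul_integral_Mw : 2 * ∫ ω in Ioi (0:ℝ), Mw ω = 1 := by
  unfold Mw
  rw [integral_div, ← mul_div_assoc]
  exact div_self wgstar_pos.ne'

theorem integrableOn_Mw : IntegrableOn Mw (Ioi 0) := by simpa using integrableOn_pow_mul_Mw 0

theorem integrableOn_Mw_mul_exp (hT : 0 ≤ T) :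
    IntegrableOn (fun ω => Mw ω * Real.exp (-ω * T)) (Ioi 0) := by
  refine integrableOn_Mw.mono' (measurable_Mw.mul (by fun_prop)).aestronglyMeasurable
    ((ae_restrict_iff' measurableSet_Ioi).2 (ae_of_all _ fun ω hω => ?_))
  have hω : 0 < ω := hω
  rw [norm_mul, Real.norm_eq_abs, Real.norm_eq_abs, Real.abs_exp, abs_of_pos (Mw_pos hω)]
  exact mul_le_of_le_one_right (Mw_pos hω).le (Real.exp_le_one_iff.2 (by nlinarith))

theorem integrableOn_Mw_mul_one_sub_exp (hT : 0 ≤ T) :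
    IntegrableOn (fun ω => Mw ω * (1 - Real.exp (-ω * T))) (Ioi 0) := by
  simp only [mul_sub, mul_one]
  exact integrableOn_Mw.sub (integrableOn_Mw_mul_exp hT)

/-- The fraction of phonons scattered before time `T` is less than one. -/
theorem two_mul_integral_Mw_mul_lt_one (hT : 0 ≤ T) :
    2 * ∫ ω in Ioi (0:ℝ), Mw ω * (1 - Real.exp (-ω * T)) < 1 := by
  have h1 := integrableOn_Mw_mul_exp hT
  have h2 : 0 < ∫ ω in Ioi (0:ℝ), Mw ω * Real.exp (-ω * T) := by
    rw [setIntegral_pos_iff_support_of_nonneg_ae ?_ h1]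
    · refine lt_of_lt_of_le (b := volume (Ioi (0:ℝ))) (by simp) (measure_mono fun ω hω => ⟨?_, hω⟩)
      exact (mul_pos (Mw_pos hω) (Real.exp_pos _)).ne'
    · exact (ae_restrict_iff' measurableSet_Ioi).2 (ae_of_all _ fun ω hω =>
        (mul_pos (Mw_pos hω) (Real.exp_pos _)).le)
  have h3 := two_mul_integral_Mw
  simp only [mul_sub, mul_one]
  rw [integral_sub integrableOn_Mw h1]
  linarith

end

end

section

open MeasureTheory Set Filter Topology

/-- Extension of a solution from `[0, T] × [0, 1]` by freezing it at the boundary. -/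
noncomputable def clampSol (T : ℝ) (u : ℝ → ℝ → ℝ → ℝ → ℝ) (t x μ ω : ℝ) : ℝ :=
  u (max 0 (min t T)) (max 0 (min x 1)) μ ω

/-- The potential driving all the phonons: its time derivative is `⟨ω u⟩`. -/
noncomputable def potential (T : ℝ) (u : ℝ → ℝ → ℝ → ℝ → ℝ) (t x : ℝ) : ℝ :=
  (Mw 1)⁻¹ * (clampSol T u t x 0 1 + ∫ s in (0:ℝ)..t, clampSol T u s x 0 1)

/-- Bounded solutions of the phonon transport equation with zero initial data. -/
structure RegularSol (T : ℝ) (u : ℝ → ℝ → ℝ → ℝ → ℝ) : Prop where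
  pos : 0 < T
  pte : SatisfiesPTE T u
  bdd : BoundedFn u
  int : BracketIntegrableSol T u
  init : ∀ x ∈ Icc (0:ℝ) 1, ∀ μ ∈ Icc (-1:ℝ) 1, ∀ ω ∈ Ioi (0:ℝ), u 0 x μ ω = 0

section
variable {T : ℝ} {u : ℝ → ℝ → ℝ → ℝ → ℝ} {t x μ ω : ℝ}

theorem clamp_mem {a s : ℝ} (ha : 0 ≤ a) : max 0 (min s a) ∈ Icc 0 a :=
  ⟨le_max_left _ _, max_le ha (min_le_right _ _)⟩

theorem clamp_of_mem {a s : ℝ} (hs : s ∈ Icc 0 a) : max 0 (min s a) = s := by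
  rw [min_eq_left hs.2, max_eq_right hs.1]

theorem clampSol_of_mem (ht : t ∈ Icc 0 T) (hx : x ∈ Icc (0:ℝ) 1) :
    clampSol T u t x μ ω = u t x μ ω := by
  rw [clampSol, clamp_of_mem ht, clamp_of_mem hx]

theorem zero_mem_velocity : (0:ℝ) ∈ Icc (-1:ℝ) 1 := by constructor <;> norm_num

namespace RegularSol

theorem sepCont_clampSol (h : RegularSol T u) (hμ : μ ∈ Icc (-1:ℝ) 1) (hω : ω ∈ Ioi (0:ℝ)) :
    SepCont fun t x => clampSol T u t x μ ω := by
  refine ⟨fun x => ?_, fun t => ?_, fun R => ?_⟩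
  · have : ContinuousOn (fun s => u s (max 0 (min x 1)) μ ω) (Icc 0 T) := fun s hs =>
      (h.pte s hs _ (clamp_mem zero_le_one) μ hμ ω hω).1.continuousAt.continuousWithinAt
    exact this.comp_continuous (f := fun s => max 0 (min s T)) (by fun_prop)
      fun s => clamp_mem h.pos.le
  · have : ContinuousOn (fun y => u (max 0 (min t T)) y μ ω) (Icc 0 1) := fun y hy =>
      (h.pte _ (clamp_mem h.pos.le) y hy μ hμ ω hω).2.1.continuousAt.continuousWithinAt
    exact this.comp_continuous (f := fun s => max 0 (min s 1)) (by fun_prop)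
      fun s => clamp_mem zero_le_one
  · obtain ⟨B, hB⟩ := h.bdd
    exact ⟨B, fun t x _ _ => hB _ _ _ _⟩

theorem clampSol_of_nonpos (h : RegularSol T u) (hμ : μ ∈ Icc (-1:ℝ) 1) (hω : ω ∈ Ioi (0:ℝ))
    (ht : t ≤ 0) (x : ℝ) : clampSol T u t x μ ω = 0 := by
  rw [clampSol, min_eq_left (ht.trans h.pos.le), max_eq_left ht]
  exact h.init _ (clamp_mem zero_le_one) μ hμ ω hω

theorem sepCont_potential (h : RegularSol T u) : SepCont (potential T u) :=
  ((h.sepCont_clampSol zero_mem_velocity (mem_Ioi.2 one_pos)).add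
    (h.sepCont_clampSol zero_mem_velocity (mem_Ioi.2 one_pos)).primitive).const_mul _

theorem potential_of_nonpos (h : RegularSol T u) (t : ℝ) (ht : t ≤ 0) (x : ℝ) :
    potential T u t x = 0 := by
  rw [potential, h.clampSol_of_nonpos zero_mem_velocity (mem_Ioi.2 one_pos) ht,
    intervalIntegral.integral_zero_ae (ae_of_all _ fun s hs => ?_)]
  · simp
  · rw [uIoc_of_ge ht] at hs
    exact h.clampSol_of_nonpos zero_mem_velocity (mem_Ioi.2 one_pos) hs.2 x

theorem clampSol_eventuallyEq_left (ht : t ∈ Ioo 0 T) (hx : x ∈ Icc (0:ℝ) 1) :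
    (fun s => clampSol T u s x μ ω) =ᶠ[𝓝 t] fun s => u s x μ ω := by
  filter_upwards [Ioo_mem_nhds ht.1 ht.2] with s hs
  exact clampSol_of_mem (Ioo_subset_Icc_self hs) hx

theorem clampSol_eventuallyEq_right (ht : t ∈ Icc 0 T) (hx : x ∈ Ioo (0:ℝ) 1) :
    (fun y => clampSol T u t y μ ω) =ᶠ[𝓝 x] fun y => u t y μ ω := by
  filter_upwards [Ioo_mem_nhds hx.1 hx.2] with y hy
  exact clampSol_of_mem ht (Ioo_subset_Icc_self hy)

/-- The balance of energy along the phonons of zero group velocity. -/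
theorem hasDerivAt_slice (h : RegularSol T u) (hω : ω ∈ Ioi (0:ℝ)) (ht : t ∈ Ioo 0 T)
    (hx : x ∈ Icc (0:ℝ) 1) :
    HasDerivAt (fun t => clampSol T u t x 0 ω + ω * ∫ s in (0:ℝ)..t, clampSol T u s x 0 ω)
      (Mw ω * bracket fun μ' ω' => ω' * u t x μ' ω') t := by
  have ht' := Ioo_subset_Icc_self ht
  obtain ⟨h1, -, h3⟩ := h.pte t ht' x hx 0 zero_mem_velocity ω hω
  have h4 := (h1.hasDerivAt.congr_of_eventuallyEq (clampSol_eventuallyEq_left ht hx)).add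
    (((h.sepCont_clampSol zero_mem_velocity hω).hasDerivAt_primitive t x).const_mul ω)
  refine h4.congr_deriv ?_
  rw [clampSol_of_mem ht' hx]
  simp only [coll, zero_mul, add_zero] at h3
  linarith

theorem hasDerivAt_potential (h : RegularSol T u) (ht : t ∈ Ioo 0 T) (hx : x ∈ Icc (0:ℝ) 1) :
    HasDerivAt (fun t => potential T u t x) (bracket fun μ' ω' => ω' * u t x μ' ω') t := by
  have := (h.hasDerivAt_slice (mem_Ioi.2 one_pos) ht hx).const_mul (Mw 1)⁻¹
  simp only [one_mul] at this
  rwa [inv_mul_cancel_left₀ (Mw_pos one_pos).ne'] at this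

theorem slice_eq (h : RegularSol T u) (hω : ω ∈ Ioi (0:ℝ)) (ht : t ∈ Icc 0 T)
    (hx : x ∈ Icc (0:ℝ) 1) :
    clampSol T u t x 0 ω + ω * ∫ s in (0:ℝ)..t, clampSol T u s x 0 ω = Mw ω * potential T u t x := by
  have hS := (h.sepCont_clampSol zero_mem_velocity hω).add
    ((h.sepCont_clampSol zero_mem_velocity hω).primitive.const_mul ω)
  set D : ℝ → ℝ := fun t => (clampSol T u t x 0 ω + ω * ∫ s in (0:ℝ)..t, clampSol T u s x 0 ω) -
    Mw ω * potential T u t x with hD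
  have hc : Continuous D := (hS.left x).sub ((h.sepCont_potential.left x).const_mul _)
  have h0 : D 0 = 0 := by
    simp only [hD]
    rw [h.potential_of_nonpos 0 le_rfl, h.clampSol_of_nonpos zero_mem_velocity hω le_rfl]
    simp
  have hd : ∀ s ∈ Ioo 0 t, HasDerivAt D 0 s := fun s hs => by
    have hs' : s ∈ Ioo 0 T := ⟨hs.1, hs.2.trans_le ht.2⟩
    exact ((h.hasDerivAt_slice hω hs' hx).sub
      ((h.hasDerivAt_potential hs' hx).const_mul _)).congr_deriv (sub_self _)
  have h1 := intervalIntegral.integral_eq_sub_of_hasDerivAt_of_le ht.1 hc.continuousOn hd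
    intervalIntegrable_const
  rw [h0] at h1
  simp at h1
  simp only [hD] at h1
  linarith

/-- Duhamel's formula for right-moving phonons. -/
theorem duhamel_right (h : RegularSol T u) (hμ : μ ∈ Ioc (0:ℝ) 1) (hω : ω ∈ Ioi (0:ℝ)) (ht : t < T)
    (hx : x ∈ Icc (0:ℝ) 1) :
    ∫ s in (0:ℝ)..t, clampSol T u s x μ ω =
      Real.exp (-ω * (x / (μ * ω))) * (∫ s in (0:ℝ)..(t - x / (μ * ω)), clampSol T u s 0 μ ω) +
      Mw ω * ∫ σ in (0:ℝ)..x / (μ * ω),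
        Real.exp (-ω * σ) * potential T u (t - σ) (x - μ * ω * σ) := by
  have hμ' : μ ∈ Icc (-1:ℝ) 1 := ⟨by linarith [hμ.1], hμ.2⟩
  refine duhamel (h.sepCont_clampSol hμ' hω) (h.sepCont_clampSol zero_mem_velocity hω)
    h.sepCont_potential h.pos.le (mul_pos hμ.1 hω) (fun t ht x => h.clampSol_of_nonpos hμ' hω ht x)
    (fun x => h.clampSol_of_nonpos zero_mem_velocity hω le_rfl x) h.potential_of_nonpos
    (fun t ht x hx => h.slice_eq hω ht hx) (fun t ht x hx => ?_) ht hx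
  have ht' := Ioo_subset_Icc_self ht
  have hx' := Ioo_subset_Icc_self hx
  obtain ⟨a1, a2, a3⟩ := h.pte t ht' x hx' μ hμ' ω hω
  obtain ⟨b1, b2, b3⟩ := h.pte t ht' x hx' 0 zero_mem_velocity ω hω
  have el : ∀ {μ}, (fun s => clampSol T u s x μ ω) =ᶠ[𝓝 t] fun s => u s x μ ω :=
    clampSol_eventuallyEq_left ht hx'
  have er : ∀ {μ}, (fun y => clampSol T u t y μ ω) =ᶠ[𝓝 x] fun y => u t y μ ω :=
    clampSol_eventuallyEq_right ht' hx
  refine ⟨a1.congr_of_eventuallyEq el, a2.congr_of_eventuallyEq er,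
    b1.congr_of_eventuallyEq el, b2.congr_of_eventuallyEq er, ?_⟩
  rw [el.deriv_eq, er.deriv_eq, el.deriv_eq, clampSol_of_mem ht' hx', clampSol_of_mem ht' hx', a3]
  simp only [coll] at b3 ⊢
  linarith

/-- Duhamel's formula for left-moving phonons. -/
theorem duhamel_left (h : RegularSol T u) (hμ : μ ∈ Ioc (0:ℝ) 1) (hω : ω ∈ Ioi (0:ℝ)) (ht : t < T)
    (hx : x ∈ Icc (0:ℝ) 1) :
    ∫ s in (0:ℝ)..t, clampSol T u s x (-μ) ω =
      Real.exp (-ω * ((1 - x) / (μ * ω))) *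
        (∫ s in (0:ℝ)..(t - (1 - x) / (μ * ω)), clampSol T u s 1 (-μ) ω) +
      Mw ω * ∫ σ in (0:ℝ)..(1 - x) / (μ * ω),
        Real.exp (-ω * σ) * potential T u (t - σ) (x + μ * ω * σ) := by
  have hμ' : -μ ∈ Icc (-1:ℝ) 1 := ⟨by linarith [hμ.2], by linarith [hμ.1]⟩
  have mir : ∀ {f : ℝ → ℝ → ℝ}, SepCont f → SepCont fun t x => f t (1 - x) := fun {f} hf =>
    ⟨fun x => hf.left _, fun t => (hf.right t).comp (by fun_prop), fun R => by
      obtain ⟨B, hB⟩ := hf.bdd (R + 1)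
      refine ⟨B, fun t x ht hx => hB _ _ (by linarith) ?_⟩
      rw [abs_le] at hx ⊢
      constructor <;> linarith⟩
  have hx2 : ∀ {x}, x ∈ Icc (0:ℝ) 1 → 1 - x ∈ Icc (0:ℝ) 1 := fun hx =>
    ⟨by linarith [hx.2], by linarith [hx.1]⟩
  have key := duhamel (mir (h.sepCont_clampSol hμ' hω)) (mir (h.sepCont_clampSol zero_mem_velocity hω))
    (mir h.sepCont_potential) (T := T) (c := μ * ω) (ω := ω) (M := Mw ω) (t := t) (x := 1 - x)
    h.pos.le (mul_pos hμ.1 hω)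
    (fun t ht x => h.clampSol_of_nonpos hμ' hω ht _)
    (fun x => h.clampSol_of_nonpos zero_mem_velocity hω le_rfl _)
    (fun t ht x => h.potential_of_nonpos t ht _)
    (fun t ht x hx => h.slice_eq hω ht (hx2 hx)) (fun t ht x hx => ?_) ht (hx2 hx)
  · have e : ∀ σ, 1 - (1 - x - μ * ω * σ) = x + μ * ω * σ := fun σ => by ring
    simpa only [e, sub_sub_cancel, sub_zero] using key
  have ht' := Ioo_subset_Icc_self ht
  have hxm : 1 - x ∈ Ioo (0:ℝ) 1 := ⟨by linarith [hx.2], by linarith [hx.1]⟩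
  have hx' := Ioo_subset_Icc_self hxm
  obtain ⟨a1, a2, a3⟩ := h.pte t ht' _ hx' (-μ) hμ' ω hω
  obtain ⟨b1, b2, b3⟩ := h.pte t ht' _ hx' 0 zero_mem_velocity ω hω
  have el : ∀ {μ}, (fun s => clampSol T u s (1 - x) μ ω) =ᶠ[𝓝 t] fun s => u s (1 - x) μ ω :=
    clampSol_eventuallyEq_left ht hx'
  have er : ∀ {μ}, (fun y => clampSol T u t y μ ω) =ᶠ[𝓝 (1 - x)] fun y => u t y μ ω :=
    clampSol_eventuallyEq_right ht' hxm
  have d : ∀ {μ d}, HasDerivAt (fun y => u t y μ ω) d (1 - x) →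
      HasDerivAt (fun y => clampSol T u t (1 - y) μ ω) (-d) x := fun hd =>
    HasDerivAt.comp_const_sub 1 x (hd.congr_of_eventuallyEq er)
  refine ⟨a1.congr_of_eventuallyEq el, (d a2.hasDerivAt).differentiableAt,
    b1.congr_of_eventuallyEq el, (d b2.hasDerivAt).differentiableAt, ?_⟩
  rw [el.deriv_eq, (d a2.hasDerivAt).deriv, el.deriv_eq, clampSol_of_mem ht' hx',
    clampSol_of_mem ht' hx']
  simp only [coll] at a3 b3 ⊢
  linarith

end RegularSol
end

end

section

open MeasureTheory Set Filter Topology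

/-- Sign conditions at the boundary: nonnegative inflow and super-reflection. -/
structure SignedBoundary (T : ℝ) (η : ℝ → ℝ) (u : ℝ → ℝ → ℝ → ℝ → ℝ) : Prop where
  coeff : ∀ ω ∈ Ioi (0:ℝ), η ω ∈ Icc (0:ℝ) 1
  inflow : ∀ t ∈ Icc (0:ℝ) T, ∀ μ ∈ Ioc (0:ℝ) 1, ∀ ω ∈ Ioi (0:ℝ), 0 ≤ u t 0 μ ω
  refl : ∀ t ∈ Icc (0:ℝ) T, ∀ μ ∈ Ioc (0:ℝ) 1, ∀ ω ∈ Ioi (0:ℝ), η ω * u t 1 μ ω ≤ u t 1 (-μ) ω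

/-- Increment of the time-integrated solution. -/
noncomputable def solIncrement (T : ℝ) (u : ℝ → ℝ → ℝ → ℝ → ℝ) (t₁ t₂ x μ ω : ℝ) : ℝ :=
  (∫ s in (0:ℝ)..t₂, clampSol T u s x μ ω) - ∫ s in (0:ℝ)..t₁, clampSol T u s x μ ω

/-- Increment of the truncated potential. -/
noncomputable def potIncrement (T : ℝ) (u : ℝ → ℝ → ℝ → ℝ → ℝ) (t₁ t₂ x : ℝ) : ℝ :=
  cutoff T (potential T u) t₂ x - cutoff T (potential T u) t₁ x

section
variable {T : ℝ} {u : ℝ → ℝ → ℝ → ℝ → ℝ} {η : ℝ → ℝ} {t t₁ t₂ x μ ω : ℝ}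

theorem sub_primitive_nonneg {f : ℝ → ℝ} (hf : Continuous f) (h0 : ∀ s, 0 ≤ f s) (h12 : t₁ ≤ t₂) :
    0 ≤ (∫ s in (0:ℝ)..t₂, f s) - ∫ s in (0:ℝ)..t₁, f s := by
  rw [intervalIntegral.integral_interval_sub_left (hf.intervalIntegrable _ _)
    (hf.intervalIntegrable _ _)]
  exact intervalIntegral.integral_nonneg h12 fun s _ => h0 s

theorem mem_velocity (hμ : μ ∈ Ioc (0:ℝ) 1) : μ ∈ Icc (-1:ℝ) 1 := ⟨by linarith [hμ.1], hμ.2⟩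

theorem neg_mem_velocity (hμ : μ ∈ Ioc (0:ℝ) 1) : -μ ∈ Icc (-1:ℝ) 1 :=
  ⟨by linarith [hμ.2], by linarith [hμ.1]⟩

namespace RegularSol

theorem solIncrement_zero_nonneg (h : RegularSol T u) (hb : SignedBoundary T η u)
    (hμ : μ ∈ Ioc (0:ℝ) 1) (hω : ω ∈ Ioi (0:ℝ)) (h12 : t₁ ≤ t₂) :
    0 ≤ solIncrement T u t₁ t₂ 0 μ ω :=
  sub_primitive_nonneg ((h.sepCont_clampSol (mem_velocity hμ) hω).left 0) (fun s => by
    rw [clampSol, clamp_of_mem (show (0:ℝ) ∈ Icc (0:ℝ) 1 by simp)]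
    exact hb.inflow _ (clamp_mem h.pos.le) μ hμ ω hω) h12

theorem solIncrement_one_le (h : RegularSol T u) (hb : SignedBoundary T η u)
    (hμ : μ ∈ Ioc (0:ℝ) 1) (hω : ω ∈ Ioi (0:ℝ)) (h12 : t₁ ≤ t₂) :
    η ω * solIncrement T u t₁ t₂ 1 μ ω ≤ solIncrement T u t₁ t₂ 1 (-μ) ω := by
  have c1 := (h.sepCont_clampSol (mem_velocity hμ) hω).left 1
  have c2 := (h.sepCont_clampSol (neg_mem_velocity hμ) hω).left 1
  have := sub_primitive_nonneg (f := fun s => clampSol T u s 1 (-μ) ω - η ω * clampSol T u s 1 μ ω)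
    (c2.sub (c1.const_mul _)) (fun s => by
      rw [clampSol, clampSol, clamp_of_mem (show (1:ℝ) ∈ Icc (0:ℝ) 1 by simp)]
      exact sub_nonneg.2 (hb.refl _ (clamp_mem h.pos.le) μ hμ ω hω)) h12
  have e : ∀ a b : ℝ, ∫ s in a..b, (clampSol T u s 1 (-μ) ω - η ω * clampSol T u s 1 μ ω) =
      (∫ s in a..b, clampSol T u s 1 (-μ) ω) - η ω * ∫ s in a..b, clampSol T u s 1 μ ω :=
    fun a b => by
      rw [intervalIntegral.integral_sub (c2.intervalIntegrable _ _)
        ((c1.const_mul _).intervalIntegrable _ _), intervalIntegral.integral_const_mul]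
  rw [e, e] at this
  unfold solIncrement
  linarith

theorem integrableOn_ray (h : RegularSol T u) (hω : 0 < ω) (t x c : ℝ) :
    IntegrableOn (fun σ => Real.exp (-ω * σ) * cutoff T (potential T u) (t - σ) (x + c * σ))
      (Ioi 0) :=
  integrableOn_ray_cutoff hω h.sepCont_potential h.potential_of_nonpos t x c

theorem integrableOn_ray_increment (h : RegularSol T u) (hω : 0 < ω) (t₁ t₂ x c : ℝ) :
    IntegrableOn (fun σ => Real.exp (-ω * σ) * potIncrement T u (t₁ - σ) (t₂ - σ) (x + c * σ))
      (Ioi 0) := by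
  unfold potIncrement
  simp only [mul_sub]
  exact (h.integrableOn_ray hω t₂ x c).sub (h.integrableOn_ray hω t₁ x c)

theorem integral_ray_increment (h : RegularSol T u) (hω : 0 < ω) (t₁ t₂ x c : ℝ) :
    ∫ σ in Ioi 0, Real.exp (-ω * σ) * potIncrement T u (t₁ - σ) (t₂ - σ) (x + c * σ) =
      (∫ σ in Ioi 0, Real.exp (-ω * σ) * cutoff T (potential T u) (t₂ - σ) (x + c * σ)) -
      ∫ σ in Ioi 0, Real.exp (-ω * σ) * cutoff T (potential T u) (t₁ - σ) (x + c * σ) := by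
  unfold potIncrement
  simp only [mul_sub]
  exact integral_sub (h.integrableOn_ray hω t₂ x c) (h.integrableOn_ray hω t₁ x c)

/-- Lower bound for the increments of the right-moving phonons. -/
theorem solIncrement_right_ge (h : RegularSol T u) (hb : SignedBoundary T η u)
    (hμ : μ ∈ Ioc (0:ℝ) 1) (hω : ω ∈ Ioi (0:ℝ)) (h12 : t₁ ≤ t₂) (h2 : t₂ < T)
    (hx : x ∈ Icc (0:ℝ) 1) :
    Mw ω * ∫ σ in Ioi 0, Real.exp (-ω * σ) *
      potIncrement T u (t₁ - σ) (t₂ - σ) (x + -(μ * ω) * σ) ≤ solIncrement T u t₁ t₂ x μ ω := by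
  have hc : 0 < μ * ω := mul_pos hμ.1 hω
  have e : ∀ σ, x + -(μ * ω) * σ = x - μ * ω * σ := fun σ => by ring
  rw [h.integral_ray_increment hω]
  simp only [e]
  rw [integral_ray_cutoff ω hc h2 hx, integral_ray_cutoff ω hc (h12.trans_lt h2) hx]
  have d2 := h.duhamel_right hμ hω h2 hx
  have d1 := h.duhamel_right hμ hω (h12.trans_lt h2) hx
  have h0 := mul_nonneg (Real.exp_pos (-ω * (x / (μ * ω)))).le
    (h.solIncrement_zero_nonneg hb hμ hω (sub_le_sub_right h12 (x / (μ * ω))))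
  unfold solIncrement at h0 ⊢
  rw [d1, d2]
  linarith

/-- Lower bound for the increments of the left-moving phonons. -/
theorem solIncrement_left_ge (h : RegularSol T u) (hb : SignedBoundary T η u)
    (hμ : μ ∈ Ioc (0:ℝ) 1) (hω : ω ∈ Ioi (0:ℝ)) (h12 : t₁ ≤ t₂) (h2 : t₂ < T)
    (hx : x ∈ Icc (0:ℝ) 1) :
    Mw ω * ((∫ σ in Ioi 0, Real.exp (-ω * σ) *
        potIncrement T u (t₁ - σ) (t₂ - σ) (x + μ * ω * σ)) +
      η ω * ∫ σ in Ioi 0, Real.exp (-ω * σ) *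
        potIncrement T u (t₁ - σ) (t₂ - σ) (2 - x + -(μ * ω) * σ)) ≤
    solIncrement T u t₁ t₂ x (-μ) ω := by
  have hc : 0 < μ * ω := mul_pos hμ.1 hω
  have h1 := h12.trans_lt h2
  have e : ∀ y σ, y + -(μ * ω) * σ = y - μ * ω * σ := fun y σ => by ring
  set s := (1 - x) / (μ * ω) with hs
  have hs0 : 0 ≤ s := div_nonneg (by linarith [hx.2]) hc.le
  have hr := h.solIncrement_right_ge hb hμ hω (sub_le_sub_right h12 s) (by linarith)
    (show (1:ℝ) ∈ Icc (0:ℝ) 1 by simp)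
  rw [h.integral_ray_increment hω] at hr ⊢
  rw [h.integral_ray_increment hω]
  simp only [e] at hr ⊢
  rw [integral_ray_cutoff_mirror ω hc h2 hx, integral_ray_cutoff_mirror ω hc h1 hx,
    integral_ray_cutoff_reflect ω hc h2 hx, integral_ray_cutoff_reflect ω hc h1 hx]
  rw [integral_ray_cutoff ω hc (by linarith) (show (1:ℝ) ∈ Icc (0:ℝ) 1 by simp),
    integral_ray_cutoff ω hc (by linarith) (show (1:ℝ) ∈ Icc (0:ℝ) 1 by simp)] at hr
  have d2 := h.duhamel_left hμ hω h2 hx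
  have d1 := h.duhamel_left hμ hω h1 hx
  have hbd := h.solIncrement_one_le hb hμ hω (sub_le_sub_right h12 s)
  have hE := Real.exp_pos (-ω * s)
  have h3 := mul_le_mul_of_nonneg_left
    ((mul_le_mul_of_nonneg_left hr (hb.coeff ω hω).1).trans hbd) hE.le
  rw [← hs] at d1 d2 ⊢
  rw [show solIncrement T u t₁ t₂ x (-μ) ω = _ - _ from rfl, d1, d2]
  rw [show solIncrement T u (t₁ - s) (t₂ - s) 1 (-μ) ω = _ - _ from rfl] at h3
  linarith

end RegularSol
end

end

section

open MeasureTheory Set Filter Topology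

/-- A function of two variables that is continuous in the first and a.e. measurable in the second
is a.e. measurable. -/
theorem aestronglyMeasurable_uncurry_of_continuous {Y : Type*} [MeasurableSpace Y] {ν : Measure Y}
    [SFinite ν] {f : ℝ → Y → ℝ} (hc : ∀ᵐ y ∂ν, Continuous fun s => f s y)
    (hm : ∀ s, AEStronglyMeasurable (f s) ν) (κ : Measure ℝ) [SFinite κ] :
    AEStronglyMeasurable (Function.uncurry f) (κ.prod ν) := by
  set grid : ℕ → ℤ → ℝ := fun n k => k / (n + 1) with hgrid
  have he : ∀ᵐ y ∂ν, ∀ n k, f (grid n k) y = (hm (grid n k)).mk _ y :=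
    ae_all_iff.2 fun n => ae_all_iff.2 fun k => (hm (grid n k)).ae_eq_mk
  set F : ℕ → ℝ × Y → ℝ := fun n z => (hm (grid n ⌊(n + 1) * z.1⌋)).mk _ z.2 with hF
  have hFm : ∀ n, Measurable (F n) := fun n => by
    have h1 : Measurable fun p : ℤ × Y => (hm (grid n p.1)).mk _ p.2 :=
      measurable_from_prod_countable_right fun k => (hm (grid n k)).stronglyMeasurable_mk.measurable
    exact h1.comp (f := fun z : ℝ × Y => (⌊((n:ℝ) + 1) * z.1⌋, z.2)) (by fun_prop)
  refine aestronglyMeasurable_of_tendsto_ae atTop (f := F)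
    (fun n => (hFm n).aestronglyMeasurable) ?_
  filter_upwards [Measure.quasiMeasurePreserving_snd.ae (hc.and he)] with z hz
  have h1 : ∀ n, F n z = f (grid n ⌊(n + 1) * z.1⌋) z.2 := fun n => (hz.2 n _).symm
  simp only [h1]
  refine ((hz.1.tendsto z.1).comp (g := fun s => f s z.2) ?_)
  have h2 : Tendsto (fun n : ℕ => z.1 - 1 / ((n:ℝ) + 1)) atTop (𝓝 z.1) := by
    simpa using tendsto_const_nhds.sub (tendsto_one_div_add_atTop_nhds_zero_nat (𝕜 := ℝ))
  refine tendsto_of_tendsto_of_tendsto_of_le_of_le h2 tendsto_const_nhds (fun n => ?_) fun n => ?_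
  · have h3 : (0:ℝ) < n + 1 := by positivity
    simp only [hgrid]
    rw [sub_le_iff_le_add, ← add_div, le_div_iff₀ h3]
    linarith [Int.lt_floor_add_one (((n:ℝ) + 1) * z.1)]
  · have h3 : (0:ℝ) < n + 1 := by positivity
    simp only [hgrid]
    rw [div_le_iff₀ h3]
    linarith [Int.floor_le (((n:ℝ) + 1) * z.1)]

section
variable {T : ℝ} {u : ℝ → ℝ → ℝ → ℝ → ℝ} {η : ℝ → ℝ} {t t₁ t₂ x μ ω : ℝ}

/-- Integration of a bounded function along rays against `rayWeight`. -/
theorem integrable_rayWeight_mul (m : ℕ) (hω : 0 < ω) {q : ℝ × ℝ → ℝ} (hq : Measurable q) {C : ℝ}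
    (hC : ∀ y, |q y| ≤ C) : Integrable (fun y => rayWeight m ω y * q y) rayMeasure :=
  (integrable_rayWeight m hω).mul_bdd (c := C) hq.aestronglyMeasurable (ae_of_all _ hC)

theorem rayWeight_mul_eq (m : ℕ) (q : ℝ × ℝ → ℝ) (y : ℝ × ℝ) :
    rayWeight m ω y * q y = (1 - y.1 ^ m) * (Real.exp (-ω * y.2) * q y) := by
  rw [rayWeight, mul_assoc]

theorem integral_rayWeight_mul (m : ℕ) (hω : 0 < ω) {q : ℝ × ℝ → ℝ} (hq : Measurable q) {C : ℝ}
    (hC : ∀ y, |q y| ≤ C) : ∫ y, rayWeight m ω y * q y ∂rayMeasure =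
      ∫ μ in Ioc (0:ℝ) 1, (1 - μ ^ m) * ∫ σ in Ioi (0:ℝ), Real.exp (-ω * σ) * q (μ, σ) := by
  have h1 := integrable_rayWeight_mul m hω hq hC
  simp only [rayWeight_mul_eq] at h1 ⊢
  unfold rayMeasure at h1 ⊢
  rw [integral_prod _ h1]
  simp only [integral_const_mul]

theorem integrableOn_rayWeight_mul (m : ℕ) (hω : 0 < ω) {q : ℝ × ℝ → ℝ} (hq : Measurable q)
    {C : ℝ} (hC : ∀ y, |q y| ≤ C) : IntegrableOn (fun μ : ℝ => (1 - μ ^ m) *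
      ∫ σ in Ioi (0:ℝ), Real.exp (-ω * σ) * q (μ, σ)) (Ioc 0 1) := by
  have h1 := integrable_rayWeight_mul m hω hq hC
  simp only [rayWeight_mul_eq] at h1
  unfold rayMeasure at h1
  have := h1.integral_prod_left
  simpa only [IntegrableOn, integral_const_mul] using this

/-- Folding an integral over all the directions. -/
theorem integral_velocity_eq {f : ℝ → ℝ} (hf : IntegrableOn f (Icc (-1) 1)) :
    IntegrableOn f (Ioc 0 1) ∧ IntegrableOn (fun μ => f (-μ)) (Ioc 0 1) ∧
    ∫ μ in Icc (-1:ℝ) 1, f μ = ∫ μ in Ioc (0:ℝ) 1, (f μ + f (-μ)) := by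
  have hi : ∀ a b : ℝ, -1 ≤ a → a ≤ b → b ≤ 1 → IntervalIntegrable f volume a b :=
    fun a b h1 h2 h3 => (intervalIntegrable_iff_integrableOn_Icc_of_le h2).2
      (hf.mono_set (Icc_subset_Icc h1 h3))
  have i1 := hi 0 1 (by norm_num) (by norm_num) le_rfl
  have i2 := hi (-1) 0 le_rfl (by norm_num) (by norm_num)
  have i3 : IntervalIntegrable (fun μ => f (-μ)) volume 0 1 := by
    have := (IntervalIntegrable.comp_sub_left i2 0).symm
    simpa using this
  refine ⟨(intervalIntegrable_iff_integrableOn_Ioc_of_le zero_le_one).1 i1,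
    (intervalIntegrable_iff_integrableOn_Ioc_of_le zero_le_one).1 i3, ?_⟩
  rw [integral_Icc_eq_integral_Ioc, ← intervalIntegral.integral_of_le (by norm_num),
    ← intervalIntegral.integral_of_le zero_le_one, intervalIntegral.integral_add i1 i3,
    intervalIntegral.integral_comp_neg, ← intervalIntegral.integral_add_adjacent_intervals i2 i1]
  simp [add_comm]

namespace RegularSol

theorem integrableOn_velocity (h : RegularSol T u) (hω : ω ∈ Ioi (0:ℝ)) (t x : ℝ) :
    IntegrableOn (fun μ => clampSol T u t x μ ω) (Icc (-1) 1) := by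
  have := ((h.int _ (clamp_mem h.pos.le (s := t)) _ (clamp_mem zero_le_one (s := x))).1 ω hω).const_mul
    ω⁻¹
  simpa only [IntegrableOn, clampSol, inv_mul_cancel_left₀ (mem_Ioi.1 hω).ne'] using this

/-- Average over directions against a bounded weight. -/
theorem sepCont_average (h : RegularSol T u) (hω : ω ∈ Ioi (0:ℝ)) {w : ℝ → ℝ} (hw : Measurable w)
    (hw1 : ∀ μ ∈ Icc (-1:ℝ) 1, |w μ| ≤ 1) :
    SepCont fun t x => ∫ μ in Icc (-1:ℝ) 1, w μ * clampSol T u t x μ ω := by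
  obtain ⟨B, hB⟩ := h.bdd
  have hm : ∀ t x, AEStronglyMeasurable (fun μ => w μ * clampSol T u t x μ ω)
      (volume.restrict (Icc (-1) 1)) := fun t x =>
    hw.aestronglyMeasurable.mul (h.integrableOn_velocity hω t x).aestronglyMeasurable
  have hb : ∀ t x, ∀ᵐ μ ∂(volume.restrict (Icc (-1:ℝ) 1)), ‖w μ * clampSol T u t x μ ω‖ ≤ B :=
    fun t x => by
      filter_upwards [ae_restrict_mem measurableSet_Icc] with μ hμ
      rw [norm_mul]
      have := hB (max 0 (min t T)) (max 0 (min x 1)) μ ω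
      exact (mul_le_of_le_one_left (norm_nonneg _) (hw1 μ hμ)).trans this
  refine ⟨fun x => ?_, fun t => ?_, fun R => ⟨B * 2, fun t x _ _ => ?_⟩⟩
  · refine continuous_of_dominated (fun t => hm t x) (fun t => hb t x) (integrable_const B) ?_
    filter_upwards [ae_restrict_mem measurableSet_Icc] with μ hμ
    exact ((h.sepCont_clampSol hμ hω).left x).const_mul _
  · refine continuous_of_dominated (fun x => hm t x) (fun x => hb t x) (integrable_const B) ?_
    filter_upwards [ae_restrict_mem measurableSet_Icc] with μ hμ
    exact ((h.sepCont_clampSol hμ hω).right t).const_mul _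
  · refine (norm_integral_le_of_norm_le_const (hb t x)).trans (le_of_eq ?_)
    simp [Measure.real]
    left; norm_num

/-- Averaging over directions commutes with integration in time. -/
theorem integral_solIncrement (h : RegularSol T u) (hω : ω ∈ Ioi (0:ℝ)) {w : ℝ → ℝ}
    (hw : Measurable w) (hw1 : ∀ μ ∈ Icc (-1:ℝ) 1, |w μ| ≤ 1) (h12 : t₁ ≤ t₂) (x : ℝ) :
    IntegrableOn (fun μ => w μ * solIncrement T u t₁ t₂ x μ ω) (Icc (-1) 1) ∧
    ∫ μ in Icc (-1:ℝ) 1, w μ * solIncrement T u t₁ t₂ x μ ω =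
      ∫ s in t₁..t₂, ∫ μ in Icc (-1:ℝ) 1, w μ * clampSol T u s x μ ω := by
  obtain ⟨B, hB⟩ := h.bdd
  have hm : AEStronglyMeasurable (Function.uncurry fun s μ => w μ * clampSol T u s x μ ω)
      ((volume.restrict (Ioc t₁ t₂)).prod (volume.restrict (Icc (-1) 1))) := by
    refine aestronglyMeasurable_uncurry_of_continuous ?_ (fun s =>
      hw.aestronglyMeasurable.mul (h.integrableOn_velocity hω s x).aestronglyMeasurable) _
    filter_upwards [ae_restrict_mem measurableSet_Icc] with μ hμ
    exact ((h.sepCont_clampSol hμ hω).left x).const_mul _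
  have hi : Integrable (Function.uncurry fun s μ => w μ * clampSol T u s x μ ω)
      ((volume.restrict (Ioc t₁ t₂)).prod (volume.restrict (Icc (-1) 1))) := by
    refine Integrable.of_bound hm B ?_
    filter_upwards [Measure.quasiMeasurePreserving_snd.ae
      (ae_restrict_mem (μ := volume) (measurableSet_Icc (a := (-1:ℝ)) (b := 1)))] with z hz
    simp only [Function.uncurry, norm_mul]
    exact (mul_le_of_le_one_left (norm_nonneg _) (hw1 z.2 hz)).trans (hB _ _ _ _)
  have e : ∀ μ ∈ Icc (-1:ℝ) 1, w μ * solIncrement T u t₁ t₂ x μ ω =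
      ∫ s in Ioc t₁ t₂, w μ * clampSol T u s x μ ω := fun μ hμ => by
    have c := (h.sepCont_clampSol hμ hω).left x
    rw [solIncrement, intervalIntegral.integral_interval_sub_left (c.intervalIntegrable _ _)
      (c.intervalIntegrable _ _), ← intervalIntegral.integral_of_le h12,
      intervalIntegral.integral_const_mul]
  constructor
  · exact hi.integral_prod_right.congr (by
      filter_upwards [ae_restrict_mem measurableSet_Icc] with μ hμ
      exact (e μ hμ).symm)
  · rw [setIntegral_congr_fun measurableSet_Icc e, intervalIntegral.integral_of_le h12]
    exact (integral_integral_swap hi).symm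

end RegularSol
end

end

section

open MeasureTheory Set Filter Topology

section
variable {T : ℝ} {u : ℝ → ℝ → ℝ → ℝ → ℝ} {η : ℝ → ℝ} {t t₁ t₂ x μ ω : ℝ}

theorem abs_one_sub_abs_pow_le (m : ℕ) {μ : ℝ} (hμ : μ ∈ Icc (-1:ℝ) 1) : |1 - |μ| ^ m| ≤ 1 := by
  have h1 : |μ| ^ m ≤ 1 := pow_le_one₀ (abs_nonneg _) (abs_le.2 hμ)
  have h2 : 0 ≤ |μ| ^ m := by positivity
  rw [abs_of_nonneg (by linarith)]
  linarith

/-- The real form of `rayIncrement` for the truncated potential. -/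
theorem rayIncrement_cutoff (m : ℕ) (ω b h : ℝ) (t x : ℝ) :
    rayIncrement m ω b h (fun t x => (cutoff T (potential T u) t x : ℂ)) t x =
      ((∫ y, rayWeight m ω y * potIncrement T u (t - y.2) (t + h - y.2) (x - y.1 * b * y.2)
        ∂rayMeasure : ℝ) : ℂ) := by
  rw [rayIncrement, ← integral_complex_ofReal]
  congr 1
  funext y
  simp only [potIncrement]
  push_cast
  rfl

namespace RegularSol

theorem measurable_cutoff_potential (h : RegularSol T u) :
    Measurable (Function.uncurry (cutoff T (potential T u))) :=
  measurable_cutoff h.sepCont_potential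

theorem exists_abs_potIncrement_le (h : RegularSol T u) :
    ∃ C, ∀ t₁ t₂ x, |potIncrement T u t₁ t₂ x| ≤ C := by
  obtain ⟨C, hC⟩ := exists_abs_cutoff_le (T := T) h.sepCont_potential h.potential_of_nonpos
  refine ⟨C + C, fun t₁ t₂ x => (abs_sub _ _).trans (add_le_add (hC _ _) (hC _ _))⟩

theorem measurable_potIncrement_ray (h : RegularSol T u) (t₁ t₂ x b : ℝ) :
    Measurable fun y : ℝ × ℝ => potIncrement T u (t₁ - y.2) (t₂ - y.2) (x - y.1 * b * y.2) :=
  (h.measurable_cutoff_potential.comp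
    (f := fun y : ℝ × ℝ => (t₂ - y.2, x - y.1 * b * y.2)) (by fun_prop)).sub
  (h.measurable_cutoff_potential.comp
    (f := fun y : ℝ × ℝ => (t₁ - y.2, x - y.1 * b * y.2)) (by fun_prop))

theorem integral_average_ge (h : RegularSol T u) (hb : SignedBoundary T η u)
    (hω : ω ∈ Ioi (0:ℝ)) (m : ℕ) (h12 : t₁ ≤ t₂) (h2 : t₂ < T) (hx : x ∈ Icc (0:ℝ) 1) :
    Mw ω * ((∫ y, rayWeight m ω y *
          potIncrement T u (t₁ - y.2) (t₂ - y.2) (x - y.1 * ω * y.2) ∂rayMeasure) +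
        (∫ y, rayWeight m ω y *
          potIncrement T u (t₁ - y.2) (t₂ - y.2) (x - y.1 * (-ω) * y.2) ∂rayMeasure) +
        η ω * ∫ y, rayWeight m ω y *
          potIncrement T u (t₁ - y.2) (t₂ - y.2) (2 - x - y.1 * ω * y.2) ∂rayMeasure) ≤
      ∫ s in t₁..t₂, ∫ μ in Icc (-1:ℝ) 1, (1 - |μ| ^ m) * clampSol T u s x μ ω := by
  obtain ⟨C, hC⟩ := h.exists_abs_potIncrement_le
  have hq : ∀ y b, _ := fun y b => h.measurable_potIncrement_ray t₁ t₂ y b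
  have hqC : ∀ (x b : ℝ) (y : ℝ × ℝ),
      |potIncrement T u (t₁ - y.2) (t₂ - y.2) (x - y.1 * b * y.2)| ≤ C := fun _ _ _ => hC _ _ _
  have hA := h.integral_solIncrement hω (w := fun μ => 1 - |μ| ^ m) (by fun_prop)
    (fun μ hμ => abs_one_sub_abs_pow_le m hμ) h12 x
  have hB := integral_velocity_eq hA.1
  obtain ⟨J, hJ⟩ : ∃ J : ℝ → ℝ → ℝ → ℝ, ∀ y b μ, J y b μ = (1 - μ ^ m) * ∫ σ in Ioi (0:ℝ),
    Real.exp (-ω * σ) * potIncrement T u (t₁ - σ) (t₂ - σ) (y - μ * b * σ) := ⟨_, fun _ _ _ => rfl⟩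
  have i : ∀ y b : ℝ, IntegrableOn (J y b) (Ioc 0 1) := fun y b => by
    simpa only [← hJ] using integrableOn_rayWeight_mul m (mem_Ioi.1 hω) (hq y b) (hqC y b)
  have e : ∀ y b : ℝ, ∫ y', rayWeight m ω y' *
      potIncrement T u (t₁ - y'.2) (t₂ - y'.2) (y - y'.1 * b * y'.2) ∂rayMeasure =
      ∫ μ in Ioc (0:ℝ) 1, J y b μ := fun y b => by
    simpa only [← hJ] using integral_rayWeight_mul m (mem_Ioi.1 hω) (hq y b) (hqC y b)
  rw [← hA.2, hB.2.2, e, e, e, ← integral_const_mul, ← integral_add (i _ _) (i _ _),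
    ← integral_add (f := fun a => J x ω a + J x (-ω) a) (g := fun a => η ω * J (2 - x) ω a)
      ((i _ _).add (i _ _)) ((i _ _).const_mul _), ← integral_const_mul]
  refine setIntegral_mono_on ((((i _ _).add (i _ _)).add ((i _ _).const_mul _)).const_mul _)
    (hB.1.add hB.2.1) measurableSet_Ioc fun μ hμ => ?_
  have h1 := h.solIncrement_right_ge hb hμ hω h12 h2 hx
  have h3 := h.solIncrement_left_ge hb hμ hω h12 h2 hx
  have e1 : ∀ y σ : ℝ, y - μ * ω * σ = y + -(μ * ω) * σ := fun y σ => by ring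
  have e2 : ∀ y σ : ℝ, y - μ * (-ω) * σ = y + μ * ω * σ := fun y σ => by ring
  have e3 : |(-μ)| = μ := by rw [abs_neg, abs_of_pos hμ.1]
  have h4 : 0 ≤ 1 - μ ^ m := sub_nonneg.2 (pow_le_one₀ hμ.1.le hμ.2)
  simp only [hJ, e1, e2, e3, abs_of_pos hμ.1]
  have h5 := mul_le_mul_of_nonneg_left (add_le_add h1 h3) h4
  refine le_trans (le_of_eq ?_) (h5.trans (le_of_eq ?_))
  · ring
  · ring

end RegularSol
end

end

section

open MeasureTheory Set Filter Topology

/-- Lebesgue measure on the space-time slab `(0, T) × (0, 1)`. -/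
noncomputable def slabMeasure (T : ℝ) : Measure (ℝ × ℝ) :=
  (volume.restrict (Ioo 0 T)).prod (volume.restrict (Ioo 0 1))

theorem slabMeasure_eq_restrict (T : ℝ) :
    slabMeasure T = (volume.prod volume).restrict (Ioo 0 T ×ˢ Ioo (0:ℝ) 1) :=
  Measure.prod_restrict _ _

theorem slabMeasure_univ (T : ℝ) : slabMeasure T univ = ENNReal.ofReal T := by
  rw [slabMeasure, ← univ_prod_univ, Measure.prod_prod]
  simp

theorem ENNReal.le_one_add_sq (a : ENNReal) : a ≤ 1 + a ^ 2 := by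
  rcases le_total a 1 with h | h
  · exact h.trans le_self_add
  · calc a = a * 1 := (mul_one a).symm
      _ ≤ a * a := by gcongr
      _ = a ^ 2 := (sq a).symm
      _ ≤ 1 + a ^ 2 := le_add_self

theorem lintegral_slab_le (T : ℝ) (a : ENNReal) {w : ℝ → ℝ → ℂ}
    (hw : Measurable (Function.uncurry w)) :
    ∫⁻ z, a * ‖w z.1 z.2‖ₑ ∂(slabMeasure T) ≤
      ENNReal.ofReal T + a ^ 2 * ∫⁻ t, ∫⁻ x, ‖w t x‖ₑ ^ 2 := by
  have hm : Measurable fun z : ℝ × ℝ => ‖w z.1 z.2‖ₑ ^ 2 := (hw.enorm.pow_const 2)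
  calc ∫⁻ z, a * ‖w z.1 z.2‖ₑ ∂(slabMeasure T)
      ≤ ∫⁻ z, (1 + a ^ 2 * ‖w z.1 z.2‖ₑ ^ 2) ∂(slabMeasure T) := by
        refine lintegral_mono fun z => ?_
        rw [← mul_pow]
        exact ENNReal.le_one_add_sq _
    _ = ENNReal.ofReal T + a ^ 2 * ∫⁻ z, ‖w z.1 z.2‖ₑ ^ 2 ∂(slabMeasure T) := by
        rw [lintegral_add_left measurable_const, lintegral_const_mul _ hm, lintegral_const,
          slabMeasure_univ, one_mul]
    _ ≤ _ := by
        gcongr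
        rw [slabMeasure_eq_restrict]
        refine (setLIntegral_le_lintegral _ _).trans (le_of_eq ?_)
        rw [lintegral_prod _ hm.aemeasurable]

namespace RegularSol
variable {T : ℝ} {u : ℝ → ℝ → ℝ → ℝ → ℝ} {η : ℝ → ℝ} {t t₁ t₂ x μ ω : ℝ}

/-- The truncated potential as a complex-valued function. -/
theorem measurable_ofReal_cutoff (h : RegularSol T u) : Measurable (Function.uncurry
    fun t x => (cutoff T (potential T u) t x : ℂ)) :=
  Complex.measurable_ofReal.comp h.measurable_cutoff_potential

theorem lintegral_rayIncrement_cutoff_le (h : RegularSol T u) (hω : 0 < ω) (m : ℕ) (b : ℝ) (n : ℕ) :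
    ENNReal.ofReal (n + 1) ^ 2 * ∫⁻ t, ∫⁻ x, ‖rayIncrement m ω b (1 / ((n:ℝ) + 1))
      (fun t x => (cutoff T (potential T u) t x : ℂ)) t x‖ₑ ^ 2 ≤
    ENNReal.ofReal (2 + (m + 2) ^ 2 * Real.pi) ^ 2 *
      ∫⁻ t, ∫⁻ x, ‖(cutoff T (potential T u) t x : ℂ)‖ₑ ^ 2 := by
  obtain ⟨C, hC⟩ := exists_abs_cutoff_le (T := T) h.sepCont_potential h.potential_of_nonpos
  have hn : (0:ℝ) < (n:ℝ) + 1 := by positivity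
  have := lintegral_rayIncrement_sq_le m hω b (h := 1 / ((n:ℝ) + 1)) (by positivity)
    h.measurable_ofReal_cutoff (C := C) (fun t x => by rw [Complex.norm_real]; exact hC t x)
    (fun t x hx => by rw [cutoff_of_notMem fun hx' => hx (Ioo_subset_Icc_self hx')]; rfl)
  refine (mul_le_mul_right this (ENNReal.ofReal ((n:ℝ) + 1) ^ 2)).trans (le_of_eq ?_)
  rw [← mul_assoc, ← mul_pow, ← ENNReal.ofReal_mul hn.le, ← mul_assoc, mul_one_div_cancel hn.ne',
    one_mul]

theorem lintegral_neg_average_le (h : RegularSol T u) (hb : SignedBoundary T η u)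
    (hω : ω ∈ Ioi (0:ℝ)) (m : ℕ) :
    ∫⁻ z, ENNReal.ofReal (-∫ μ in Icc (-1:ℝ) 1, (1 - |μ| ^ m) * clampSol T u z.1 z.2 μ ω)
      ∂(slabMeasure T) ≤ ENNReal.ofReal (Mw ω) * (3 * (ENNReal.ofReal T +
        ENNReal.ofReal (2 + (m + 2) ^ 2 * Real.pi) ^ 2 *
          ∫⁻ t, ∫⁻ x, ‖(cutoff T (potential T u) t x : ℂ)‖ₑ ^ 2)) := by
  set W : ℝ → ℕ → ℝ → ℝ → ℂ := fun b n => rayIncrement m ω b (1 / ((n:ℝ) + 1))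
    (fun t x => (cutoff T (potential T u) t x : ℂ)) with hW
  have hWm : ∀ b n, Measurable (Function.uncurry (W b n)) := fun b n =>
    measurable_rayIncrement m ω b _ h.measurable_ofReal_cutoff
  have hWm' : ∀ b n, Measurable (Function.uncurry fun t x => W b n t (2 - x)) := fun b n =>
    (hWm b n).comp (f := fun z : ℝ × ℝ => (z.1, 2 - z.2)) (by fun_prop)
  set a : ℕ → ENNReal := fun n => ENNReal.ofReal ((n:ℝ) + 1) with ha
  set s : ℕ → ℝ × ℝ → ENNReal := fun n z => a n * ‖W ω n z.1 z.2‖ₑ + a n * ‖W (-ω) n z.1 z.2‖ₑ +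
    a n * ‖W ω n z.1 (2 - z.2)‖ₑ with hs
  have m1 : ∀ b n, Measurable fun z : ℝ × ℝ => a n * ‖W b n z.1 z.2‖ₑ := fun b n =>
    (hWm b n).enorm.const_mul _
  have m2 : ∀ b n, Measurable fun z : ℝ × ℝ => a n * ‖W b n z.1 (2 - z.2)‖ₑ := fun b n =>
    (hWm' b n).enorm.const_mul _
  have hsm : ∀ n, Measurable (s n) := fun n => ((m1 _ n).add (m1 _ n)).add (m2 _ n)
  set R : ENNReal := ENNReal.ofReal T + ENNReal.ofReal (2 + (m + 2) ^ 2 * Real.pi) ^ 2 *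
          ∫⁻ t, ∫⁻ x, ‖(cutoff T (potential T u) t x : ℂ)‖ₑ ^ 2 with hR
  have b1 : ∀ b n, ∫⁻ z, a n * ‖W b n z.1 z.2‖ₑ ∂(slabMeasure T) ≤ R := fun b n =>
    (lintegral_slab_le T (a n) (hWm b n)).trans
      (add_le_add le_rfl (h.lintegral_rayIncrement_cutoff_le (mem_Ioi.1 hω) m b n))
  have b2 : ∀ b n, ∫⁻ z, a n * ‖W b n z.1 (2 - z.2)‖ₑ ∂(slabMeasure T) ≤ R := fun b n => by
    refine (lintegral_slab_le T (a n) (hWm' b n)).trans (add_le_add le_rfl ?_)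
    simp_rw [fun t => lintegral_sub_left_eq_self (μ := (volume : Measure ℝ))
      (fun x => ‖W b n t x‖ₑ ^ 2) 2]
    exact h.lintegral_rayIncrement_cutoff_le (mem_Ioi.1 hω) m b n
  have hsR : ∀ n, ∫⁻ z, s n z ∂(slabMeasure T) ≤ 3 * R := fun n => by
    simp only [hs]
    rw [lintegral_add_right _ (m2 _ n), lintegral_add_left (m1 _ n)]
    refine (add_le_add (add_le_add (b1 _ n) (b1 _ n)) (b2 _ n)).trans (le_of_eq ?_)
    ring
  have key : ∀ z ∈ Ioo 0 T ×ˢ Ioo (0:ℝ) 1,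
      ENNReal.ofReal (-∫ μ in Icc (-1:ℝ) 1, (1 - |μ| ^ m) * clampSol T u z.1 z.2 μ ω) ≤
        liminf (fun n => ENNReal.ofReal (Mw ω) * s n z) atTop := by
    rintro ⟨t, x⟩ ⟨ht, hx⟩
    have hx' := Ioo_subset_Icc_self hx
    have hS := h.sepCont_average hω (w := fun μ => 1 - |μ| ^ m) (by fun_prop)
      fun μ hμ => abs_one_sub_abs_pow_le m hμ
    set A : ℝ → ℝ := fun s => ∫ μ in Icc (-1:ℝ) 1, (1 - |μ| ^ m) * clampSol T u s x μ ω with hA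
    have hAc : Continuous A := hS.left x
    have hd : HasDerivAt (fun s => ∫ r in t..s, A r) (A t) t :=
      intervalIntegral.integral_hasDerivAt_right (hAc.intervalIntegrable _ _)
        (hAc.stronglyMeasurableAtFilter _ _) hAc.continuousAt
    have hstep : Tendsto (fun n : ℕ => 1 / ((n:ℝ) + 1)) atTop (𝓝 0) :=
      tendsto_one_div_add_atTop_nhds_zero_nat
    have hlim : Tendsto (fun n : ℕ => ((n:ℝ) + 1) * ∫ r in t..(t + 1 / ((n:ℝ) + 1)), A r) atTop
        (𝓝 (A t)) := by
      have h1 := hasDerivAt_iff_tendsto_slope_zero.1 hd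
      have h2 := h1.comp (tendsto_nhdsWithin_iff.2 ⟨hstep, Eventually.of_forall fun n =>
        (by positivity : (1:ℝ) / ((n:ℝ) + 1) ≠ 0)⟩)
      refine h2.congr fun n => ?_
      simp
    have hlim2 := (ENNReal.continuous_ofReal.tendsto _).comp hlim.neg
    change ENNReal.ofReal (-A t) ≤ _
    rw [← hlim2.liminf_eq]
    refine liminf_le_liminf ?_
    have hev : ∀ᶠ n : ℕ in atTop, 1 / ((n:ℝ) + 1) < T - t :=
      hstep.eventually (gt_mem_nhds (by linarith [ht.2]))
    filter_upwards [hev] with n hn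
    have hn0 : (0:ℝ) < (n:ℝ) + 1 := by positivity
    have hn1 : (0:ℝ) < 1 / ((n:ℝ) + 1) := by positivity
    have g := h.integral_average_ge hb hω m (t₁ := t) (t₂ := t + 1 / ((n:ℝ) + 1)) (by linarith)
      (by linarith) hx'
    have eW : ∀ b y, ∃ r : ℝ, W b n t y = (r : ℂ) ∧ r = ∫ y', rayWeight m ω y' *
        potIncrement T u (t - y'.2) (t + 1 / ((n:ℝ) + 1) - y'.2) (y - y'.1 * b * y'.2)
        ∂rayMeasure := fun b y => ⟨_, rayIncrement_cutoff m ω b _ t y, rfl⟩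
    obtain ⟨r1, e1, f1⟩ := eW ω x
    obtain ⟨r2, e2, f2⟩ := eW (-ω) x
    obtain ⟨r3, e3, f3⟩ := eW ω (2 - x)
    rw [← f1, ← f2, ← f3] at g
    have hη := hb.coeff ω hω
    have e4 : ∀ r : ℝ, ‖(r : ℂ)‖ₑ = ENNReal.ofReal |r| := fun r => by
      rw [← ofReal_norm, Complex.norm_real, Real.norm_eq_abs]
    simp only [Function.comp_apply, hs, e1, e2, e3, e4, ha]
    rw [← mul_add, ← mul_add, ← ENNReal.ofReal_add (abs_nonneg _) (abs_nonneg _),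
      ← ENNReal.ofReal_add (by positivity) (abs_nonneg _), ← ENNReal.ofReal_mul hn0.le,
      ← ENNReal.ofReal_mul (Mw_pos (mem_Ioi.1 hω)).le]
    refine ENNReal.ofReal_le_ofReal ?_
    have g1 : -(|r1| + |r2| + |r3|) ≤ r1 + r2 + η ω * r3 := by
      have := neg_abs_le r1
      have := neg_abs_le r2
      have h3 : |η ω * r3| ≤ |r3| := by
        rw [abs_mul, abs_of_nonneg hη.1]
        exact mul_le_of_le_one_left (abs_nonneg _) hη.2
      have := neg_abs_le (η ω * r3)
      linarith
    have g2 := mul_le_mul_of_nonneg_left g1 (Mw_pos (mem_Ioi.1 hω)).le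
    have g3 := mul_le_mul_of_nonneg_left (g2.trans g) hn0.le
    linarith
  calc _ ≤ ∫⁻ z, liminf (fun n => ENNReal.ofReal (Mw ω) * s n z) atTop ∂(slabMeasure T) := by
        rw [slabMeasure_eq_restrict]
        exact setLIntegral_mono' (measurableSet_Ioo.prod measurableSet_Ioo) key
    _ ≤ liminf (fun n => ∫⁻ z, ENNReal.ofReal (Mw ω) * s n z ∂(slabMeasure T)) atTop :=
        lintegral_liminf_le fun n => (hsm n).const_mul _
    _ ≤ liminf (fun _ : ℕ => ENNReal.ofReal (Mw ω) * (3 * R)) atTop := by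
        refine liminf_le_liminf (Eventually.of_forall fun n => ?_)
        change ∫⁻ z, ENNReal.ofReal (Mw ω) * s n z ∂(slabMeasure T) ≤ _
        rw [lintegral_const_mul _ (hsm n)]
        gcongr
        exact hsR n
    _ = _ := by simp

end RegularSol

end

section

open MeasureTheory Set Filter Topology

theorem integral_abs_pow_velocity (m : ℕ) : ∫ μ in Icc (-1:ℝ) 1, |μ| ^ m = 2 / (m + 1) := by
  have h1 : IntegrableOn (fun μ : ℝ => |μ| ^ m) (Icc (-1) 1) :=
    (by fun_prop : Continuous fun μ : ℝ => |μ| ^ m).continuousOn.integrableOn_Icc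
  rw [(integral_velocity_eq h1).2.2, setIntegral_congr_fun (g := fun μ : ℝ => 2 * μ ^ m)
    measurableSet_Ioc fun μ hμ => ?_]
  · rw [integral_const_mul, ← intervalIntegral.integral_of_le zero_le_one, integral_pow]
    simp
    ring
  · simp only [abs_neg, abs_of_pos hμ.1]
    ring

/-- Energy density per frequency. -/
noncomputable def spectral (T : ℝ) (u : ℝ → ℝ → ℝ → ℝ → ℝ) (t x ω : ℝ) : ℝ :=
  ∫ μ in Icc (-1:ℝ) 1, ω * clampSol T u t x μ ω

/-- The polynomial weight controlling the negative part of the energy density. -/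
theorem spectral_bound_le {ω : ℝ} (hω : 0 < ω) :
    (2 + ((⌈ω ^ 3⌉₊ : ℝ) + 2) ^ 2 * Real.pi) ^ 2 ≤ 288 * ω ^ 12 + 23328 := by
  have h1 : ((⌈ω ^ 3⌉₊ : ℝ) + 2) ≤ ω ^ 3 + 3 := by
    linarith [(Nat.ceil_lt_add_one (by positivity : 0 ≤ ω ^ 3)).le]
  have h2 : 2 + ((⌈ω ^ 3⌉₊ : ℝ) + 2) ^ 2 * Real.pi ≤ 6 * (ω ^ 3 + 3) ^ 2 := by
    have h3 : ((⌈ω ^ 3⌉₊ : ℝ) + 2) ^ 2 ≤ (ω ^ 3 + 3) ^ 2 := by gcongr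
    have h4 : 0 < ω ^ 3 := by positivity
    nlinarith [Real.pi_le_four, Real.pi_pos, sq_nonneg ((⌈ω ^ 3⌉₊ : ℝ) + 2)]
  have h5 : (2 + ((⌈ω ^ 3⌉₊ : ℝ) + 2) ^ 2 * Real.pi) ^ 2 ≤ (6 * (ω ^ 3 + 3) ^ 2) ^ 2 :=
    pow_le_pow_left₀ (by positivity) h2 2
  refine h5.trans ?_
  have h6 : (ω ^ 3 + 3) ^ 2 ≤ 2 * ((ω ^ 3) ^ 2 + 3 ^ 2) := by nlinarith [sq_nonneg (ω ^ 3 - 3)]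
  have h7 : ((ω ^ 3 + 3) ^ 2) ^ 2 ≤ (2 * ((ω ^ 3) ^ 2 + 3 ^ 2)) ^ 2 :=
    pow_le_pow_left₀ (by positivity) h6 2
  nlinarith [sq_nonneg ((ω ^ 3) ^ 2 - 9)]

namespace RegularSol
variable {T : ℝ} {u : ℝ → ℝ → ℝ → ℝ → ℝ} {η : ℝ → ℝ} {t t₁ t₂ x μ ω : ℝ}

theorem sepCont_spectral (h : RegularSol T u) (hω : ω ∈ Ioi (0:ℝ)) :
    SepCont fun t x => spectral T u t x ω := by
  have := (h.sepCont_average hω (w := fun _ => 1) measurable_const (by simp)).const_mul ω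
  simpa only [one_mul, spectral, integral_const_mul] using this

theorem integrableOn_spectral (h : RegularSol T u) (t x : ℝ) :
    IntegrableOn (spectral T u t x) (Ioi 0) :=
  (h.int _ (clamp_mem h.pos.le (s := t)) _ (clamp_mem zero_le_one (s := x))).2

theorem bracket_eq_integral_spectral (ht : t ∈ Icc 0 T) (hx : x ∈ Icc (0:ℝ) 1) :
    bracket (fun μ ω => ω * u t x μ ω) = ∫ ω in Ioi (0:ℝ), spectral T u t x ω := by
  simp only [bracket, spectral, clampSol_of_mem ht hx]

theorem neg_spectral_le (h : RegularSol T u) (hω : ω ∈ Ioi (0:ℝ)) {B : ℝ}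
    (hB : ∀ t x μ ω, |u t x μ ω| ≤ B) (m : ℕ) (t x : ℝ) :
    -spectral T u t x ω ≤ ω * (B * (2 / (m + 1))) +
      ω * -∫ μ in Icc (-1:ℝ) 1, (1 - |μ| ^ m) * clampSol T u t x μ ω := by
  have hω' := mem_Ioi.1 hω
  have i1 := h.integrableOn_velocity hω t x
  have i2 : IntegrableOn (fun μ => |μ| ^ m * clampSol T u t x μ ω) (Icc (-1) 1) := by
    refine i1.bdd_mul (c := 1) (f := fun μ : ℝ => |μ| ^ m)
      (by fun_prop : Continuous fun μ : ℝ => |μ| ^ m).aestronglyMeasurable ?_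
    filter_upwards [ae_restrict_mem measurableSet_Icc] with μ hμ
    rw [Real.norm_eq_abs, abs_of_nonneg (by positivity)]
    exact pow_le_one₀ (abs_nonneg _) (abs_le.2 hμ)
  have i3 : IntegrableOn (fun μ : ℝ => |μ| ^ m) (Icc (-1) 1) :=
    (by fun_prop : Continuous fun μ : ℝ => |μ| ^ m).continuousOn.integrableOn_Icc
  have e : ∫ μ in Icc (-1:ℝ) 1, (1 - |μ| ^ m) * clampSol T u t x μ ω =
      (∫ μ in Icc (-1:ℝ) 1, clampSol T u t x μ ω) -
        ∫ μ in Icc (-1:ℝ) 1, |μ| ^ m * clampSol T u t x μ ω := by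
    rw [← integral_sub i1 i2]
    congr 1
    funext μ
    ring
  have b : -(B * (2 / (m + 1))) ≤ ∫ μ in Icc (-1:ℝ) 1, |μ| ^ m * clampSol T u t x μ ω := by
    rw [← integral_abs_pow_velocity, ← integral_const_mul, ← integral_neg]
    refine setIntegral_mono_on (i3.const_mul B).neg i2 measurableSet_Icc fun μ _ => ?_
    have h1 := (abs_le.1 (hB (max 0 (min t T)) (max 0 (min x 1)) μ ω)).1
    have h2 : 0 ≤ |μ| ^ m := by positivity
    simp only [clampSol]
    nlinarith
  rw [spectral, integral_const_mul, e]
  nlinarith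

theorem exists_lintegral_neg_spectral_le (h : RegularSol T u) (hb : SignedBoundary T η u) :
    ∃ D : ℝ → ℝ, IntegrableOn D (Ioi 0) ∧ ∀ ω ∈ Ioi (0:ℝ),
      ∫⁻ z, ENNReal.ofReal (-spectral T u z.1 z.2 ω) ∂(slabMeasure T) ≤ ENNReal.ofReal (D ω) := by
  obtain ⟨B, hB⟩ := h.bdd
  have hB0 : 0 ≤ B := (abs_nonneg _).trans (hB 0 0 0 0)
  have hT := h.pos
  have hN := lintegral_cutoff_sq_lt_top (T := T) h.sepCont_potential h.potential_of_nonpos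
  set N : ENNReal := ∫⁻ t, ∫⁻ x, ‖(cutoff T (potential T u) t x : ℂ)‖ₑ ^ 2 with hNdef
  obtain ⟨N', hN0, hN'⟩ : ∃ r : ℝ, 0 ≤ r ∧ N = ENNReal.ofReal r :=
    ⟨N.toReal, ENNReal.toReal_nonneg, (ENNReal.ofReal_toReal hN.ne).symm⟩
  refine ⟨fun ω => 4 * B * T * (1 + ω ^ 2)⁻¹ + ((3 * T + 3 * 23328 * N') * (ω ^ 1 * Mw ω) +
    3 * 288 * N' * (ω ^ 13 * Mw ω)), ?_, fun ω hω => ?_⟩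
  · exact ((integrable_inv_one_add_sq.integrableOn).const_mul _).add
      (((integrableOn_pow_mul_Mw 1).const_mul _).add ((integrableOn_pow_mul_Mw 13).const_mul _))
  have hω' := mem_Ioi.1 hω
  have hM := (Mw_pos hω').le
  set m := ⌈ω ^ 3⌉₊ with hm
  have hm1 : ω * (B * (2 / ((m:ℝ) + 1))) ≤ 4 * B * (1 + ω ^ 2)⁻¹ := by
    have h1 : ω ^ 3 + 1 ≤ (m:ℝ) + 1 := by linarith [Nat.le_ceil (ω ^ 3)]
    have h2 : ω / ((m:ℝ) + 1) ≤ 2 * (1 + ω ^ 2)⁻¹ := by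
      rw [← div_eq_mul_inv, div_le_div_iff₀ (by positivity) (by positivity)]
      rcases le_total ω 1 with h3 | h3
      · nlinarith [pow_pos hω' 3]
      · nlinarith [pow_pos hω' 3, mul_nonneg (mul_nonneg hω'.le (sub_nonneg.2 h3)) (by linarith : 0 ≤ ω + 1)]
    calc ω * (B * (2 / ((m:ℝ) + 1))) = 2 * B * (ω / ((m:ℝ) + 1)) := by ring
      _ ≤ 2 * B * (2 * (1 + ω ^ 2)⁻¹) := by gcongr
      _ = _ := by ring
  have key := h.lintegral_neg_average_le hb hω m
  calc ∫⁻ z, ENNReal.ofReal (-spectral T u z.1 z.2 ω) ∂(slabMeasure T)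
      ≤ ∫⁻ z, (ENNReal.ofReal (4 * B * (1 + ω ^ 2)⁻¹) + ENNReal.ofReal ω * ENNReal.ofReal
          (-∫ μ in Icc (-1:ℝ) 1, (1 - |μ| ^ m) * clampSol T u z.1 z.2 μ ω)) ∂(slabMeasure T) := by
        refine lintegral_mono fun z => ?_
        rw [← ENNReal.ofReal_mul hω'.le]
        refine (ENNReal.ofReal_le_ofReal ?_).trans ENNReal.ofReal_add_le
        exact (h.neg_spectral_le hω hB m z.1 z.2).trans (add_le_add hm1 le_rfl)
    _ = ENNReal.ofReal (4 * B * (1 + ω ^ 2)⁻¹) * ENNReal.ofReal T + ENNReal.ofReal ω *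
          ∫⁻ z, ENNReal.ofReal (-∫ μ in Icc (-1:ℝ) 1, (1 - |μ| ^ m) * clampSol T u z.1 z.2 μ ω)
            ∂(slabMeasure T) := by
        rw [lintegral_add_left measurable_const, lintegral_const, slabMeasure_univ,
          lintegral_const_mul' _ _ ENNReal.ofReal_ne_top]
    _ ≤ ENNReal.ofReal (4 * B * (1 + ω ^ 2)⁻¹) * ENNReal.ofReal T + ENNReal.ofReal ω *
          (ENNReal.ofReal (Mw ω) * (3 * (ENNReal.ofReal T +
            ENNReal.ofReal (2 + (m + 2) ^ 2 * Real.pi) ^ 2 * N))) := by gcongr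
    _ = ENNReal.ofReal (4 * B * (1 + ω ^ 2)⁻¹ * T + ω * (Mw ω * (3 * (T +
            (2 + (m + 2) ^ 2 * Real.pi) ^ 2 * N')))) := by
        have hK : 0 ≤ 2 + ((m:ℝ) + 2) ^ 2 * Real.pi := by positivity
        have hE : 0 ≤ 4 * B * (1 + ω ^ 2)⁻¹ := by positivity
        generalize 2 + ((m:ℝ) + 2) ^ 2 * Real.pi = K at hK ⊢
        generalize 4 * B * (1 + ω ^ 2)⁻¹ = E at hE ⊢
        rw [hN', ENNReal.ofReal_add (by positivity) (by positivity), ENNReal.ofReal_mul hE,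
          ENNReal.ofReal_mul hω'.le, ENNReal.ofReal_mul hM, ENNReal.ofReal_mul (p := 3) (by positivity),
          ENNReal.ofReal_add hT.le (by positivity), ENNReal.ofReal_mul (q := N') (by positivity),
          ENNReal.ofReal_pow hK, ENNReal.ofReal_ofNat]
    _ ≤ _ := by
        refine ENNReal.ofReal_le_ofReal ?_
        have h1 := mul_le_mul_of_nonneg_left (spectral_bound_le hω')
          (by positivity : 0 ≤ ω * Mw ω * (3 * N'))
        simp only [← hm] at h1
        refine le_trans (le_of_eq ?_)
          (add_le_add (le_refl (4 * B * (1 + ω ^ 2)⁻¹ * T + 3 * T * ω * Mw ω)) h1 |>.trans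
            (le_of_eq ?_))
        · ring
        · ring

theorem aestronglyMeasurable_spectral (h : RegularSol T u) :
    AEStronglyMeasurable (Function.uncurry fun (x : ℝ) (z : ℝ × ℝ) => spectral T u z.1 x z.2)
      ((volume.restrict (Ioo (0:ℝ) 1)).prod
        ((volume.restrict (Ioo 0 T)).prod (volume.restrict (Ioi 0)))) := by
  have hω : ∀ᵐ ω ∂(volume.restrict (Ioi (0:ℝ))), ω ∈ Ioi (0:ℝ) := ae_restrict_mem measurableSet_Ioi
  refine aestronglyMeasurable_uncurry_of_continuous ?_ (fun x => ?_) _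
  · filter_upwards [Measure.quasiMeasurePreserving_snd.ae hω] with z hz
    exact (h.sepCont_spectral hz).right z.1
  · refine aestronglyMeasurable_uncurry_of_continuous ?_
      (fun t => (h.integrableOn_spectral t x).aestronglyMeasurable) _
    filter_upwards [hω] with ω hω
    exact (h.sepCont_spectral hω).left x

theorem ae_lintegral_neg_spectral_lt_top (h : RegularSol T u) (hb : SignedBoundary T η u) :
    ∀ᵐ x ∂(volume.restrict (Ioo (0:ℝ) 1)),
      AEStronglyMeasurable (Function.uncurry fun t ω => spectral T u t x ω)
        ((volume.restrict (Ioo 0 T)).prod (volume.restrict (Ioi 0))) ∧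
      ∫⁻ z, ENNReal.ofReal (-spectral T u z.1 x z.2)
        ∂((volume.restrict (Ioo 0 T)).prod (volume.restrict (Ioi 0))) < ⊤ := by
  obtain ⟨D, hD, hDb⟩ := h.exists_lintegral_neg_spectral_le hb
  have hm := h.aestronglyMeasurable_spectral
  set X := volume.restrict (Ioo (0:ℝ) 1) with hX
  set Y := volume.restrict (Ioo 0 T) with hY
  set Z := volume.restrict (Ioi (0:ℝ)) with hZ
  have hm2 : AEMeasurable (fun p : ℝ × ℝ × ℝ => ENNReal.ofReal (-spectral T u p.2.1 p.1 p.2.2))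
      (X.prod (Y.prod Z)) := hm.aemeasurable.neg.ennreal_ofReal
  have hfin : ∫⁻ p, ENNReal.ofReal (-spectral T u p.2.1 p.1 p.2.2) ∂(X.prod (Y.prod Z)) < ⊤ := by
    have mp := measurePreserving_prodAssoc X Y Z
    rw [← mp.lintegral_comp_emb MeasurableEquiv.prodAssoc.measurableEmbedding]
    refine (lintegral_prod_symm _
      (hm2.comp_quasiMeasurePreserving mp.quasiMeasurePreserving)).trans_lt ?_
    refine lt_of_le_of_lt (setLIntegral_mono' measurableSet_Ioi fun ω hω => ?_)
      hD.lintegral_lt_top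
    refine le_trans (le_of_eq ?_) (hDb ω hω)
    exact lintegral_prod_swap (μ := Y) (ν := X)
      (fun z : ℝ × ℝ => ENNReal.ofReal (-spectral T u z.1 z.2 ω))
  rw [lintegral_prod _ hm2] at hfin
  filter_upwards [ae_lt_top' hm2.lintegral_prod_right' hfin.ne, hm.prodMk_left] with x h1 h2
  exact ⟨h2, h1⟩

end RegularSol

end

section

open MeasureTheory Set Filter Topology

theorem enorm_eq_ofReal_add_ofReal_neg (r : ℝ) :
    ‖r‖ₑ = ENNReal.ofReal r + ENNReal.ofReal (-r) := by
  rw [← ofReal_norm, Real.norm_eq_abs]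
  rcases le_total 0 r with h | h
  · rw [abs_of_nonneg h, ENNReal.ofReal_of_nonpos (neg_nonpos.2 h), add_zero]
  · rw [abs_of_nonpos h, ENNReal.ofReal_of_nonpos h, zero_add]

/-- If the derivative of a continuous function is a parametric integral whose integrand has an
integrable negative part, then the integrand is jointly integrable. -/
theorem integrable_uncurry_of_lintegral_neg_lt_top {Y : Type*} [MeasurableSpace Y] {ν : Measure Y}
    [SFinite ν] {T : ℝ} (hT : 0 ≤ T) {f : ℝ → Y → ℝ} {P : ℝ → ℝ}
    (hm : AEStronglyMeasurable (Function.uncurry f) ((volume.restrict (Ioo 0 T)).prod ν))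
    (hi : ∀ t, Integrable (f t) ν)
    (hneg : ∫⁻ z, ENNReal.ofReal (-f z.1 z.2) ∂((volume.restrict (Ioo 0 T)).prod ν) < ⊤)
    (hP : ContinuousOn P (Icc 0 T)) (hd : ∀ t ∈ Ioo 0 T, HasDerivAt P (∫ y, f t y ∂ν) t) :
    Integrable (Function.uncurry f) ((volume.restrict (Ioo 0 T)).prod ν) := by
  have hN : Integrable (Function.uncurry fun t y => max (-f t y) 0)
      ((volume.restrict (Ioo 0 T)).prod ν) := by
    refine ⟨(hm.neg.sup aestronglyMeasurable_const : AEStronglyMeasurable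
      (fun z : ℝ × Y => max (-f z.1 z.2) 0) _), ?_⟩
    refine lt_of_eq_of_lt (lintegral_congr fun z => ?_) hneg
    rw [← ofReal_norm, Function.uncurry, Real.norm_of_nonneg (le_max_right _ _),
      ENNReal.ofReal_max]
    simp
  set G : ℝ → ℝ := fun t => ∫ y, f t y ∂ν with hG
  set g : ℝ → ℝ := fun t => ∫ y, max (-f t y) 0 ∂ν with hg
  have hgi : IntegrableOn g (Ioo 0 T) := hN.integral_prod_left
  have hGm : AEStronglyMeasurable G (volume.restrict (Ioo 0 T)) := hm.integral_prod_right'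
  have hg0 : ∀ t, 0 ≤ g t := fun t => integral_nonneg fun y => le_max_right _ _
  have hNi : ∀ t, Integrable (fun y => max (-f t y) 0) ν := fun t => (hi t).neg.pos_part
  have hGg : ∀ t, G t + g t = ∫ y, max (f t y) 0 ∂ν := fun t => by
    simp only [hG, hg]
    rw [← integral_add (hi t) (hNi t)]
    congr 1
    funext y
    rcases le_total 0 (f t y) with h | h
    · rw [max_eq_right (neg_nonpos.2 h), max_eq_left h, add_zero]
    · rw [max_eq_left (neg_nonneg.2 h), max_eq_right h, add_neg_cancel]
  have hGg0 : ∀ t, 0 ≤ G t + g t := fun t => by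
    rw [hGg]
    exact integral_nonneg fun y => le_max_right _ _
  have hφ0 : ∀ (n : ℕ) t, 0 ≤ min (G t) n + g t := fun n t => by
    rcases min_choice (G t) n with h | h
    · rw [h]; exact hGg0 t
    · rw [h]; exact add_nonneg (Nat.cast_nonneg n) (hg0 t)
  have hφi : ∀ n : ℕ, IntegrableOn (fun t => min (G t) n) (Ioo 0 T) := fun n => by
    refine Integrable.mono' (hgi.add (integrable_const (n:ℝ)))
      (hGm.inf aestronglyMeasurable_const) (ae_of_all _ fun t => ?_)
    rw [Real.norm_eq_abs, abs_le]
    have h1 := hφ0 n t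
    have h2 := min_le_right (G t) n
    have h3 := hg0 t
    simp only [Pi.add_apply]
    constructor <;> linarith
  have hφP : ∀ n : ℕ, ∫ t in Ioo 0 T, min (G t) n ≤ P T - P 0 := fun n => by
    rw [← integral_Ioc_eq_integral_Ioo, ← intervalIntegral.integral_of_le hT]
    exact intervalIntegral.integral_le_sub_of_hasDeriv_right_of_le hT hP
      (fun t ht => (hd t ht).hasDerivWithinAt)
      ((hφi n).congr_set_ae Ioo_ae_eq_Icc.symm) fun t _ => min_le_left _ _
  have hb : ∀ n : ℕ, ∫⁻ t in Ioo 0 T, ENNReal.ofReal (min (G t) n + g t) ≤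
      ENNReal.ofReal (P T - P 0 + ∫ t in Ioo 0 T, g t) := fun n => by
    rw [← ofReal_integral_eq_lintegral_ofReal (f := fun t => min (G t) n + g t)
      ((hφi n).add hgi) (ae_of_all _ (hφ0 n)), integral_add (hφi n) hgi]
    exact ENNReal.ofReal_le_ofReal (add_le_add (hφP n) le_rfl)
  have hpos : ∫⁻ t in Ioo 0 T, ENNReal.ofReal (G t + g t) < ⊤ := by
    have hlim : ∀ t, liminf (fun n : ℕ => ENNReal.ofReal (min (G t) n + g t)) atTop =
        ENNReal.ofReal (G t + g t) := fun t => by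
      refine Tendsto.liminf_eq (tendsto_const_nhds.congr' ?_)
      filter_upwards [eventually_ge_atTop ⌈G t⌉₊] with n hn
      rw [min_eq_left (Nat.ceil_le.1 hn)]
    simp only [← hlim]
    refine (lintegral_liminf_le' fun n =>
      ((hφi n).add hgi).aestronglyMeasurable.aemeasurable.ennreal_ofReal).trans_lt ?_
    refine (liminf_le_liminf (Eventually.of_forall hb)).trans_lt ?_
    simp
  refine ⟨hm, ?_⟩
  have m1 := hm.aemeasurable.ennreal_ofReal
  rw [HasFiniteIntegral]
  simp only [enorm_eq_ofReal_add_ofReal_neg]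
  rw [lintegral_add_left' m1, lintegral_prod _ m1]
  refine ENNReal.add_lt_top.2 ⟨lt_of_eq_of_lt (lintegral_congr fun t => ?_) hpos, hneg⟩
  rw [hGg, ofReal_integral_eq_lintegral_ofReal (hi t).pos_part
    (ae_of_all _ fun y => le_max_right _ _)]
  simp [Function.uncurry, ENNReal.ofReal_max]

/-- Fundamental theorem of calculus and Fubini's theorem under the previous assumptions. -/
theorem integral_integral_eq_sub {Y : Type*} [MeasurableSpace Y] {ν : Measure Y}
    [SFinite ν] {T : ℝ} {f : ℝ → Y → ℝ} {P : ℝ → ℝ}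
    (hf : Integrable (Function.uncurry f) ((volume.restrict (Ioo 0 T)).prod ν))
    (hP : ContinuousOn P (Icc 0 T)) (hd : ∀ t ∈ Ioo 0 T, HasDerivAt P (∫ y, f t y ∂ν) t)
    {t₁ t₂ : ℝ} (h1 : 0 ≤ t₁) (h12 : t₁ ≤ t₂) (h2 : t₂ ≤ T) :
    Integrable (fun y => ∫ s in t₁..t₂, f s y) ν ∧
      ∫ y, (∫ s in t₁..t₂, f s y) ∂ν = P t₂ - P t₁ := by
  have hsub : Ioo t₁ t₂ ⊆ Ioo 0 T := Ioo_subset_Ioo h1 h2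
  have hf' : Integrable (Function.uncurry f) ((volume.restrict (Ioo t₁ t₂)).prod ν) :=
    hf.mono_measure (Measure.prod_mono (Measure.restrict_mono hsub le_rfl) le_rfl)
  have e : ∀ y, ∫ s in t₁..t₂, f s y = ∫ s in Ioo t₁ t₂, f s y := fun y => by
    rw [intervalIntegral.integral_of_le h12, integral_Ioc_eq_integral_Ioo]
  simp only [e]
  refine ⟨hf'.integral_prod_right, ?_⟩
  rw [← integral_integral_swap hf', ← integral_Ioc_eq_integral_Ioo,
    ← intervalIntegral.integral_of_le h12]
  refine intervalIntegral.integral_eq_sub_of_hasDerivAt_of_le h12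
    (hP.mono (Icc_subset_Icc h1 h2)) (fun t ht => hd t (hsub ht)) ?_
  exact (intervalIntegrable_iff_integrableOn_Ioo_of_le h12).2 hf'.integral_prod_left

namespace RegularSol
variable {T : ℝ} {u : ℝ → ℝ → ℝ → ℝ → ℝ} {η : ℝ → ℝ} {t t₁ t₂ x μ ω : ℝ}

/-- The increments of the potential are the increments of the total energy. -/
theorem ae_potential_sub_eq (h : RegularSol T u) (hb : SignedBoundary T η u) :
    ∀ᵐ x ∂(volume.restrict (Ioo (0:ℝ) 1)), ∀ t₁ t₂, 0 ≤ t₁ → t₁ ≤ t₂ → t₂ ≤ T →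
      IntegrableOn (fun ω => ω * ∫ μ in Icc (-1:ℝ) 1, solIncrement T u t₁ t₂ x μ ω) (Ioi 0) ∧
      potential T u t₂ x - potential T u t₁ x =
        ∫ ω in Ioi (0:ℝ), ω * ∫ μ in Icc (-1:ℝ) 1, solIncrement T u t₁ t₂ x μ ω := by
  filter_upwards [h.ae_lintegral_neg_spectral_lt_top hb, ae_restrict_mem measurableSet_Ioo]
    with x hx hx01 t₁ t₂ h1 h12 h2
  have hx' := Ioo_subset_Icc_self hx01
  have hP : ContinuousOn (fun t => potential T u t x) (Icc 0 T) :=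
    (h.sepCont_potential.left x).continuousOn
  have hd : ∀ t ∈ Ioo 0 T, HasDerivAt (fun t => potential T u t x)
      (∫ ω in Ioi (0:ℝ), spectral T u t x ω) t := fun t ht => by
    rw [← bracket_eq_integral_spectral (Ioo_subset_Icc_self ht) hx']
    exact h.hasDerivAt_potential ht hx'
  have hf := integrable_uncurry_of_lintegral_neg_lt_top h.pos.le hx.1
    (fun t => h.integrableOn_spectral t x) hx.2 hP hd
  have key := integral_integral_eq_sub hf hP hd h1 h12 h2
  have e : ∀ ω ∈ Ioi (0:ℝ), ∫ s in t₁..t₂, spectral T u s x ω =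
      ω * ∫ μ in Icc (-1:ℝ) 1, solIncrement T u t₁ t₂ x μ ω := fun ω hω => by
    have := (h.integral_solIncrement hω (w := fun _ => 1) measurable_const (by simp) h12 x).2
    simp only [one_mul] at this
    rw [this, ← intervalIntegral.integral_const_mul]
    simp only [spectral, integral_const_mul]
  exact ⟨(integrableOn_congr_fun e measurableSet_Ioi).1 key.1,
    by rw [← key.2, setIntegral_congr_fun measurableSet_Ioi e]⟩

end RegularSol

end

section

open MeasureTheory Set Filter Topology

namespace RegularSol
variable {T : ℝ} {u : ℝ → ℝ → ℝ → ℝ → ℝ} {η : ℝ → ℝ} {t t₁ t₂ x μ ω N : ℝ}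

theorem integral_exp_decay (hω : 0 < ω) (hT : 0 ≤ T) :
    IntegrableOn (fun σ => Real.exp (-ω * σ) * (Iio T).indicator (fun _ => -N) σ) (Ioi 0) ∧
    ∫ σ in Ioi (0:ℝ), Real.exp (-ω * σ) * (Iio T).indicator (fun _ => -N) σ =
      -(N * ((1 - Real.exp (-ω * T)) / ω)) := by
  have e : (fun σ => Real.exp (-ω * σ) * (Iio T).indicator (fun _ => -N) σ) =
      (Iio T).indicator fun σ => Real.exp (-ω * σ) * -N := by
    funext σ
    by_cases h : σ ∈ Iio T
    · rw [indicator_of_mem h, indicator_of_mem h]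
    · rw [indicator_of_notMem h, indicator_of_notMem h, mul_zero]
  have hi : IntegrableOn (fun σ => Real.exp (-ω * σ) * -N) (Ioi 0) :=
    (exp_neg_integrableOn_Ioi 0 hω).mul_const _
  rw [e]
  refine ⟨hi.indicator measurableSet_Iio, ?_⟩
  rw [setIntegral_indicator measurableSet_Iio, Ioi_inter_Iio, ← integral_Ioc_eq_integral_Ioo,
    ← intervalIntegral.integral_of_le hT, intervalIntegral.integral_mul_const,
    intervalIntegral.integral_comp_mul_left Real.exp (neg_ne_zero.2 hω.ne'), integral_exp,
    mul_zero, Real.exp_zero, smul_eq_mul]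
  field_simp
  ring

/-- The potential decreases at most by `N`. -/
def PotentialDropLE (T : ℝ) (u : ℝ → ℝ → ℝ → ℝ → ℝ) (N : ℝ) : Prop :=
  ∀ t₁ t₂, 0 ≤ t₁ → t₁ ≤ t₂ → t₂ < T → ∀ x ∈ Icc (0:ℝ) 1,
    -N ≤ potential T u t₂ x - potential T u t₁ x

theorem potIncrement_eq_zero (hx : x ∉ Ioo (0:ℝ) 1) : potIncrement T u t₁ t₂ x = 0 := by
  rw [potIncrement, cutoff_of_notMem hx, cutoff_of_notMem hx, sub_zero]

theorem potIncrement_ge (h : RegularSol T u) (hN : 0 ≤ N) (hQ : PotentialDropLE T u N)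
    (h12 : t₁ ≤ t₂) (h2 : t₂ < T) (σ : ℝ) (hσ : 0 < σ) (x : ℝ) :
    (Iio T).indicator (fun _ => -N) σ ≤ potIncrement T u (t₁ - σ) (t₂ - σ) x := by
  by_cases hx : x ∈ Ioo (0:ℝ) 1
  · by_cases hσT : σ ∈ Iio T
    · rw [indicator_of_mem hσT, potIncrement, cutoff_of_mem (by linarith) hx,
        cutoff_of_mem (by linarith) hx]
      have e : ∀ s, potential T u s x = potential T u (max s 0) x := fun s => by
        rcases le_total s 0 with hs | hs
        · rw [max_eq_right hs, h.potential_of_nonpos s hs, h.potential_of_nonpos 0 le_rfl]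
        · rw [max_eq_left hs]
      rw [e (t₁ - σ), e (t₂ - σ)]
      refine hQ _ _ (le_max_right _ _) (max_le_max (by linarith) le_rfl) (max_lt (by linarith) h.pos)
        x (Ioo_subset_Icc_self hx)
    · have hσT' : T ≤ σ := not_lt.1 hσT
      rw [indicator_of_notMem hσT, potIncrement,
        cutoff_of_nonpos h.potential_of_nonpos (by linarith),
        cutoff_of_nonpos h.potential_of_nonpos (by linarith), sub_zero]
  · rw [potIncrement_eq_zero hx]
    exact indicator_apply_le' (fun _ => neg_nonpos.2 hN) fun _ => le_rfl

theorem solIncrement_right_ge_of_drop (h : RegularSol T u) (hb : SignedBoundary T η u) (hN : 0 ≤ N)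
    (hQ : PotentialDropLE T u N) (hμ : μ ∈ Ioc (0:ℝ) 1) (hω : ω ∈ Ioi (0:ℝ)) (h12 : t₁ ≤ t₂)
    (h2 : t₂ < T) (hx : x ∈ Icc (0:ℝ) 1) :
    -(N * Mw ω * ((1 - Real.exp (-ω * T)) / ω)) ≤ solIncrement T u t₁ t₂ x μ ω := by
  refine le_trans ?_ (h.solIncrement_right_ge hb hμ hω h12 h2 hx)
  have hi := integral_exp_decay (N := N) (mem_Ioi.1 hω) h.pos.le
  have h1 := setIntegral_mono_on hi.1
    (h.integrableOn_ray_increment (mem_Ioi.1 hω) t₁ t₂ x (-(μ * ω))) measurableSet_Ioi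
    fun σ hσ => mul_le_mul_of_nonneg_left
      (h.potIncrement_ge hN hQ h12 h2 σ hσ (x + -(μ * ω) * σ)) (Real.exp_pos _).le
  rw [hi.2] at h1
  have := mul_le_mul_of_nonneg_left h1 (Mw_pos (mem_Ioi.1 hω)).le
  linarith

theorem solIncrement_left_ge_of_drop (h : RegularSol T u) (hb : SignedBoundary T η u) (hN : 0 ≤ N)
    (hQ : PotentialDropLE T u N) (hμ : μ ∈ Ioc (0:ℝ) 1) (hω : ω ∈ Ioi (0:ℝ)) (h12 : t₁ ≤ t₂)
    (h2 : t₂ < T) (hx : x ∈ Icc (0:ℝ) 1) :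
    -(N * Mw ω * ((1 - Real.exp (-ω * T)) / ω)) ≤ solIncrement T u t₁ t₂ x (-μ) ω := by
  refine le_trans ?_ (h.solIncrement_left_ge hb hμ hω h12 h2 hx)
  have hω' := mem_Ioi.1 hω
  have hi := integral_exp_decay (N := N) hω' h.pos.le
  have i1 := h.integrableOn_ray_increment hω' t₁ t₂ x (μ * ω)
  have i2 := (h.integrableOn_ray_increment hω' t₁ t₂ (2 - x) (-(μ * ω))).const_mul (η ω)
  have hη := hb.coeff ω hω
  have h1 := setIntegral_mono_on hi.1 (i1.add i2) measurableSet_Ioi fun σ hσ => by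
    have hp := Real.exp_pos (-ω * σ)
    have hI : (Iio T).indicator (fun _ => -N) σ ≤ 0 :=
      indicator_apply_le' (fun _ => neg_nonpos.2 hN) fun _ => le_rfl
    have key : (Iio T).indicator (fun _ => -N) σ ≤
        potIncrement T u (t₁ - σ) (t₂ - σ) (x + μ * ω * σ) +
        η ω * potIncrement T u (t₁ - σ) (t₂ - σ) (2 - x + -(μ * ω) * σ) := by
      rcases lt_or_ge (x + μ * ω * σ) 1 with hc | hc
      · rw [potIncrement_eq_zero (x := 2 - x + -(μ * ω) * σ) fun h => by linarith [h.2], mul_zero,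
          add_zero]
        exact h.potIncrement_ge hN hQ h12 h2 σ hσ _
      · rw [potIncrement_eq_zero (x := x + μ * ω * σ) fun h => by linarith [h.2], zero_add]
        have := mul_le_mul_of_nonneg_left
          (h.potIncrement_ge hN hQ h12 h2 σ hσ (2 - x + -(μ * ω) * σ)) hη.1
        nlinarith [hη.2]
    have := mul_le_mul_of_nonneg_left key hp.le
    change _ ≤ Real.exp (-ω * σ) * _ + η ω * (Real.exp (-ω * σ) * _)
    linarith
  rw [hi.2] at h1
  have e := integral_add i1 i2
  rw [integral_const_mul] at e
  change _ ≤ ∫ σ in Ioi (0:ℝ), (Real.exp (-ω * σ) * _ + η ω * (Real.exp (-ω * σ) * _)) at h1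
  rw [e] at h1
  have := mul_le_mul_of_nonneg_left h1 (Mw_pos hω').le
  linarith

theorem potentialDropLE_mul (h : RegularSol T u) (hb : SignedBoundary T η u) (hN : 0 ≤ N)
    (hQ : PotentialDropLE T u N) :
    PotentialDropLE T u (2 * (∫ ω in Ioi (0:ℝ), Mw ω * (1 - Real.exp (-ω * T))) * N) := by
  intro t₁ t₂ h1 h12 h2
  set q := 2 * ∫ ω in Ioi (0:ℝ), Mw ω * (1 - Real.exp (-ω * T)) with hq
  have hae : ∀ᵐ x ∂(volume.restrict (Icc (0:ℝ) 1)),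
      max (potential T u t₂ x - potential T u t₁ x) (-(q * N)) =
        potential T u t₂ x - potential T u t₁ x := by
    rw [← restrict_Ioo_eq_restrict_Icc]
    filter_upwards [h.ae_potential_sub_eq hb, ae_restrict_mem measurableSet_Ioo] with x hx hx01
    obtain ⟨i1, e1⟩ := hx t₁ t₂ h1 h12 h2.le
    have hx' := Ioo_subset_Icc_self hx01
    rw [max_eq_left]
    have hi := (integrableOn_Mw_mul_one_sub_exp h.pos.le).const_mul (-(2 * N))
    have e2 : -(q * N) = ∫ ω in Ioi (0:ℝ), -(2 * N) * (Mw ω * (1 - Real.exp (-ω * T))) := by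
      rw [integral_const_mul, hq]
      ring
    rw [e1, e2]
    refine setIntegral_mono_on hi i1 measurableSet_Ioi fun ω hω => ?_
    have hω' := mem_Ioi.1 hω
    have hS := h.integral_solIncrement hω (w := fun _ => 1) measurable_const (by simp) h12 x
    simp only [one_mul] at hS
    have hV := integral_velocity_eq hS.1
    have h3 := setIntegral_mono_on (integrableOn_const (by simp)) (hV.1.add hV.2.1)
      (measurableSet_Ioc (a := (0:ℝ)) (b := 1)) fun μ hμ =>
      add_le_add (h.solIncrement_right_ge_of_drop hb hN hQ hμ hω h12 h2 hx')
        (h.solIncrement_left_ge_of_drop hb hN hQ hμ hω h12 h2 hx')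
    rw [hV.2.2]
    rw [setIntegral_const, Real.volume_real_Ioc_of_le zero_le_one, sub_zero, one_smul] at h3
    have h4 := mul_le_mul_of_nonneg_left h3 hω'.le
    simp only [neg_mul]
    refine le_trans (le_of_eq ?_) h4
    field_simp
    ring
  have hc := h.sepCont_potential
  intro x hx
  have := Measure.eqOn_Icc_of_ae_eq volume zero_ne_one hae
    ((((hc.right t₂).sub (hc.right t₁)).max continuous_const).continuousOn)
    (((hc.right t₂).sub (hc.right t₁)).continuousOn) hx
  exact max_eq_left_iff.1 this

theorem potentialDropLE_zero (h : RegularSol T u) (hb : SignedBoundary T η u) :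
    PotentialDropLE T u 0 := by
  set q := 2 * ∫ ω in Ioi (0:ℝ), Mw ω * (1 - Real.exp (-ω * T)) with hq
  have hq1 : q < 1 := two_mul_integral_Mw_mul_lt_one h.pos.le
  have hq0 : 0 ≤ q := mul_nonneg two_pos.le (setIntegral_nonneg measurableSet_Ioi fun ω hω =>
    mul_nonneg (Mw_pos (mem_Ioi.1 hω)).le (sub_nonneg.2 (Real.exp_le_one_iff.2
      (by nlinarith [mem_Ioi.1 hω, h.pos]))))
  obtain ⟨B, hB⟩ := h.sepCont_potential.bdd (max T 1)
  have hB' : ∀ t, 0 ≤ t → t < T → ∀ x ∈ Icc (0:ℝ) 1, |potential T u t x| ≤ B :=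
    fun t h0 h1 x hx => hB t x (by rw [abs_of_nonneg h0]; exact h1.le.trans (le_max_left _ _))
      (by rw [abs_of_nonneg hx.1]; exact hx.2.trans (le_max_right _ _))
  have hB0 : 0 ≤ B := (abs_nonneg _).trans (hB' 0 le_rfl h.pos 0 (by simp))
  have hk : ∀ k : ℕ, PotentialDropLE T u (q ^ k * (2 * B)) := fun k => by
    induction k with
    | zero =>
      intro t₁ t₂ h1 h12 h2 x hx
      have a1 := abs_le.1 (hB' t₁ h1 (h12.trans_lt h2) x hx)
      have a2 := abs_le.1 (hB' t₂ (h1.trans h12) h2 x hx)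
      simp only [pow_zero, one_mul]
      linarith [a1.2, a2.1]
    | succ k ih =>
      have := h.potentialDropLE_mul hb (by positivity) ih
      rwa [← hq, ← mul_assoc, ← pow_succ'] at this
  intro t₁ t₂ h1 h12 h2 x hx
  have hlim : Tendsto (fun k : ℕ => -(q ^ k * (2 * B))) atTop (𝓝 (-0)) := by
    have := ((tendsto_pow_atTop_nhds_zero_of_lt_one hq0 hq1).mul_const (2 * B)).neg
    rwa [zero_mul] at this
  exact le_of_tendsto' hlim fun k => hk k t₁ t₂ h1 h12 h2 x hx

/-- A continuous function all of whose integrals over short intervals are nonnegative. -/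
theorem nonneg_of_primitive_monotone {f : ℝ → ℝ} (hf : Continuous f)
    (hmono : ∀ t₁ t₂, t₁ ≤ t₂ → t₂ < T → 0 ≤ (∫ s in (0:ℝ)..t₂, f s) - ∫ s in (0:ℝ)..t₁, f s)
    (ht : t ≤ T) : 0 ≤ f t := by
  have h1 : ∀ s ∈ Iio T, 0 ≤ f s := fun s hs => by
    have hm : MonotoneOn (fun t => ∫ s in (0:ℝ)..t, f s) (Iio T) := fun a _ b hb hab =>
      sub_nonneg.1 (hmono a b hab hb)
    have h2 := hm.derivWithin_nonneg (x := s)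
    rw [derivWithin_of_isOpen isOpen_Iio hs] at h2
    rwa [hf.deriv_integral f 0 s] at h2
  have h3 : closure (Iio T) ⊆ {s | 0 ≤ f s} :=
    closure_minimal h1 (isClosed_le continuous_const hf)
  rw [closure_Iio] at h3
  exact h3 ht

/-- Maximum principle for the phonon transport equation. -/
theorem nonneg (h : RegularSol T u) (hb : SignedBoundary T η u) (ht : t ∈ Icc 0 T)
    (hx : x ∈ Icc (0:ℝ) 1) (hμ : μ ∈ Ioc (0:ℝ) 1) (hω : ω ∈ Ioi (0:ℝ)) :
    0 ≤ u t x μ ω ∧ 0 ≤ u t x (-μ) ω := by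
  have hQ := h.potentialDropLE_zero hb
  rw [← clampSol_of_mem (u := u) ht hx, ← clampSol_of_mem (u := u) ht hx]
  constructor
  · refine nonneg_of_primitive_monotone (f := fun s => clampSol T u s x μ ω)
      ((h.sepCont_clampSol (mem_velocity hμ) hω).left x)
      (fun t₁ t₂ h12 h2 => ?_) ht.2
    have := h.solIncrement_right_ge_of_drop hb le_rfl hQ hμ hω h12 h2 hx
    rwa [zero_mul, zero_mul, neg_zero] at this
  · refine nonneg_of_primitive_monotone (f := fun s => clampSol T u s x (-μ) ω)
      ((h.sepCont_clampSol (neg_mem_velocity hμ) hω).left x)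
      (fun t₁ t₂ h12 h2 => ?_) ht.2
    have := h.solIncrement_left_ge_of_drop hb le_rfl hQ hμ hω h12 h2 hx
    rwa [zero_mul, zero_mul, neg_zero] at this

theorem bracket_nonneg (h : RegularSol T u) (hb : SignedBoundary T η u) (ht : t ∈ Icc 0 T)
    (hx : x ∈ Icc (0:ℝ) 1) : 0 ≤ bracket fun μ ω => ω * u t x μ ω := by
  refine setIntegral_nonneg measurableSet_Ioi fun ω hω => ?_
  rw [(integral_velocity_eq ((h.int t ht x hx).1 ω hω)).2.2]
  refine setIntegral_nonneg measurableSet_Ioc fun μ hμ => ?_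
  have hu := h.nonneg hb ht hx hμ hω
  exact add_nonneg (mul_nonneg (mem_Ioi.1 hω).le hu.1) (mul_nonneg (mem_Ioi.1 hω).le hu.2)

end RegularSol

end

section

open MeasureTheory Set Filter Topology

theorem BracketIntegrable.linComb {f g : ℝ → ℝ → ℝ} (hf : BracketIntegrable f)
    (hg : BracketIntegrable g) (a b : ℝ) :
    BracketIntegrable (fun μ ω => a * f μ ω + b * g μ ω) ∧
    bracket (fun μ ω => a * f μ ω + b * g μ ω) = a * bracket f + b * bracket g := by
  have e : ∀ ω ∈ Ioi (0:ℝ), a * (∫ μ in Icc (-1:ℝ) 1, f μ ω) + b * (∫ μ in Icc (-1:ℝ) 1, g μ ω) =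
      ∫ μ in Icc (-1:ℝ) 1, (a * f μ ω + b * g μ ω) := fun ω hω => by
    rw [integral_add ((hf.1 ω hω).const_mul a) ((hg.1 ω hω).const_mul b), integral_const_mul,
      integral_const_mul]
  refine ⟨⟨fun ω hω => ((hf.1 ω hω).const_mul a).add ((hg.1 ω hω).const_mul b),
    IntegrableOn.congr_fun ((hf.2.const_mul a).add (hg.2.const_mul b)) e measurableSet_Ioi⟩, ?_⟩
  rw [bracket, ← setIntegral_congr_fun measurableSet_Ioi e,
    integral_add (hf.2.const_mul a) (hg.2.const_mul b), integral_const_mul, integral_const_mul]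
  rfl

namespace RegularSol
variable {T : ℝ} {u v : ℝ → ℝ → ℝ → ℝ → ℝ} {t x : ℝ}

theorem bracket_linComb (hu : RegularSol T u) (hv : RegularSol T v) (a b : ℝ)
    (ht : t ∈ Icc 0 T) (hx : x ∈ Icc (0:ℝ) 1) :
    BracketIntegrable (fun μ ω => ω * (a * u t x μ ω + b * v t x μ ω)) ∧
    bracket (fun μ ω => ω * (a * u t x μ ω + b * v t x μ ω)) =
      a * bracket (fun μ ω => ω * u t x μ ω) + b * bracket (fun μ ω => ω * v t x μ ω) := by
  have := (hu.int t ht x hx).linComb (hv.int t ht x hx) a b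
  have e : (fun μ ω => ω * (a * u t x μ ω + b * v t x μ ω)) =
      fun μ ω => a * (ω * u t x μ ω) + b * (ω * v t x μ ω) := by
    funext μ ω
    ring
  rwa [e]

theorem linComb (hu : RegularSol T u) (hv : RegularSol T v) (a b : ℝ) :
    RegularSol T fun t x μ ω => a * u t x μ ω + b * v t x μ ω where
  pos := hu.pos
  pte t ht x hx μ hμ ω hω := by
    obtain ⟨u1, u2, u3⟩ := hu.pte t ht x hx μ hμ ω hω
    obtain ⟨v1, v2, v3⟩ := hv.pte t ht x hx μ hμ ω hω
    have d1 := (u1.hasDerivAt.const_mul a).add (v1.hasDerivAt.const_mul b)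
    have d2 := (u2.hasDerivAt.const_mul a).add (v2.hasDerivAt.const_mul b)
    refine ⟨d1.differentiableAt, d2.differentiableAt, ?_⟩
    refine (congrArg₂ (fun p q => p + μ * ω * q) d1.deriv d2.deriv).trans ?_
    rw [coll] at u3 v3
    rw [coll, (hu.bracket_linComb hv a b ht hx).2]
    linear_combination a * u3 + b * v3
  bdd := by
    obtain ⟨B, hB⟩ := hu.bdd
    obtain ⟨C, hC⟩ := hv.bdd
    refine ⟨|a| * B + |b| * C, fun t x μ ω => (abs_add_le _ _).trans ?_⟩
    rw [abs_mul, abs_mul]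
    gcongr
    exacts [hB t x μ ω, hC t x μ ω]
  int t ht x hx := (hu.bracket_linComb hv a b ht hx).1
  init x hx μ hμ ω hω := by
    simp only [hu.init x hx μ hμ ω hω, hv.init x hx μ hμ ω hω, mul_zero, add_zero]

end RegularSol

theorem IsForwardSolution.regularSol {T : ℝ} {η : ℝ → ℝ} {φ : ℝ → ℝ → ℝ → ℝ}
    {g : ℝ → ℝ → ℝ → ℝ → ℝ} (h : IsForwardSolution T η φ g) (hT : 0 < T) (hb : BoundedFn g)
    (hi : BracketIntegrableSol T g) : RegularSol T g :=
  ⟨hT, h.1, hb, hi, h.2.1⟩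

theorem IsForwardSolution.reflection {T : ℝ} {η : ℝ → ℝ} {φ : ℝ → ℝ → ℝ → ℝ}
    {g : ℝ → ℝ → ℝ → ℝ → ℝ} (h : IsForwardSolution T η φ g) {t μ ω : ℝ} (ht : t ∈ Icc 0 T)
    (hμ : μ ∈ Ioc (0:ℝ) 1) (hω : ω ∈ Ioi (0:ℝ)) : g t 1 (-μ) ω = η ω * g t 1 μ ω := by
  have := h.2.2.2 t ht (-μ) ⟨by linarith [hμ.2], by linarith [hμ.1]⟩ ω hω
  rwa [neg_neg] at this

end

/-- Theorem A.1 (convexity of the forward map in the reflection coefficient):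
with `α, β ≥ 0`, `α + β = 1`, `η₁ ≥ η₂` pointwise and a bounded nonnegative
incoming datum `φ`, the bounded forward solutions `g₁, g₂, g` for reflection
coefficients `η₁`, `η₂` and `α η₁ + β η₂` satisfy, for all `t ∈ [0, Tmax]`,
`⟨ω g⟩(t,0) ≤ α ⟨ω g₁⟩(t,0) + β ⟨ω g₂⟩(t,0)`; equivalently, with
`ΔT = ⟨ω g⟩/⟨ω g*⟩`, `α ΔT_{g₁}(t,0) + β ΔT_{g₂}(t,0) ≥ ΔT_g(t,0)`. -/
theorem forward_map_convex (Tmax : ℝ) (hT : 0 < Tmax) (α β : ℝ)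
    (hα : 0 ≤ α) (hβ : 0 ≤ β) (hαβ : α + β = 1)
    (η₁ η₂ : ℝ → ℝ) (φ : ℝ → ℝ → ℝ → ℝ) (g₁ g₂ g : ℝ → ℝ → ℝ → ℝ → ℝ)
    (hη₁ : ∀ ω ∈ Ioi (0:ℝ), η₁ ω ∈ Icc (0:ℝ) 1)
    (hη₂ : ∀ ω ∈ Ioi (0:ℝ), η₂ ω ∈ Icc (0:ℝ) 1)
    (hmono : ∀ ω ∈ Ioi (0:ℝ), η₂ ω ≤ η₁ ω)
    (hφbdd : ∃ Cφ, ∀ t μ ω, |φ t μ ω| ≤ Cφ)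
    (hφpos : ∀ t ∈ Icc (0:ℝ) Tmax, ∀ μ ∈ Ioc (0:ℝ) 1, ∀ ω ∈ Ioi (0:ℝ), 0 ≤ φ t μ ω)
    (hb₁ : BoundedFn g₁) (hb₂ : BoundedFn g₂) (hb : BoundedFn g)
    (hi₁ : BracketIntegrableSol Tmax g₁) (hi₂ : BracketIntegrableSol Tmax g₂)
    (hi : BracketIntegrableSol Tmax g)
    (hs₁ : IsForwardSolution Tmax η₁ φ g₁) (hs₂ : IsForwardSolution Tmax η₂ φ g₂)
    (hs : IsForwardSolution Tmax (fun ω => α * η₁ ω + β * η₂ ω) φ g) :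
    ∀ t ∈ Icc (0:ℝ) Tmax,
      bracket (fun μ ω => ω * g t 0 μ ω)
          ≤ α * bracket (fun μ ω => ω * g₁ t 0 μ ω)
            + β * bracket (fun μ ω => ω * g₂ t 0 μ ω) ∧
      bracket (fun μ ω => ω * g t 0 μ ω) / wgstar
          ≤ α * (bracket (fun μ ω => ω * g₁ t 0 μ ω) / wgstar)
            + β * (bracket (fun μ ω => ω * g₂ t 0 μ ω) / wgstar) := by
  have r₁ := hs₁.regularSol hT hb₁ hi₁
  have r₂ := hs₂.regularSol hT hb₂ hi₂
  have r := hs.regularSol hT hb hi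
  have h1 : (1:ℝ) ∈ Icc (0:ℝ) 1 := ⟨zero_le_one, le_rfl⟩
  have h0 : (0:ℝ) ∈ Icc (0:ℝ) 1 := ⟨le_rfl, zero_le_one⟩
  have s₂ : SignedBoundary Tmax η₂ g₂ := ⟨hη₂, fun t ht μ hμ ω hω => by
    rw [hs₂.2.2.1 t ht μ hμ ω hω]
    exact hφpos t ht μ hμ ω hω, fun t ht μ hμ ω hω => (hs₂.reflection ht hμ hω).ge⟩
  have re := r₁.linComb r₂ 1 (-1)
  have se : SignedBoundary Tmax η₁ fun t x μ ω => 1 * g₁ t x μ ω + -1 * g₂ t x μ ω := by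
    refine ⟨hη₁, fun t ht μ hμ ω hω => ?_, fun t ht μ hμ ω hω => ?_⟩
    · simp only [hs₁.2.2.1 t ht μ hμ ω hω, hs₂.2.2.1 t ht μ hμ ω hω]
      linarith
    · simp only [hs₁.reflection ht hμ hω, hs₂.reflection ht hμ hω]
      have := mul_nonneg (sub_nonneg.2 (hmono ω hω)) (r₂.nonneg s₂ ht h1 hμ hω).1
      linarith
  have rd := (r₁.linComb r₂ α β).linComb r 1 (-1)
  have sd : SignedBoundary Tmax (fun ω => α * η₁ ω + β * η₂ ω) fun t x μ ω =>
      1 * (α * g₁ t x μ ω + β * g₂ t x μ ω) + -1 * g t x μ ω := by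
    refine ⟨fun ω hω => ⟨?_, ?_⟩, fun t ht μ hμ ω hω => ?_, fun t ht μ hμ ω hω => ?_⟩
    · exact add_nonneg (mul_nonneg hα (hη₁ ω hω).1) (mul_nonneg hβ (hη₂ ω hω).1)
    · have := mul_le_mul_of_nonneg_left (hη₁ ω hω).2 hα
      have := mul_le_mul_of_nonneg_left (hη₂ ω hω).2 hβ
      linarith
    · simp only [hs₁.2.2.1 t ht μ hμ ω hω, hs₂.2.2.1 t ht μ hμ ω hω, hs.2.2.1 t ht μ hμ ω hω]
      refine le_of_eq ?_
      linear_combination (-φ t μ ω) * hαβ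
    · simp only [hs₁.reflection ht hμ hω, hs₂.reflection ht hμ hω, hs.reflection ht hμ hω]
      have := mul_nonneg (mul_nonneg hα hβ) (mul_nonneg (sub_nonneg.2 (hmono ω hω))
        (re.nonneg se ht h1 hμ hω).1)
      obtain rfl : α = 1 - β := by linarith
      linarith
  intro t ht
  have key := rd.bracket_nonneg sd ht h0
  rw [((r₁.linComb r₂ α β).bracket_linComb r 1 (-1) ht h0).2,
    (r₁.bracket_linComb r₂ α β ht h0).2] at key
  have main : bracket (fun μ ω => ω * g t 0 μ ω) ≤ α * bracket (fun μ ω => ω * g₁ t 0 μ ω)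
      + β * bracket (fun μ ω => ω * g₂ t 0 μ ω) := by
    linarith
  refine ⟨main, (div_le_div_of_nonneg_right main wgstar_pos.le).trans_eq ?_⟩
  ring
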